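/- For every integer t ≥ 1 there exists n_0 such that for all n ≥ n_0, the Turán number of F_5(f_5;t) satisfies ex_3(n, F_5(f_5;t)) = e(T_3(n,3)^{t+}), i.e., it equals the number of hyperedges of the 3-graph obtained from the balanced complete tripartite 3-graph by adding inside each part a maximum 3-graph in which every pair of vertices lies in at most t−1 hyperedges. -/

import Mathlib

open Finset

/-- `H` (a 3-graph given by its edge set on vertex type `V`) contains a copy of the
3-graph `F` (given by its edge set on vertex type `W`). -/
def HasCopy {V W : Type*} [DecidableEq V] [DecidableEq W]
    (H : Finset (Finset V)) (F : Finset (Finset W)) : Prop :=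
  ∃ f : W ↪ V, ∀ e ∈ F, e.image f ∈ H

/-- The Turán number `ex_3(n, F)`: the maximum number of hyperedges of an `F`-free
3-uniform hypergraph on `n` vertices. -/
noncomputable def exThree {W : Type*} [DecidableEq W] (n : ℕ) (F : Finset (Finset W)) : ℕ :=
  sSup {k | ∃ H : Finset (Finset (Fin n)), (∀ e ∈ H, e.card = 3) ∧ ¬ HasCopy H F ∧ H.card = k}

/-- The `i`-th part of the balanced tripartition of `Fin n` (vertices with residue `i` mod 3);
the parts have sizes `⌊n/3⌋` or `⌈n/3⌉`. -/
def turanPart (n : ℕ) (i : Fin 3) : Finset (Fin n) :=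
  Finset.univ.filter (fun v => (v : ℕ) % 3 = (i : ℕ))

/-- The balanced complete tripartite 3-graph `T_3(n,3)`: hyperedges are exactly the triples
with one vertex in each part of the balanced tripartition. -/
def T3 (n : ℕ) : Finset (Finset (Fin n)) :=
  Finset.univ.filter (fun e => e.card = 3 ∧ ∀ i : Fin 3, (e ∩ turanPart n i).card = 1)

/-- The 3-graph `F_5` on `{f_1, …, f_5}` with hyperedges `f_1f_2f_3, f_1f_2f_4, f_3f_4f_5`. -/
def F5 : Finset (Finset (Fin 5)) := {{0,1,2},{0,1,3},{2,3,4}}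

/-- `F_5(f_5;t)`: `F_5` with the vertex `f_5` blown up to `t` copies.
Here `inl 0, inl 1, inl 2, inl 3` play the roles of `f_1,f_2,f_3,f_4` and the
vertices `inr j` are the `t` copies of `f_5`. -/
def F5b5 (t : ℕ) : Finset (Finset (Fin 4 ⊕ Fin t)) :=
  ({({Sum.inl 0, Sum.inl 1, Sum.inl 2} : Finset (Fin 4 ⊕ Fin t)),
    ({Sum.inl 0, Sum.inl 1, Sum.inl 3} : Finset (Fin 4 ⊕ Fin t))} :
      Finset (Finset (Fin 4 ⊕ Fin t))) ∪
  Finset.univ.image (fun j : Fin t => ({Sum.inl 2, Sum.inl 3, Sum.inr j} : Finset (Fin 4 ⊕ Fin t)))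

/-- `F_5(f_3;t)`: `F_5` with the vertex `f_3` blown up to `t` copies.
Here `inl 0, inl 1, inl 2, inl 3` play the roles of `f_1,f_2,f_4,f_5` and the
vertices `inr j` are the `t` copies of `f_3`. -/
def F5b3 (t : ℕ) : Finset (Finset (Fin 4 ⊕ Fin t)) :=
  ({({Sum.inl 0, Sum.inl 1, Sum.inl 2} : Finset (Fin 4 ⊕ Fin t))} :
      Finset (Finset (Fin 4 ⊕ Fin t))) ∪
  Finset.univ.image (fun j : Fin t => ({Sum.inl 0, Sum.inl 1, Sum.inr j} : Finset (Fin 4 ⊕ Fin t))) ∪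
  Finset.univ.image (fun j : Fin t => ({Sum.inr j, Sum.inl 2, Sum.inl 3} : Finset (Fin 4 ⊕ Fin t)))

/-- `S^t(N)` (the size of `D(N,3,t,2)`): the maximum number of hyperedges of a 3-graph on `N`
vertices in which every pair of vertices is contained in at most `t-1` hyperedges. -/
noncomputable def Dmax (N t : ℕ) : ℕ :=
  sSup {k | ∃ H : Finset (Finset (Fin N)), (∀ e ∈ H, e.card = 3) ∧
    (∀ u v : Fin N, u ≠ v → (H.filter (fun e => u ∈ e ∧ v ∈ e)).card ≤ t - 1) ∧ H.card = k}

/-- `e(T_3(n,3)^{t+})`: the number of hyperedges of `T_3(n,3)` together with a maximum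
3-graph inside each part in which every pair of vertices lies in at most `t-1` hyperedges. -/
noncomputable def eT3plus (n t : ℕ) : ℕ :=
  (T3 n).card + ∑ i : Fin 3, Dmax ((turanPart n i).card) t

/-- `F` is a subgraph of a blow-up of `F_5`: every edge is a triple, and there is a map
to `V(F_5)` that is injective on each edge and sends each edge to an edge of `F_5`. -/
def IsSubBlowupF5 {W : Type*} [DecidableEq W] (F : Finset (Finset W)) : Prop :=
  (∀ e ∈ F, e.card = 3) ∧ ∃ φ : W → Fin 5, ∀ e ∈ F, (e.image φ).card = 3 ∧ e.image φ ∈ F5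

/-- The complete tripartite 3-graph with parts `A`, `B`, `C`: all triples with exactly
one vertex in each of `A`, `B`, `C`. -/
def tripartiteEdges {n : ℕ} (A B C : Finset (Fin n)) : Finset (Finset (Fin n)) :=
  Finset.univ.filter (fun e =>
    (e ∩ A).card = 1 ∧ (e ∩ B).card = 1 ∧ (e ∩ C).card = 1 ∧ e.card = 3)

/-- The complete 3-partite 3-graph `K_{t,s,s}` with parts of sizes `t`, `s`, `s`. -/
def Ktss (t s : ℕ) : Finset (Finset (Fin t ⊕ Fin s ⊕ Fin s)) :=
  Finset.univ.image (fun x : Fin t × Fin s × Fin s =>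
    ({Sum.inl x.1, Sum.inr (Sum.inl x.2.1), Sum.inr (Sum.inr x.2.2)} :
      Finset (Fin t ⊕ Fin s ⊕ Fin s)))

/-- All hyperedges of `H` consist of one vertex of the `A`-side (`Fin mA`) and two
vertices of the `B`-side (`Fin nB`). -/
def BipShape (mA nB : ℕ) (H : Finset (Finset (Fin mA ⊕ Fin nB))) : Prop :=
  ∀ e ∈ H, ∃ a : Fin mA, ∃ b c : Fin nB, b ≠ c ∧
    e = ({Sum.inl a, Sum.inr b, Sum.inr c} : Finset (Fin mA ⊕ Fin nB))

/-- `H` contains a copy of `K_{t,s,s}` whose `t`-vertex part lies on the `A`-side and whose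
two `s`-vertex parts lie on the `B`-side. -/
def HasBipKtss (mA nB t s : ℕ) (H : Finset (Finset (Fin mA ⊕ Fin nB))) : Prop :=
  ∃ (T : Finset (Fin mA)) (S0 S1 : Finset (Fin nB)), T.card = t ∧
    S0.card = s ∧ S1.card = s ∧ Disjoint S0 S1 ∧
    ∀ a ∈ T, ∀ b ∈ S0, ∀ c ∈ S1,
      ({Sum.inl a, Sum.inr b, Sum.inr c} : Finset (Fin mA ⊕ Fin nB)) ∈ H

/-- The bipartite Turán number `ex_3^{bip}(mA, nB, K_{t,s,s})`. -/
noncomputable def exBip (mA nB t s : ℕ) : ℕ :=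
  sSup {k | ∃ H : Finset (Finset (Fin mA ⊕ Fin nB)),
    BipShape mA nB H ∧ ¬ HasBipKtss mA nB t s H ∧ H.card = k}

/-- The `s`-set `S_0` inside the residue-0 part of `T_3(3m,3)`. -/
def S0set (m s : ℕ) (h : 2*s ≤ m) : Finset (Fin (3*m)) :=
  Finset.univ.image (fun i : Fin s => (⟨3*i.val, by have := i.isLt; omega⟩ : Fin (3*m)))

/-- The `s`-set `S_1` inside the residue-0 part of `T_3(3m,3)`, disjoint from `S_0`. -/
def S1set (m s : ℕ) (h : 2*s ≤ m) : Finset (Fin (3*m)) :=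
  Finset.univ.image (fun i : Fin s => (⟨3*(s+i.val), by have := i.isLt; omega⟩ : Fin (3*m)))

/-- The 3-graph `F_5^S(m,t,K_{s,s})`: `T_3(3m,3)` (on the `inl` vertices) together with a set
`T` of `t` new vertices (the `inr` vertices) and all triples consisting of one vertex of `T`,
one vertex of `S_0` and one vertex of `S_1`. -/
def F5Stss (m t s : ℕ) (h : 2*s ≤ m) : Finset (Finset (Fin (3*m) ⊕ Fin t)) :=
  (T3 (3*m)).image (fun e => e.image Sum.inl) ∪
  Finset.univ.biUnion (fun j : Fin t =>
    ((S0set m s h) ×ˢ (S1set m s h)).image (fun p =>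
      ({Sum.inr j, Sum.inl p.1, Sum.inl p.2} : Finset (Fin (3*m) ⊕ Fin t))))

/-- `F_sim(t)`: the 3-graph with hyperedges `f_1f_2f_3, f_1f_2f_4, f_3f_4f_5, f_5f_6f_7,
f_6f_7f_8` in which `f_8` is blown up to `t` copies. Here `inl 0, …, inl 6` play the roles
of `f_1, …, f_7` and the vertices `inr j` are the `t` copies of `f_8`. -/
def Fsim (t : ℕ) : Finset (Finset (Fin 7 ⊕ Fin t)) :=
  ({({Sum.inl 0, Sum.inl 1, Sum.inl 2} : Finset (Fin 7 ⊕ Fin t)),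
    ({Sum.inl 0, Sum.inl 1, Sum.inl 3} : Finset (Fin 7 ⊕ Fin t)),
    ({Sum.inl 2, Sum.inl 3, Sum.inl 4} : Finset (Fin 7 ⊕ Fin t)),
    ({Sum.inl 4, Sum.inl 5, Sum.inl 6} : Finset (Fin 7 ⊕ Fin t))} :
      Finset (Finset (Fin 7 ⊕ Fin t))) ∪
  Finset.univ.image (fun j : Fin t => ({Sum.inl 5, Sum.inl 6, Sum.inr j} : Finset (Fin 7 ⊕ Fin t)))

/-- The 3-graph with parts `A`, `B`, `C` and an extra clique `X`: its hyperedges are the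
triples with one vertex in each of `A`, `B`, `C`, all 3-subsets of `X`, and the triples with
one vertex in `X` and two vertices in a common part among `A`, `B`, `C`. -/
def simConstr (n : ℕ) (A B C X : Finset (Fin n)) : Finset (Finset (Fin n)) :=
  Finset.univ.filter (fun e => e.card = 3 ∧
    (((e ∩ A).card = 1 ∧ (e ∩ B).card = 1 ∧ (e ∩ C).card = 1) ∨
     e ⊆ X ∨
     ((e ∩ X).card = 1 ∧ ((e ∩ A).card = 2 ∨ (e ∩ B).card = 2 ∨ (e ∩ C).card = 2))))

/-- `F_5^S(m)`: `T_3(3m,3)` together with one new vertex `v = inr ()` and one hyperedge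
consisting of `v` and two vertices (`0` and `3`) lying in one part of `T_3(3m,3)`. -/
def F5Sm (m : ℕ) (hm : 2 ≤ m) : Finset (Finset (Fin (3*m) ⊕ Unit)) :=
  (T3 (3*m)).image (fun e => e.image Sum.inl) ∪
  {({Sum.inr (), Sum.inl ⟨0, by omega⟩, Sum.inl ⟨3, by omega⟩} : Finset (Fin (3*m) ⊕ Unit))}

/-- The disjoint union of `k` vertex-disjoint copies of the 3-graph `F`. -/
def copies (k : ℕ) {W : Type*} [DecidableEq W] (F : Finset (Finset W)) :
    Finset (Finset (Fin k × W)) :=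
  Finset.univ.biUnion (fun j : Fin k => F.image (fun e => e.image (fun w => (j, w))))

/-- The 3-graph `G(t,m,n)` (it does not depend on `m`): the vertices `v < t` form the set
`T`, the remaining `n - t` vertices carry a copy of `T_3(n-t,3)` (parts by residue of
`v - t` mod 3), and the hyperedges are those of this `T_3(n-t,3)` together with all
3-sets of vertices intersecting `T`. -/
def Gtmn (t n : ℕ) : Finset (Finset (Fin n)) :=
  Finset.univ.filter (fun e => e.card = 3 ∧
    ((∃ v ∈ e, (v : ℕ) < t) ∨
     (∀ i : Fin 3, (e.filter (fun v : Fin n => t ≤ (v : ℕ) ∧ ((v : ℕ) - t) % 3 = (i : ℕ))).card = 1)))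

/-- The blow-up of `F_5` in which every vertex is replaced by `t` copies:
the vertex `(i, j)` is the `j`-th copy of `f_{i+1}`. -/
def F5blowAll (t : ℕ) : Finset (Finset (Fin 5 × Fin t)) :=
  Finset.univ.biUnion (fun x : Fin t × Fin t × Fin t =>
    ({ ({((0:Fin 5), x.1), ((1:Fin 5), x.2.1), ((2:Fin 5), x.2.2)} : Finset (Fin 5 × Fin t)),
       ({((0:Fin 5), x.1), ((1:Fin 5), x.2.1), ((3:Fin 5), x.2.2)} : Finset (Fin 5 × Fin t)),
       ({((2:Fin 5), x.1), ((3:Fin 5), x.2.1), ((4:Fin 5), x.2.2)} : Finset (Fin 5 × Fin t)) } :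
      Finset (Finset (Fin 5 × Fin t))))

namespace Packing

open scoped Classical

section Relation

variable {V : Type*}

/-- A ternary relation that is invariant under permuting its arguments and only holds for
triples of distinct elements, i.e. the edge relation of a 3-graph. -/
structure IsTriple (E : V → V → V → Prop) : Prop where
  swap : ∀ {x y z}, E x y z → E y x z
  rot : ∀ {x y z}, E x y z → E y z x
  ne : ∀ {x y z}, E x y z → x ≠ y

namespace IsTriple

variable {E : V → V → V → Prop} {x y z : V}

lemma swap_iff (h : IsTriple E) : E x y z ↔ E y x z := ⟨h.swap, h.swap⟩

lemma rot_iff (h : IsTriple E) : E x y z ↔ E y z x := ⟨h.rot, fun H => h.rot (h.rot H)⟩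

lemma rot' (h : IsTriple E) (H : E x y z) : E z x y := h.rot (h.rot H)

lemma swap' (h : IsTriple E) (H : E x y z) : E x z y := h.rot (h.rot (h.swap (h.rot H)))

lemma rev (h : IsTriple E) (H : E x y z) : E z y x := h.swap (h.rot H)

lemma ne' (h : IsTriple E) (H : E x y z) : y ≠ z := h.ne (h.rot H)

lemma ne'' (h : IsTriple E) (H : E x y z) : x ≠ z := (h.ne (h.rot' H)).symm

lemma restrict {W : Type*} (h : IsTriple E) (f : W → V) :
    IsTriple (fun a b c => E (f a) (f b) (f c)) :=
  ⟨fun H => h.swap H, fun H => h.rot H, fun H e => h.ne H (by rw [e])⟩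

end IsTriple

/-- The indicator of a ternary relation. -/
noncomputable def ind (E : V → V → V → Prop) (x y z : V) : ℝ := if E x y z then 1 else 0

lemma ind_nonneg (E : V → V → V → Prop) (x y z : V) : 0 ≤ ind E x y z := by
  unfold ind; split_ifs <;> norm_num

lemma ind_le_one (E : V → V → V → Prop) (x y z : V) : ind E x y z ≤ 1 := by
  unfold ind; split_ifs <;> norm_num

lemma ind_swap {E : V → V → V → Prop} (h : IsTriple E) (x y z : V) :
    ind E x y z = ind E y x z := by
  unfold ind; rw [h.swap_iff]

lemma ind_rot {E : V → V → V → Prop} (h : IsTriple E) (x y z : V) :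
    ind E x y z = ind E y z x := by
  unfold ind; rw [h.rot_iff]

/-- The number of ordered triples of `A × B × C` satisfying `E`. -/
noncomputable def cnt (E : V → V → V → Prop) (A B C : Finset V) : ℝ :=
  ∑ x ∈ A, ∑ y ∈ B, ∑ z ∈ C, ind E x y z

section cnt

variable {E : V → V → V → Prop} {A A' B B' C C' : Finset V}

lemma cnt_swap (h : IsTriple E) : cnt E A B C = cnt E B A C := by
  unfold cnt
  rw [Finset.sum_comm]
  exact Finset.sum_congr rfl fun y _ => Finset.sum_congr rfl fun x _ =>
    Finset.sum_congr rfl fun z _ => ind_swap h x y z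

lemma cnt_rot (h : IsTriple E) : cnt E A B C = cnt E B C A := by
  unfold cnt
  rw [Finset.sum_comm]
  refine Finset.sum_congr rfl fun y _ => ?_
  rw [Finset.sum_comm]
  exact Finset.sum_congr rfl fun y _ => Finset.sum_congr rfl fun x _ => ind_rot h _ _ _

lemma cnt_swap' (h : IsTriple E) : cnt E A B C = cnt E A C B := by
  rw [cnt_rot h, cnt_swap h, ← cnt_rot h, cnt_swap h, ← cnt_rot h, cnt_swap h]

lemma cnt_nonneg (E : V → V → V → Prop) (A B C : Finset V) : 0 ≤ cnt E A B C :=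
  Finset.sum_nonneg fun _ _ => Finset.sum_nonneg fun _ _ => Finset.sum_nonneg fun _ _ =>
    ind_nonneg _ _ _ _

lemma cnt_mono (hA : A ⊆ A') (hB : B ⊆ B') (hC : C ⊆ C') :
    cnt E A B C ≤ cnt E A' B' C' := by
  unfold cnt
  refine (Finset.sum_le_sum fun x _ => (Finset.sum_le_sum fun y _ =>
    Finset.sum_le_sum_of_subset_of_nonneg hC fun z _ _ => ind_nonneg E x y z).trans
    (Finset.sum_le_sum_of_subset_of_nonneg hB fun y _ _ => Finset.sum_nonneg fun z _ =>
      ind_nonneg E x y z)).trans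
    (Finset.sum_le_sum_of_subset_of_nonneg hA fun x _ _ => Finset.sum_nonneg fun y _ =>
      Finset.sum_nonneg fun z _ => ind_nonneg E x y z)

lemma cnt_union (hd : Disjoint A A') : cnt E (A ∪ A') B C = cnt E A B C + cnt E A' B C :=
  Finset.sum_union hd

lemma cnt_union₂ (hd : Disjoint B B') : cnt E A (B ∪ B') C = cnt E A B C + cnt E A B' C := by
  simp only [cnt, ← Finset.sum_add_distrib, Finset.sum_union hd]

lemma cnt_union₃ (hd : Disjoint C C') : cnt E A B (C ∪ C') = cnt E A B C + cnt E A B C' := by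
  simp only [cnt, ← Finset.sum_add_distrib, Finset.sum_union hd]

lemma cnt_le_card (E : V → V → V → Prop) (A B C : Finset V) :
    cnt E A B C ≤ (#A : ℝ) * #B * #C := by
  calc cnt E A B C ≤ ∑ x ∈ A, ∑ y ∈ B, ∑ z ∈ C, (1 : ℝ) :=
        Finset.sum_le_sum fun _ _ => Finset.sum_le_sum fun _ _ => Finset.sum_le_sum fun _ _ =>
          ind_le_one _ _ _ _
    _ = _ := by simp; ring

lemma cnt_eq_sum_left (E : V → V → V → Prop) (A B C : Finset V) :
    cnt E A B C = ∑ x ∈ A, cnt E {x} B C := by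
  simp [cnt]

lemma cnt_singleton₂ (E : V → V → V → Prop) (x y : V) (C : Finset V) :
    cnt E {x} {y} C = #{z ∈ C | E x y z} := by
  simp [cnt, ind]

end cnt

variable [Fintype V]

/-- The number of edges through a pair. -/
noncomputable def codeg (E : V → V → V → Prop) (x y : V) : ℕ := #{z | E x y z}

lemma codeg_comm {E : V → V → V → Prop} (h : IsTriple E) (x y : V) :
    codeg E x y = codeg E y x := by
  unfold codeg; congr 1; ext z; simp [h.swap_iff (x := x)]

lemma codeg_self {E : V → V → V → Prop} (h : IsTriple E) (x : V) : codeg E x x = 0 := by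
  unfold codeg
  rw [Finset.card_eq_zero, Finset.filter_eq_empty_iff]
  exact fun z _ H => h.ne H rfl

lemma codeg_eq_zero {E : V → V → V → Prop} {x y : V} (h : ∀ z, ¬ E x y z) : codeg E x y = 0 := by
  unfold codeg
  rw [Finset.card_eq_zero, Finset.filter_eq_empty_iff]
  exact fun z _ => h z

lemma codeg_le_card (E : V → V → V → Prop) (x y : V) : codeg E x y ≤ Fintype.card V :=
  Finset.card_le_univ _

lemma codeg_eq_cnt (E : V → V → V → Prop) (x y : V) :
    (codeg E x y : ℝ) = cnt E {x} {y} univ := by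
  rw [cnt_singleton₂, codeg]

lemma codeg_eq_sum (E : V → V → V → Prop) (x y : V) :
    (codeg E x y : ℝ) = ∑ z, ind E x y z := by
  simp [codeg, ind]

lemma cnt_le_codeg (E : V → V → V → Prop) (x y : V) (C : Finset V) :
    cnt E {x} {y} C ≤ codeg E x y := by
  rw [codeg_eq_cnt]; exact cnt_mono subset_rfl subset_rfl (Finset.subset_univ _)

lemma cnt_eq_sum_codeg (E : V → V → V → Prop) (A B : Finset V) :
    cnt E A B univ = ∑ x ∈ A, ∑ y ∈ B, (codeg E x y : ℝ) := by
  simp only [codeg_eq_sum, cnt]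

/-- The edge relation of a family of finite sets. -/
def edgeRel (H : Finset (Finset V)) (x y z : V) : Prop := ({x, y, z} : Finset V) ∈ H

lemma edgeRel_isTriple {H : Finset (Finset V)} (hH : ∀ e ∈ H, #e = 3) :
    IsTriple (edgeRel H) where
  swap {x y z} H := by
    unfold edgeRel at *; convert H using 1; ext; simp; tauto
  rot {x y z} H := by
    unfold edgeRel at *; convert H using 1; ext; simp; tauto
  ne {x y z} H e := by
    subst e
    have h1 := hH _ H
    have h2 : #({x, x, z} : Finset V) ≤ 2 := by simpa using Finset.card_le_two
    omega

/-- The family of edges of a ternary relation. -/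
noncomputable def toEdges (E : V → V → V → Prop) : Finset (Finset V) :=
  {e | ∃ x y z, E x y z ∧ e = {x, y, z}}

lemma toEdges_card {E : V → V → V → Prop} (h : IsTriple E) : ∀ e ∈ toEdges E, #e = 3 := by
  intro e he
  simp only [toEdges, mem_filter, mem_univ, true_and] at he
  obtain ⟨x, y, z, hE, rfl⟩ := he
  exact Finset.card_eq_three.2 ⟨x, y, z, h.ne hE, h.ne'' hE, h.ne' hE, rfl⟩

lemma edgeRel_toEdges {E : V → V → V → Prop} (h : IsTriple E) : edgeRel (toEdges E) = E := by
  funext x y z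
  apply propext
  simp only [edgeRel, toEdges, mem_filter, mem_univ, true_and]
  constructor
  · rintro ⟨a, b, c, hE, he⟩
    have hab := h.ne hE
    have hbc := h.ne' hE
    have hac := h.ne'' hE
    have ha : a ∈ ({x, y, z} : Finset V) := by rw [he]; simp
    have hb : b ∈ ({x, y, z} : Finset V) := by rw [he]; simp
    have hc : c ∈ ({x, y, z} : Finset V) := by rw [he]; simp
    simp only [mem_insert, mem_singleton] at ha hb hc
    have h1 := h.swap hE
    have h2 := h.rot hE
    have h3 := h.rot' hE
    have h4 := h.swap' hE
    have h5 := h.rev hE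
    rcases ha with rfl | rfl | rfl <;> rcases hb with rfl | rfl | rfl <;>
      rcases hc with rfl | rfl | rfl <;> first | assumption | exact absurd rfl ‹_›
  · exact fun H => ⟨x, y, z, H, rfl⟩

lemma codeg_edgeRel {H : Finset (Finset V)} (hH : ∀ e ∈ H, #e = 3) {x y : V} (hxy : x ≠ y) :
    codeg (edgeRel H) x y = #{e ∈ H | x ∈ e ∧ y ∈ e} := by
  unfold codeg
  refine Finset.card_bij (fun z _ => {x, y, z}) ?_ ?_ ?_
  · intro z hz
    have : ({x, y, z} : Finset V) ∈ H := (Finset.mem_filter.1 hz).2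
    simp [this]
  · intro z hz w hw hzw
    simp only [mem_filter, mem_univ, true_and] at hz hw
    have h1 := (edgeRel_isTriple hH).ne' hz
    have h2 := (edgeRel_isTriple hH).ne'' hz
    have : z ∈ ({x, y, w} : Finset V) := by rw [← hzw]; simp
    simp only [mem_insert, mem_singleton] at this
    rcases this with h | h | h
    · exact absurd h.symm h2
    · exact absurd h.symm h1
    · exact h
  · intro e he
    simp only [mem_filter] at he
    obtain ⟨heH, hx, hy⟩ := he
    have h3 := hH e heH
    have h1 : #((e.erase x).erase y) = 1 := by
      rw [card_erase_of_mem (by simp [hy, hxy.symm]), card_erase_of_mem hx, h3]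
    obtain ⟨z, hz⟩ := Finset.card_eq_one.1 h1
    have : ({x, y, z} : Finset V) = e := by
      rw [← insert_erase hx, ← insert_erase (show y ∈ e.erase x by simp [hy, hxy.symm]), hz]
    exact ⟨z, Finset.mem_filter.2 ⟨mem_univ _, by rw [edgeRel, this]; exact heH⟩, this⟩

lemma six_card {H : Finset (Finset V)} (hH : ∀ e ∈ H, #e = 3) :
    ∑ x, ∑ y, codeg (edgeRel H) x y = 6 * #H := by
  have h1 : ∀ x y, codeg (edgeRel H) x y
      = ∑ e ∈ H, if (x, y) ∈ e.offDiag then 1 else 0 := by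
    intro x y
    by_cases hxy : x = y
    · subst hxy
      rw [codeg_self (edgeRel_isTriple hH)]; simp
    · rw [codeg_edgeRel hH hxy, Finset.card_filter]
      exact Finset.sum_congr rfl fun e _ => by simp [hxy]
  simp only [h1]
  rw [← Finset.sum_product', Finset.sum_comm]
  rw [Finset.sum_congr rfl (g := fun _ => 6)]
  · simp; ring
  · intro e he
    rw [← Finset.card_filter]
    have : (filter (fun p : V × V => (p.1, p.2) ∈ e.offDiag) (univ ×ˢ univ)) = e.offDiag := by
      ext p; simp
    rw [this, Finset.offDiag_card, hH e he]

lemma six_card_toEdges {E : V → V → V → Prop} (h : IsTriple E) :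
    6 * #(toEdges E) = ∑ x, ∑ y, codeg E x y := by
  rw [← six_card (toEdges_card h), edgeRel_toEdges h]

lemma six_card_cnt {H : Finset (Finset V)} (hH : ∀ e ∈ H, #e = 3) :
    cnt (edgeRel H) univ univ univ = 6 * #H := by
  rw [cnt_eq_sum_codeg]; exact_mod_cast six_card hH

/-- All codegrees of distinct pairs are at most `l`. -/
def Bounded (l : ℕ) (E : V → V → V → Prop) : Prop := ∀ x y, x ≠ y → codeg E x y ≤ l

lemma codeg_comp_equiv {W : Type*} [Fintype W] (E : V → V → V → Prop) (f : W ≃ V) (x y : W) :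
    codeg (fun a b c => E (f a) (f b) (f c)) x y = codeg E (f x) (f y) := by
  unfold codeg
  refine Finset.card_equiv f ?_
  simp

lemma Dmax_set_bddAbove (N t : ℕ) : BddAbove {k | ∃ H : Finset (Finset (Fin N)),
    (∀ e ∈ H, e.card = 3) ∧
    (∀ u v : Fin N, u ≠ v → (H.filter (fun e => u ∈ e ∧ v ∈ e)).card ≤ t - 1) ∧ H.card = k} :=
  ⟨Fintype.card (Finset (Fin N)), by rintro k ⟨H, -, -, rfl⟩; exact Finset.card_le_univ _⟩

lemma le_Dmax {E : V → V → V → Prop} {t : ℕ} (h : IsTriple E) (hb : Bounded (t - 1) E) :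
    ∑ x, ∑ y, codeg E x y ≤ 6 * Dmax (Fintype.card V) t := by
  let f : Fin (Fintype.card V) ≃ V := (Fintype.equivFin V).symm
  let E' : Fin (Fintype.card V) → Fin (Fintype.card V) → Fin (Fintype.card V) → Prop :=
    fun a b c => E (f a) (f b) (f c)
  have h' : IsTriple E' := h.restrict f
  have h1 : ∑ x, ∑ y, codeg E x y = ∑ x, ∑ y, codeg E' x y := by
    rw [← Equiv.sum_comp f]
    refine Finset.sum_congr rfl fun x _ => ?_
    rw [← Equiv.sum_comp f]
    exact Finset.sum_congr rfl fun y _ => (codeg_comp_equiv E f x y).symm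
  rw [h1, ← six_card_toEdges h']
  refine Nat.mul_le_mul_left _ (le_csSup (Dmax_set_bddAbove _ _)
    ⟨toEdges E', toEdges_card h', fun u v huv => ?_, rfl⟩)
  have h2 := codeg_edgeRel (toEdges_card h') huv
  rw [edgeRel_toEdges h', codeg_comp_equiv] at h2
  refine le_trans (le_of_eq ?_) (h2 ▸ hb _ _ (f.injective.ne huv))
  congr

lemma exists_Dmax_fin (N t : ℕ) : ∃ E : Fin N → Fin N → Fin N → Prop, IsTriple E ∧
    Bounded (t - 1) E ∧ ∑ x, ∑ y, codeg E x y = 6 * Dmax N t := by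
  obtain ⟨H, h1, h2, h3⟩ := Nat.sSup_mem (s := {k | ∃ H : Finset (Finset (Fin N)),
    (∀ e ∈ H, e.card = 3) ∧
    (∀ u v : Fin N, u ≠ v → (H.filter (fun e => u ∈ e ∧ v ∈ e)).card ≤ t - 1) ∧ H.card = k})
    ⟨0, ∅, by simp⟩ (Dmax_set_bddAbove N t)
  refine ⟨edgeRel H, edgeRel_isTriple h1, fun x y hxy => ?_, ?_⟩
  · rw [codeg_edgeRel h1 hxy]
    refine le_trans (le_of_eq ?_) (h2 x y hxy)
    congr
  · rw [six_card h1, h3]; rfl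

lemma exists_Dmax (V : Type*) [Fintype V] (t : ℕ) : ∃ E : V → V → V → Prop, IsTriple E ∧
    Bounded (t - 1) E ∧ ∑ x, ∑ y, codeg E x y = 6 * Dmax (Fintype.card V) t := by
  obtain ⟨E, h1, h2, h3⟩ := exists_Dmax_fin (Fintype.card V) t
  let f : V ≃ Fin (Fintype.card V) := Fintype.equivFin V
  refine ⟨fun a b c => E (f a) (f b) (f c), h1.restrict f, fun x y hxy => ?_, ?_⟩
  · rw [codeg_comp_equiv]; exact h2 _ _ (f.injective.ne hxy)
  · rw [← h3, ← Equiv.sum_comp f]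
    refine Finset.sum_congr rfl fun x _ => ?_
    rw [← Equiv.sum_comp f]
    exact Finset.sum_congr rfl fun y _ => codeg_comp_equiv E f x y

lemma sum_codeg_le {E : V → V → V → Prop} {l : ℕ} (h : IsTriple E) (hb : Bounded l E) :
    ∑ x, ∑ y, codeg E x y ≤ l * (Fintype.card V * (Fintype.card V - 1)) := by
  calc ∑ x, ∑ y, codeg E x y ≤ ∑ x : V, ∑ y, if x ≠ y then l else 0 := by
        refine Finset.sum_le_sum fun x _ => Finset.sum_le_sum fun y _ => ?_
        by_cases hxy : x = y
        · simp [hxy, codeg_self h]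
        · simp [hxy, hb x y hxy]
    _ = _ := by
        have : ∀ x : V, (∑ y, if x ≠ y then l else 0) = (Fintype.card V - 1) * l := by
          intro x
          rw [← Finset.sum_filter, Finset.sum_const, smul_eq_mul, Finset.filter_ne,
            card_erase_of_mem (mem_univ _), card_univ]
        rw [Finset.sum_congr rfl fun x _ => this x]
        simp; ring

lemma Dmax_le (N t : ℕ) : 6 * Dmax N t ≤ (t - 1) * (N * (N - 1)) := by
  obtain ⟨E, h1, h2, h3⟩ := exists_Dmax_fin N t
  rw [← h3]
  simpa using sum_codeg_le h1 h2

/-- A relation on a subset of the vertices whose inner codegrees are bounded. -/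
lemma cnt_le_Dmax {E : V → V → V → Prop} {t : ℕ} (h : IsTriple E) (P : Finset V)
    (hb : ∀ x ∈ P, ∀ y ∈ P, x ≠ y → codeg E x y ≤ t - 1) :
    cnt E P P P ≤ 6 * Dmax #P t := by
  let E' : P → P → P → Prop := fun a b c => E a b c
  have h' : IsTriple E' := h.restrict _
  have hcd : ∀ x y : P, codeg E' x y ≤ codeg E x y := by
    intro x y
    unfold codeg
    refine Finset.card_le_card_of_injOn (fun z => (z : V)) ?_ (Subtype.val_injective.injOn)
    intro z hz; simpa using hz
  have := le_Dmax h' (fun x y hxy => (hcd x y).trans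
    (hb x x.2 y y.2 (fun e => hxy (Subtype.ext e))))
  rw [Fintype.card_coe] at this
  have h2 : cnt E P P P = ((∑ x, ∑ y, codeg E' x y : ℕ) : ℝ) := by
    push_cast
    unfold cnt
    rw [← Finset.sum_coe_sort]
    refine Finset.sum_congr rfl fun x _ => ?_
    rw [← Finset.sum_coe_sort]
    refine Finset.sum_congr rfl fun y _ => ?_
    rw [codeg_eq_sum, ← Finset.sum_coe_sort]
    rfl
  rw [h2]; exact_mod_cast this

lemma Dmax_mono (t : ℕ) {M N : ℕ} (hMN : M ≤ N) : Dmax M t ≤ Dmax N t := by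
  obtain ⟨H, h1, h2, h3⟩ := Nat.sSup_mem (s := {k | ∃ H : Finset (Finset (Fin M)),
    (∀ e ∈ H, e.card = 3) ∧
    (∀ u v : Fin M, u ≠ v → (H.filter (fun e => u ∈ e ∧ v ∈ e)).card ≤ t - 1) ∧ H.card = k})
    ⟨0, ∅, by simp⟩ (Dmax_set_bddAbove M t)
  let f : Fin M ↪ Fin N := Fin.castLEEmb hMN
  refine le_csSup (Dmax_set_bddAbove _ _) ⟨H.map (Finset.mapEmbedding f).toEmbedding, ?_, ?_, ?_⟩
  · intro e he
    simp only [mem_map] at he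
    obtain ⟨e, he, rfl⟩ := he
    simpa using h1 e he
  · intro u v huv
    rw [Finset.filter_map, card_map]
    by_cases hu : ∃ u', f u' = u
    · by_cases hv : ∃ v', f v' = v
      · obtain ⟨u', rfl⟩ := hu
        obtain ⟨v', rfl⟩ := hv
        refine le_trans (le_of_eq ?_) (h2 u' v' (fun e => huv (by rw [e])))
        congr 1; ext e; simp
      · push Not at hv
        rw [Finset.card_eq_zero.2]; · omega
        rw [Finset.filter_eq_empty_iff]
        intro e _ h
        obtain ⟨w, -, hw⟩ := Finset.mem_map.1 (show v ∈ e.map f from h.2)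
        exact hv _ hw
    · push Not at hu
      rw [Finset.card_eq_zero.2]; · omega
      rw [Finset.filter_eq_empty_iff]
      intro e _ h
      obtain ⟨w, -, hw⟩ := Finset.mem_map.1 (show u ∈ e.map f from h.1)
      exact hu _ hw
  · rw [card_map, h3]; rfl

end Relation

section ForbiddenCopy

variable {V : Type*} [Fintype V]

/-- If two edges share a pair, then the remaining two vertices have fewer than `t`
further common neighbours. -/
def Free (t : ℕ) (E : V → V → V → Prop) : Prop :=
  ∀ a b x y, x ≠ y → E a b x → E a b y → #{z | E x y z ∧ z ≠ a ∧ z ≠ b} < t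

lemma edgeRel_iff {V : Type*} [inst : DecidableEq V] {H : Finset (Finset V)} {x y z : V} :
    edgeRel H x y z ↔ ({x, y, z} : Finset V) ∈ H := by
  unfold edgeRel
  have : inst = fun a b => Classical.propDecidable (a = b) := Subsingleton.elim _ _
  subst this
  rfl

lemma hasCopy_iff [DecidableEq V] {t : ℕ} {H : Finset (Finset V)} (hH : ∀ e ∈ H, #e = 3) :
    HasCopy H (F5b5 t) ↔ ¬ Free t (edgeRel H) := by
  have hT := edgeRel_isTriple hH
  have key : ∀ f : Fin 4 ⊕ Fin t ↪ V, (∀ e ∈ F5b5 t, e.image f ∈ H) ↔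
      edgeRel H (f (.inl 0)) (f (.inl 1)) (f (.inl 2)) ∧
      edgeRel H (f (.inl 0)) (f (.inl 1)) (f (.inl 3)) ∧
      ∀ j, edgeRel H (f (.inl 2)) (f (.inl 3)) (f (.inr j)) := by
    intro f
    simp only [edgeRel_iff]
    constructor
    · intro h
      refine ⟨?_, ?_, fun j => ?_⟩
      · simpa [Finset.image_insert] using h {.inl 0, .inl 1, .inl 2} (by simp [F5b5])
      · simpa [Finset.image_insert] using h {.inl 0, .inl 1, .inl 3} (by simp [F5b5])
      · simpa [Finset.image_insert] using h {.inl 2, .inl 3, .inr j}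
          (by unfold F5b5; exact mem_union_right _ (mem_image_of_mem _ (mem_univ j)))
    · rintro ⟨h1, h2, h3⟩ e he
      unfold F5b5 at he
      simp only [mem_union, mem_insert, mem_singleton, mem_image, mem_univ, true_and] at he
      rcases he with (rfl | rfl) | ⟨j, rfl⟩
      · simpa [Finset.image_insert] using h1
      · simpa [Finset.image_insert] using h2
      · simpa [Finset.image_insert] using h3 j
  constructor
  · rintro ⟨f, hf⟩ hF
    obtain ⟨h1, h2, h3⟩ := (key f).1 hf
    have := hF _ _ _ _ (f.injective.ne (by simp)) h1 h2
    have h4 : #(univ.image fun j : Fin t => f (.inr j)) ≤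
        #{z | edgeRel H (f (.inl 2)) (f (.inl 3)) z ∧ z ≠ f (.inl 0) ∧ z ≠ f (.inl 1)} := by
      refine Finset.card_le_card fun z hz => ?_
      simp only [mem_image, mem_univ, true_and] at hz
      obtain ⟨j, rfl⟩ := hz
      exact mem_filter.2 ⟨mem_univ _, h3 j, f.injective.ne (by simp), f.injective.ne (by simp)⟩
    rw [Finset.card_image_of_injective (f := fun j : Fin t => f (.inr j)) _
      (f.injective.comp Sum.inr_injective)] at h4
    rw [card_univ, Fintype.card_fin] at h4
    exact absurd this (not_lt.2 (h4.trans (le_of_eq (by congr))))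
  · intro hF
    unfold Free at hF
    push Not at hF
    obtain ⟨a, b, x, y, hxy, h1, h2, h3⟩ := hF
    set S : Finset V := {z | edgeRel H x y z ∧ z ≠ a ∧ z ≠ b} with hS
    obtain ⟨g⟩ := Function.Embedding.nonempty_of_card_le (α := Fin t) (β := S) (by simpa using h3)
    have hg : ∀ j, edgeRel H x y (g j) ∧ (g j : V) ≠ a ∧ (g j : V) ≠ b := fun j =>
      (mem_filter.1 (g j).2).2
    have hab := hT.ne h1
    have hax := hT.ne'' h1
    have hbx := hT.ne' h1
    have hay := hT.ne'' h2
    have hby := hT.ne' h2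
    have hinj : Function.Injective (Sum.elim ![a, b, x, y] (fun j => (g j : V))) := by
      refine Function.Injective.sumElim ?_ (Subtype.val_injective.comp g.injective) ?_
      · intro i j hij
        fin_cases i <;> fin_cases j <;> first | rfl | (exfalso; simp at hij; tauto)
      · intro i j
        have h5 := hT.ne'' (hg j).1
        have h6 := hT.ne' (hg j).1
        have h7 := (hg j).2
        fin_cases i
        · exact h7.1.symm
        · exact h7.2.symm
        · exact h5
        · exact h6
    refine ⟨⟨_, hinj⟩, (key _).2 ⟨h1, h2, fun j => (hg j).1⟩⟩

section Free

variable {t : ℕ} {E : V → V → V → Prop}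

lemma Free.codeg_le (hF : Free t E) {a b x y : V} (hxy : x ≠ y) (h1 : E a b x) (h2 : E a b y) :
    codeg E x y ≤ t + 1 := by
  have h := hF a b x y hxy h1 h2
  have : ({z | E x y z} : Finset V) ⊆
      ({z | E x y z ∧ z ≠ a ∧ z ≠ b} : Finset V) ∪ {a, b} := by
    intro z hz
    simp only [mem_filter, mem_univ, true_and, mem_union, mem_insert, mem_singleton] at *
    tauto
  have h2 := (Finset.card_le_card this).trans (Finset.card_union_le _ _)
  have h3 : #({a, b} : Finset V) ≤ 2 := Finset.card_le_two
  unfold codeg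
  omega

/-- Two vertices with many common links have codegree less than `t`. -/
lemma Free.codeg_lt (hE : IsTriple E) (hF : Free t E) {x y : V} (hxy : x ≠ y)
    (hc : 2 * t * Fintype.card V < #{p : V × V | E x p.1 p.2 ∧ E y p.1 p.2}) :
    codeg E x y < t := by
  by_contra hcon
  push Not at hcon
  obtain ⟨S, hS, hSt⟩ := Finset.exists_subset_card_eq hcon
  have hsub : ({p : V × V | E x p.1 p.2 ∧ E y p.1 p.2} : Finset (V × V)) ⊆
      (S ×ˢ univ) ∪ (univ ×ˢ S) := by
    rintro ⟨b, c⟩ hbc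
    simp only [mem_filter, mem_univ, true_and] at hbc
    by_contra hn
    simp only [mem_union, mem_product, mem_univ, and_true, true_and, not_or] at hn
    have h := hF b c x y hxy (hE.rot hbc.1) (hE.rot hbc.2)
    have : S ⊆ ({z | E x y z ∧ z ≠ b ∧ z ≠ c} : Finset V) := by
      intro z hz
      have := hS hz
      simp only [mem_filter, mem_univ, true_and] at this ⊢
      exact ⟨this, fun e => hn.1 (e ▸ hz), fun e => hn.2 (e ▸ hz)⟩
    have := Finset.card_le_card this
    omega
  have := (Finset.card_le_card hsub).trans (Finset.card_union_le _ _)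
  simp only [card_product, card_univ, hSt] at this
  nlinarith

end Free

lemma exists_Dmax_set (P : Finset V) (t : ℕ) : ∃ E : V → V → V → Prop, IsTriple E ∧
    (∀ x y z, E x y z → x ∈ P ∧ y ∈ P ∧ z ∈ P) ∧
    Bounded (t - 1) E ∧ ∑ x, ∑ y, codeg E x y = 6 * Dmax #P t := by
  obtain ⟨E, h1, h2, h3⟩ := exists_Dmax P t
  let E' : V → V → V → Prop := fun x y z => ∃ (hx : x ∈ P) (hy : y ∈ P) (hz : z ∈ P),
    E ⟨x, hx⟩ ⟨y, hy⟩ ⟨z, hz⟩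
  have hP : ∀ x y z, E' x y z → x ∈ P ∧ y ∈ P ∧ z ∈ P := fun x y z ⟨a, b, c, _⟩ => ⟨a, b, c⟩
  have hcd : ∀ x y : P, codeg E' x y = codeg E x y := by
    intro x y
    unfold codeg
    symm
    refine Finset.card_bij (fun z _ => (z : V)) ?_ (fun _ _ _ _ h => Subtype.ext h) ?_
    · intro z hz
      simp only [mem_filter, mem_univ, true_and] at hz ⊢
      exact ⟨x.2, y.2, z.2, hz⟩
    · intro z hz
      simp only [mem_filter, mem_univ, true_and] at hz
      obtain ⟨_, _, c, h⟩ := hz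
      exact ⟨⟨z, c⟩, by simpa using h, rfl⟩
  have h0 : ∀ x y, x ∉ P ∨ y ∉ P → codeg E' x y = 0 := by
    intro x y hxy
    refine codeg_eq_zero fun z h => ?_
    have := hP _ _ _ h
    tauto
  refine ⟨E', ⟨?_, ?_, ?_⟩, hP, ?_, ?_⟩
  · rintro x y z ⟨a, b, c, h⟩; exact ⟨b, a, c, h1.swap h⟩
  · rintro x y z ⟨a, b, c, h⟩; exact ⟨b, c, a, h1.rot h⟩
  · rintro x y z ⟨a, b, c, h⟩ rfl; exact h1.ne h rfl
  · intro x y hxy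
    by_cases hx : x ∈ P
    · by_cases hy : y ∈ P
      · have := hcd ⟨x, hx⟩ ⟨y, hy⟩
        simp only at this
        rw [this]
        exact h2 _ _ (fun e => hxy (Subtype.ext_iff.1 e))
      · rw [h0 x y (.inr hy)]; omega
    · rw [h0 x y (.inl hx)]; omega
  · rw [Fintype.card_coe] at h3
    rw [← h3, ← Finset.sum_subset (Finset.subset_univ P), ← Finset.sum_coe_sort]
    · refine Finset.sum_congr rfl fun x _ => ?_
      rw [← Finset.sum_subset (Finset.subset_univ P), ← Finset.sum_coe_sort]
      · exact Finset.sum_congr rfl fun y _ => hcd x y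
      · exact fun y _ hy => h0 _ _ (.inr hy)
    · exact fun x _ hx => Finset.sum_eq_zero fun y _ => h0 _ _ (.inl hx)

lemma mem_turanPart {n : ℕ} {i : Fin 3} {v : Fin n} : v ∈ turanPart n i ↔ (v : ℕ) % 3 = i := by
  simp [turanPart]

lemma turanPart_disjoint {n : ℕ} {i j : Fin 3} {v : Fin n} (hi : v ∈ turanPart n i)
    (hj : v ∈ turanPart n j) : i = j := by
  rw [mem_turanPart] at hi hj
  exact Fin.ext (hi.symm.trans hj)

lemma exists_turanPart {n : ℕ} (v : Fin n) : ∃ i, v ∈ turanPart n i :=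
  ⟨⟨(v : ℕ) % 3, Nat.mod_lt _ (by norm_num)⟩, by rw [mem_turanPart]⟩

lemma T3_not_same {n : ℕ} {x y z : Fin n} {i : Fin 3} (h : ({x, y, z} : Finset (Fin n)) ∈ T3 n)
    (hxy : x ≠ y) (hx : x ∈ turanPart n i) (hy : y ∈ turanPart n i) : False := by
  simp only [T3, mem_filter] at h
  have h1 := h.2.2 i
  have : ({x, y} : Finset (Fin n)) ⊆ {x, y, z} ∩ turanPart n i := by
    intro w hw
    simp only [mem_insert, mem_singleton] at hw
    rcases hw with rfl | rfl <;> simp [hx, hy]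
  have := Finset.card_le_card this
  rw [Finset.card_pair hxy] at this
  omega

lemma bddAbove_exThree {W : Type*} [DecidableEq W] (n : ℕ) (F : Finset (Finset W)) :
    BddAbove {k | ∃ H : Finset (Finset (Fin n)), (∀ e ∈ H, e.card = 3) ∧ ¬ HasCopy H F ∧
      H.card = k} :=
  ⟨Fintype.card (Finset (Fin n)), by rintro k ⟨H, -, -, rfl⟩; exact Finset.card_le_univ _⟩

/-- The tripartite 3-graph together with optimal packings inside its parts is free. -/
lemma eT3plus_le_exThree (n t : ℕ) (ht : 1 ≤ t) : eT3plus n t ≤ exThree n (F5b5 t) := by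
  choose E hE hP hB hS using fun i : Fin 3 => exists_Dmax_set (turanPart n i) t
  have hun : ∀ i, ∀ e ∈ toEdges (E i), #e = 3 ∧ e ⊆ turanPart n i := by
    intro i e he
    refine ⟨toEdges_card (hE i) e he, ?_⟩
    simp only [toEdges, mem_filter, mem_univ, true_and] at he
    obtain ⟨x, y, z, h, rfl⟩ := he
    have := hP i x y z h
    intro w hw
    simp only [mem_insert, mem_singleton] at hw
    rcases hw with rfl | rfl | rfl <;> tauto
  set H : Finset (Finset (Fin n)) := T3 n ∪ univ.biUnion (fun i => toEdges (E i)) with hH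
  have hc : ∀ e ∈ H, #e = 3 := by
    intro e he
    simp only [hH, mem_union, mem_biUnion, mem_univ, true_and] at he
    rcases he with he | ⟨i, he⟩
    · exact (mem_filter.1 he).2.1
    · exact (hun i e he).1
  have hcard : #H = eT3plus n t := by
    rw [hH, eT3plus, Finset.card_union_of_disjoint, Finset.card_biUnion]
    · congr 1
      refine Finset.sum_congr rfl fun i _ => ?_
      have := six_card_toEdges (hE i)
      rw [hS i] at this
      omega
    · intro i _ j _ hij
      rw [Function.onFun, Finset.disjoint_left]
      intro e he he'
      obtain ⟨h3, h4⟩ := hun i e he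
      obtain ⟨-, h5⟩ := hun j e he'
      obtain ⟨x, hx⟩ : e.Nonempty := Finset.card_pos.1 (by omega)
      exact hij (turanPart_disjoint (h4 hx) (h5 hx))
    · rw [Finset.disjoint_left]
      intro e he he'
      simp only [mem_biUnion, mem_univ, true_and] at he'
      obtain ⟨i, he'⟩ := he'
      obtain ⟨h3, h4⟩ := hun i e he'
      obtain ⟨x, y, z, hxy, -, -, rfl⟩ := Finset.card_eq_three.1 h3
      exact T3_not_same he hxy (h4 (by simp)) (h4 (by simp))
  have hrel : ∀ x y z, edgeRel H x y z ↔ ({x, y, z} : Finset (Fin n)) ∈ T3 n ∨ ∃ i, E i x y z := by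
    intro x y z
    rw [edgeRel_iff, hH, mem_union, mem_biUnion]
    have : ∀ i, ({x, y, z} : Finset (Fin n)) ∈ toEdges (E i) ↔ E i x y z := by
      intro i
      rw [← edgeRel_iff, edgeRel_toEdges (hE i)]
    simp [this]
  have hT := edgeRel_isTriple hc
  refine le_csSup (bddAbove_exThree _ _) ⟨H, hc, ?_, hcard⟩
  rw [hasCopy_iff hc, not_not]
  intro a b x y hxy h1 h2
  have hsame : ∃ i, x ∈ turanPart n i ∧ y ∈ turanPart n i := by
    obtain ⟨ia, ha⟩ := exists_turanPart a
    obtain ⟨ib, hb⟩ := exists_turanPart b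
    obtain ⟨ix, hx⟩ := exists_turanPart x
    obtain ⟨iy, hy⟩ := exists_turanPart y
    by_cases hab : ia = ib
    · subst hab
      have : ∀ w, edgeRel H a b w → w ∈ turanPart n ia := by
        intro w hw
        rcases (hrel _ _ _).1 hw with h | ⟨i, h⟩
        · exact (T3_not_same h (hT.ne hw) ha hb).elim
        · have := hP i _ _ _ h
          rw [turanPart_disjoint ha this.1]; exact this.2.2
      exact ⟨ia, this x h1, this y h2⟩
    · have : ∀ w iw, w ∈ turanPart n iw → edgeRel H a b w → iw ≠ ia ∧ iw ≠ ib := by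
        intro w iw hw hr
        rcases (hrel _ _ _).1 hr with h | ⟨i, h⟩
        · refine ⟨?_, ?_⟩
          · rintro rfl
            rw [show ({a, b, w} : Finset (Fin n)) = {a, w, b} by ext; simp; tauto] at h
            exact T3_not_same h (hT.ne'' hr) ha hw
          · rintro rfl
            rw [show ({a, b, w} : Finset (Fin n)) = {b, w, a} by ext; simp; tauto] at h
            exact T3_not_same h (hT.ne' hr) hb hw
        · have := hP i _ _ _ h
          exact (hab ((turanPart_disjoint ha this.1).trans
            (turanPart_disjoint hb this.2.1).symm)).elim
      have h3 := this x ix hx h1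
      have h4 := this y iy hy h2
      have : ix = iy := by omega
      subst this
      exact ⟨ix, hx, hy⟩
  obtain ⟨i, hx, hy⟩ := hsame
  have hle : #{z | edgeRel H x y z ∧ z ≠ a ∧ z ≠ b} ≤ codeg (E i) x y := by
    unfold codeg
    refine Finset.card_le_card fun z hz => ?_
    simp only [mem_filter, mem_univ, true_and] at hz ⊢
    rcases (hrel _ _ _).1 hz.1 with h | ⟨j, h⟩
    · exact (T3_not_same h hxy hx hy).elim
    · have := hP j _ _ _ h
      rw [turanPart_disjoint hx this.1]; exact h
  refine lt_of_le_of_lt (le_of_eq ?_) (lt_of_le_of_lt (hle.trans (hB i x y hxy)) (by omega))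
  congr

lemma card_turanPart (n : ℕ) (i : Fin 3) : #(turanPart n i) = (n + 2 - i) / 3 := by
  have h1 : #(turanPart n i) = #((range n).filter (fun v => v % 3 = (i : ℕ))) := by
    rw [turanPart, ← Finset.card_map Fin.valEmbedding]
    congr 1
    ext v
    simp only [mem_map, mem_filter, mem_univ, true_and, Fin.valEmbedding_apply, mem_range]
    exact ⟨by rintro ⟨w, h, rfl⟩; exact ⟨w.2, h⟩, fun h => ⟨⟨v, h.1⟩, h.2, rfl⟩⟩
  rw [h1]
  clear h1
  induction n with
  | zero => have := i.2; simp; omega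
  | succ n ih =>
    rw [Finset.range_add_one, Finset.filter_insert]
    have := i.2
    split_ifs with h
    · rw [Finset.card_insert_of_notMem (by simp), ih]; omega
    · rw [ih]; omega

lemma card_T3 (n : ℕ) :
    #(T3 n) = #(turanPart n 0) * #(turanPart n 1) * #(turanPart n 2) := by
  rw [← Finset.card_product, ← Finset.card_product]
  symm
  refine Finset.card_bij (fun p _ => {p.1.1, p.1.2, p.2}) ?_ ?_ ?_
  · rintro ⟨⟨x, y⟩, z⟩ h
    simp only [mem_product] at h
    obtain ⟨⟨hx, hy⟩, hz⟩ := h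
    have hxy : x ≠ y := fun e => absurd (turanPart_disjoint hx (e ▸ hy)) (by decide)
    have hxz : x ≠ z := fun e => absurd (turanPart_disjoint hx (e ▸ hz)) (by decide)
    have hyz : y ≠ z := fun e => absurd (turanPart_disjoint hy (e ▸ hz)) (by decide)
    simp only [T3, mem_filter, mem_univ, true_and]
    refine ⟨Finset.card_eq_three.2 ⟨x, y, z, hxy, hxz, hyz, rfl⟩, fun i => ?_⟩
    rw [Finset.card_eq_one]
    rw [mem_turanPart] at hx hy hz
    fin_cases i
    · refine ⟨x, ?_⟩
      ext w; simp only [mem_inter, mem_insert, mem_singleton, mem_turanPart]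
      constructor
      · rintro ⟨rfl | rfl | rfl, h⟩ <;> simp_all
      · rintro rfl; simp_all
    · refine ⟨y, ?_⟩
      ext w; simp only [mem_inter, mem_insert, mem_singleton, mem_turanPart]
      constructor
      · rintro ⟨rfl | rfl | rfl, h⟩ <;> simp_all
      · rintro rfl; simp_all
    · refine ⟨z, ?_⟩
      ext w; simp only [mem_inter, mem_insert, mem_singleton, mem_turanPart]
      constructor
      · rintro ⟨rfl | rfl | rfl, h⟩ <;> simp_all
      · rintro rfl; simp_all
  · rintro ⟨⟨x, y⟩, z⟩ h ⟨⟨x', y'⟩, z'⟩ h' heq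
    simp only [mem_product, mem_turanPart] at h h'
    simp only at heq
    have e1 : x ∈ ({x', y', z'} : Finset (Fin n)) := by rw [← heq]; simp
    have e2 : y ∈ ({x', y', z'} : Finset (Fin n)) := by rw [← heq]; simp
    have e3 : z ∈ ({x', y', z'} : Finset (Fin n)) := by rw [← heq]; simp
    simp only [mem_insert, mem_singleton] at e1 e2 e3
    have f1 : x = x' := by rcases e1 with e | e | e <;> first | exact e | (subst e; simp_all)
    have f2 : y = y' := by rcases e2 with e | e | e <;> first | exact e | (subst e; simp_all)
    have f3 : z = z' := by rcases e3 with e | e | e <;> first | exact e | (subst e; simp_all)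
    rw [f1, f2, f3]
  · intro e he
    simp only [T3, mem_filter, mem_univ, true_and] at he
    obtain ⟨x, hx⟩ := Finset.card_eq_one.1 (he.2 0)
    obtain ⟨y, hy⟩ := Finset.card_eq_one.1 (he.2 1)
    obtain ⟨z, hz⟩ := Finset.card_eq_one.1 (he.2 2)
    have hx' := Finset.mem_inter.1 (show x ∈ e ∩ turanPart n 0 by rw [hx]; simp)
    have hy' := Finset.mem_inter.1 (show y ∈ e ∩ turanPart n 1 by rw [hy]; simp)
    have hz' := Finset.mem_inter.1 (show z ∈ e ∩ turanPart n 2 by rw [hz]; simp)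
    refine ⟨⟨⟨x, y⟩, z⟩, by simp only [mem_product]; exact ⟨⟨hx'.2, hy'.2⟩, hz'.2⟩, ?_⟩
    ext w
    simp only [mem_insert, mem_singleton]
    constructor
    · rintro (rfl | rfl | rfl); exacts [hx'.1, hy'.1, hz'.1]
    · intro hw
      obtain ⟨i, hi⟩ := exists_turanPart w
      have : w ∈ e ∩ turanPart n i := Finset.mem_inter.2 ⟨hw, hi⟩
      fin_cases i
      · left; simpa using (show w ∈ ({x} : Finset (Fin n)) from hx ▸ this)
      · right; left; simpa using (show w ∈ ({y} : Finset (Fin n)) from hy ▸ this)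
      · right; right; simpa using (show w ∈ ({z} : Finset (Fin n)) from hz ▸ this)

end ForbiddenCopy

section Tripartitions

variable {V : Type*} {E : V → V → V → Prop}

section Expansion

variable {P Q R A B C X : Finset V}

lemma cnt_sq_union (h : IsTriple E) (hd : Disjoint P Q) :
    cnt E R (P ∪ Q) (P ∪ Q) = cnt E R P P + 2 * cnt E R P Q + cnt E R Q Q := by
  rw [cnt_union₂ hd, cnt_union₃ hd, cnt_union₃ hd, cnt_swap' h (A := R) (B := Q) (C := P)]
  ring

lemma cnt_cube_union (h : IsTriple E) (hd : Disjoint P Q) :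
    cnt E (P ∪ Q) (P ∪ Q) (P ∪ Q) =
      cnt E P P P + 3 * cnt E Q P P + 3 * cnt E P Q Q + cnt E Q Q Q := by
  rw [cnt_union hd, cnt_sq_union h hd, cnt_sq_union h hd, cnt_swap h (A := P) (B := P) (C := Q),
    cnt_swap h (A := Q) (B := P) (C := Q), cnt_rot h (A := Q) (B := P) (C := P)]
  ring

/-- Counting pairs in the link of `R` in a set split into three parts. -/
lemma cnt_sq_union₃ (h : IsTriple E) (hAB : Disjoint A B) (hAC : Disjoint A C)
    (hBC : Disjoint B C) :
    cnt E R (A ∪ B ∪ C) (A ∪ B ∪ C) = cnt E R A A + cnt E R B B + cnt E R C C +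
      2 * (cnt E R A B + cnt E R A C + cnt E R B C) := by
  rw [cnt_sq_union h (Finset.disjoint_union_left.2 ⟨hAC, hBC⟩), cnt_sq_union h hAB,
    cnt_union₂ hAB]
  ring

lemma cnt_cube_union₃ (h : IsTriple E) (hAB : Disjoint A B) (hAC : Disjoint A C)
    (hBC : Disjoint B C) :
    cnt E (A ∪ B ∪ C) (A ∪ B ∪ C) (A ∪ B ∪ C) = cnt E A A A + cnt E B B B + cnt E C C C +
      3 * (cnt E A B B + cnt E A C C + cnt E B A A + cnt E B C C + cnt E C A A + cnt E C B B) +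
      6 * cnt E A B C := by
  rw [cnt_cube_union h (Finset.disjoint_union_left.2 ⟨hAC, hBC⟩), cnt_cube_union h hAB,
    cnt_sq_union h hAB, cnt_union hAB, ← cnt_rot h (A := C) (B := A) (C := B)]
  ring

end Expansion

variable [Fintype V]

/-- The number of ordered pairs in the link of a vertex. -/
noncomputable def deg (E : V → V → V → Prop) (v : V) : ℝ := cnt E {v} univ univ

lemma deg_eq (E : V → V → V → Prop) (v : V) : deg E v = ∑ y, (codeg E v y : ℝ) := by
  rw [deg, cnt_eq_sum_codeg]; simp

lemma sum_deg (E : V → V → V → Prop) : ∑ v, deg E v = cnt E univ univ univ := by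
  simp [deg, cnt]

lemma sq_tangent {m D Q s : ℝ} (hm : 0 ≤ m) (hD : 0 ≤ D) (hQ : 0 ≤ Q) (hs : 0 ≤ s)
    (h : D ^ 2 ≤ s * Q) : 2 * m * D - 4 * m ^ 3 / 27 ≤ 2 * Q + D * s := by
  by_contra hcon
  push Not at hcon
  have h0 : 0 ≤ 2 * Q + D * s := by positivity
  have h1 := mul_self_lt_mul_self h0 hcon
  have h2 : 8 * D ^ 3 ≤ (2 * Q + D * s) * (2 * Q + D * s) := by
    nlinarith [sq_nonneg (2 * Q - D * s), mul_le_mul_of_nonneg_left h hD]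
  have h3 : 2 * m ^ 2 / 27 * m ≤ D * m := by nlinarith
  rcases hm.eq_or_lt with rfl | hm
  · nlinarith
  have h4 : 2 * m ^ 2 / 27 ≤ D := le_of_mul_le_mul_right h3 hm
  have h5 : 0 ≤ (D - 2 * m ^ 2 / 9) ^ 2 * (8 * D - 4 * m ^ 2 / 9) := by
    apply mul_nonneg (sq_nonneg _); nlinarith
  nlinarith

/-- In a cancellative 3-graph some edge has large total codegree, in terms of the density. -/
lemma cancellative_bound (h : IsTriple E)
    (hc : ∀ a b x y z, E a b x → E a b y → ¬ E x y z) {ρ : ℝ}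
    (hρ : ∀ a b c, E a b c → (codeg E a b + codeg E b c + codeg E a c : ℝ) ≤ ρ) :
    (Fintype.card V - ρ / 3) * cnt E univ univ univ ≤ 4 * (Fintype.card V : ℝ) ^ 4 / 27 := by
  set m : ℝ := (Fintype.card V : ℝ) with hm
  have hm0 : 0 ≤ m := Nat.cast_nonneg _
  set d : V → V → ℝ := fun x y => codeg E x y with hd
  have hd0 : ∀ x y, 0 ≤ d x y := fun x y => Nat.cast_nonneg _
  set s : V → ℝ := fun x => #{y | 0 < d x y} with hs
  set Q : V → ℝ := fun x => ∑ y, d x y ^ 2 with hQ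
  have hdsum : ∀ x y, d x y = ∑ z, ind E x y z := fun x y => codeg_eq_sum E x y
  have hCS : ∀ x, deg E x ^ 2 ≤ s x * Q x := by
    intro x
    have e1 : deg E x = ∑ y ∈ ({y | 0 < d x y} : Finset V), d x y := by
      rw [deg_eq, Finset.sum_filter_of_ne]
      intro y _ hy
      exact lt_of_le_of_ne (hd0 x y) (Ne.symm hy)
    have e2 : ∑ y ∈ ({y | 0 < d x y} : Finset V), d x y ^ 2 ≤ Q x :=
      Finset.sum_le_sum_of_subset_of_nonneg (Finset.subset_univ _) fun y _ _ => sq_nonneg _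
    rw [e1]
    exact sq_sum_le_card_mul_sum_sq.trans (mul_le_mul_of_nonneg_left e2 (Nat.cast_nonneg _))
  have hpt : ∀ x, 2 * m * deg E x - 4 * m ^ 3 / 27 ≤ 2 * Q x + deg E x * s x := fun x =>
    sq_tangent hm0 (cnt_nonneg _ _ _ _) (Finset.sum_nonneg fun y _ => sq_nonneg _)
      (Nat.cast_nonneg _) (hCS x)
  have q1 : ∑ x, Q x = ∑ x, ∑ y, ∑ z, ind E x y z * d x y := by
    refine Finset.sum_congr rfl fun x _ => Finset.sum_congr rfl fun y _ => ?_
    rw [← Finset.sum_mul, ← hdsum]; ring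
  have q2 : ∑ x, Q x = ∑ x, ∑ y, ∑ z, ind E x y z * d y z := by
    have : ∀ x y, d x y = d x y := fun _ _ => rfl
    rw [q1, Finset.sum_comm]
    calc ∑ y, ∑ x, ∑ z, ind E x y z * d x y = ∑ y, ∑ z, ∑ x, ind E x y z * d x y :=
          Finset.sum_congr rfl fun y _ => Finset.sum_comm
      _ = ∑ z, ∑ y, ∑ x, ind E x y z * d x y := Finset.sum_comm
      _ = _ := by
          refine Finset.sum_congr rfl fun x _ => Finset.sum_congr rfl fun y _ =>
            Finset.sum_congr rfl fun z _ => ?_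
          rw [ind_rot h z y x, ind_swap h y x z]
          simp only [hd, codeg_comm h z y]
  have q3 : ∑ x, Q x = ∑ x, ∑ y, ∑ z, ind E x y z * d x z := by
    rw [q1]
    refine Finset.sum_congr rfl fun x _ => ?_
    rw [Finset.sum_comm]
    refine Finset.sum_congr rfl fun y _ => Finset.sum_congr rfl fun z _ => ?_
    rw [ind_rot h x z y, ind_swap h z y x, ← ind_rot h x y z]
  have hT : cnt E univ univ univ = ∑ x, ∑ y, ∑ z, ind E x y z := rfl
  have hQρ : 3 * ∑ x, Q x ≤ ρ * cnt E univ univ univ := by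
    have : 3 * ∑ x, Q x = ∑ x, ∑ y, ∑ z, ind E x y z * (d x y + d y z + d x z) := by
      simp only [mul_add, Finset.sum_add_distrib]
      rw [← q1, ← q2, ← q3]; ring
    rw [this, hT, Finset.mul_sum]
    refine Finset.sum_le_sum fun x _ => ?_
    rw [Finset.mul_sum]
    refine Finset.sum_le_sum fun y _ => ?_
    rw [Finset.mul_sum]
    refine Finset.sum_le_sum fun z _ => ?_
    unfold ind
    split_ifs with hE
    · simpa using hρ x y z hE
    · simp
  have hQm : ∑ x, Q x ≤ ∑ x, deg E x * (m - s x) := by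
    rw [q2]
    refine Finset.sum_le_sum fun x _ => ?_
    rw [deg_eq, Finset.sum_mul]
    refine Finset.sum_le_sum fun y _ => ?_
    rw [codeg_eq_sum, Finset.sum_mul]
    refine Finset.sum_le_sum fun z _ => ?_
    unfold ind
    split_ifs with hE
    · rw [one_mul, one_mul, le_sub_iff_add_le]
      have hdis : Disjoint ({w | E y z w} : Finset V) ({w | 0 < d x w} : Finset V) := by
        rw [Finset.disjoint_left]
        intro w hw hw'
        simp only [mem_filter, mem_univ, true_and] at hw hw'
        have hne : (0 : ℝ) < codeg E x w := hw'
        have : codeg E x w = 0 := codeg_eq_zero (hc y z x w · (h.rot hE) hw)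
        rw [this] at hne; simp at hne
      have := Finset.card_union_of_disjoint hdis
      have h2 := Finset.card_le_univ (({w | E y z w} : Finset V) ∪ ({w | 0 < d x w} : Finset V))
      rw [this] at h2
      refine le_trans (le_of_eq ?_) (Nat.cast_le.2 h2)
      push_cast; rfl
    · simp
  have h1 : ∑ x, (2 * m * deg E x - 4 * m ^ 3 / 27) ≤ ∑ x, (2 * Q x + deg E x * s x) :=
    Finset.sum_le_sum fun x _ => hpt x
  have h2 : ∑ x : V, (4 * m ^ 3 / 27) = 4 * m ^ 4 / 27 := by
    rw [Finset.sum_const, card_univ, nsmul_eq_mul, ← hm]; ring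
  simp only [Finset.sum_sub_distrib, Finset.sum_add_distrib, mul_sub, ← Finset.mul_sum,
    ← Finset.sum_mul, sum_deg, h2] at h1 hQm
  nlinarith

/-- The subgraph of edges all of whose pairs have codegree at least `l`. -/
def heavy (l : ℕ) (E : V → V → V → Prop) (x y z : V) : Prop :=
  E x y z ∧ l ≤ codeg E x y ∧ l ≤ codeg E y z ∧ l ≤ codeg E x z

lemma heavy_isTriple (h : IsTriple E) (l : ℕ) : IsTriple (heavy l E) where
  swap {x y z} H := by
    obtain ⟨h1, h2, h3, h4⟩ := H
    exact ⟨h.swap h1, by rwa [codeg_comm h], h4, h3⟩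
  rot {x y z} H := by
    obtain ⟨h1, h2, h3, h4⟩ := H
    exact ⟨h.rot h1, h3, by rwa [codeg_comm h], by rwa [codeg_comm h]⟩
  ne H := h.ne H.1

lemma cnt_heavy (h : IsTriple E) (l : ℕ) : cnt E univ univ univ ≤
    cnt (heavy (l + 1) E) univ univ univ + 3 * l * (Fintype.card V : ℝ) ^ 2 := by
  let L : V → V → V → Prop := fun x y z => E x y z ∧ codeg E x y ≤ l
  have hL : ∀ x y, ∑ z, ind L x y z ≤ l := by
    intro x y
    by_cases hxy : codeg E x y ≤ l
    · calc ∑ z, ind L x y z = codeg E x y := by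
            rw [codeg_eq_sum]; simp [ind, L, hxy]
        _ ≤ l := by exact_mod_cast hxy
    · simp [ind, L, hxy]
  have hL1 : ∑ x, ∑ y, ∑ z, ind L x y z ≤ l * (Fintype.card V : ℝ) ^ 2 := by
    calc ∑ x, ∑ y, ∑ z, ind L x y z ≤ ∑ x : V, ∑ y : V, (l : ℝ) :=
          Finset.sum_le_sum fun x _ => Finset.sum_le_sum fun y _ => hL x y
      _ = _ := by simp; ring
  have hL2 : ∑ x, ∑ y, ∑ z, ind L y z x = ∑ x, ∑ y, ∑ z, ind L x y z := by
    rw [Finset.sum_comm]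
    exact Finset.sum_congr rfl fun y _ => Finset.sum_comm
  have hL3 : ∑ x, ∑ y, ∑ z, ind L x z y = ∑ x, ∑ y, ∑ z, ind L x y z :=
    Finset.sum_congr rfl fun y _ => Finset.sum_comm
  have hpt : ∀ x y z, ind E x y z ≤ ind (heavy (l + 1) E) x y z + ind L x y z + ind L y z x +
      ind L x z y := by
    intro x y z
    by_cases hE : E x y z
    · have h1 := h.rot hE
      have h2 := h.swap' hE
      by_cases c1 : codeg E x y ≤ l
      · have : ind L x y z = 1 := by simp [ind, L, hE, c1]
        linarith [ind_le_one E x y z, ind_nonneg (heavy (l + 1) E) x y z, ind_nonneg L y z x,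
          ind_nonneg L x z y]
      by_cases c2 : codeg E y z ≤ l
      · have : ind L y z x = 1 := by simp [ind, L, h1, c2]
        linarith [ind_le_one E x y z, ind_nonneg (heavy (l + 1) E) x y z, ind_nonneg L x y z,
          ind_nonneg L x z y]
      by_cases c3 : codeg E x z ≤ l
      · have : ind L x z y = 1 := by simp [ind, L, h2, c3]
        linarith [ind_le_one E x y z, ind_nonneg (heavy (l + 1) E) x y z, ind_nonneg L x y z,
          ind_nonneg L y z x]
      have : ind (heavy (l + 1) E) x y z = 1 := by
        unfold ind heavy; rw [if_pos]; exact ⟨hE, by omega, by omega, by omega⟩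
      linarith [ind_le_one E x y z, ind_nonneg L x y z, ind_nonneg L y z x, ind_nonneg L x z y]
    · have : ind E x y z = 0 := by simp [ind, hE]
      linarith [ind_nonneg (heavy (l + 1) E) x y z, ind_nonneg L x y z, ind_nonneg L y z x,
        ind_nonneg L x z y]
  have : cnt E univ univ univ ≤ ∑ x, ∑ y, ∑ z, (ind (heavy (l + 1) E) x y z + ind L x y z +
      ind L y z x + ind L x z y) :=
    Finset.sum_le_sum fun x _ => Finset.sum_le_sum fun y _ => Finset.sum_le_sum fun z _ =>
      hpt x y z
  simp only [Finset.sum_add_distrib, hL2, hL3] at this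
  have e : cnt (heavy (l + 1) E) univ univ univ
    = ∑ x, ∑ y, ∑ z, ind (heavy (l + 1) E) x y z := rfl
  linarith

lemma cnt_le_of_codeg_le {A B : Finset V} {l : ℝ} (C : Finset V)
    (hl : ∀ x ∈ A, ∀ y ∈ B, (codeg E x y : ℝ) ≤ l) :
    cnt E A B C ≤ #A * #B * l := by
  calc cnt E A B C ≤ cnt E A B univ := cnt_mono subset_rfl subset_rfl (Finset.subset_univ _)
    _ ≤ ∑ x ∈ A, ∑ y ∈ B, l := by
        rw [cnt_eq_sum_codeg]
        exact Finset.sum_le_sum fun x hx => Finset.sum_le_sum fun y hy => hl x hx y hy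
    _ = _ := by simp; ring

lemma cnt_le_of_codeg_le_offDiag (h : IsTriple E) {A : Finset V} {l : ℕ} (C : Finset V)
    (hl : ∀ x ∈ A, ∀ y ∈ A, x ≠ y → codeg E x y ≤ l) :
    cnt E A A C ≤ #A * #A * l := by
  refine cnt_le_of_codeg_le C fun x hx y hy => ?_
  by_cases hxy : x = y
  · subst hxy; rw [codeg_self h, Nat.cast_zero]; exact Nat.cast_nonneg l
  · exact_mod_cast hl x hx y hy hxy

/-- Three nearly equal classes that nearly span the 3-graph as a complete tripartite one. -/
structure Tripartition (t : ℕ) (E : V → V → V → Prop) (A B C : Finset V) : Prop where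
  disj_AB : Disjoint A B
  disj_AC : Disjoint A C
  disj_BC : Disjoint B C
  same_A : ∀ x ∈ A, ∀ y ∈ A, x ≠ y → codeg E x y ≤ t + 1
  same_B : ∀ x ∈ B, ∀ y ∈ B, x ≠ y → codeg E x y ≤ t + 1
  same_C : ∀ x ∈ C, ∀ y ∈ C, x ≠ y → codeg E x y ≤ t + 1
  cover : (1 - 0.000000000000000001) * (Fintype.card V : ℝ) ≤ #A + #B + #C
  missing : (#A : ℝ) * #B * #C - 0.000000000000000001 * (Fintype.card V : ℝ) ^ 3 ≤ cnt E A B C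
  card_A : |(#A : ℝ) - Fintype.card V / 3| ≤ 0.00000001 * Fintype.card V
  card_B : |(#B : ℝ) - Fintype.card V / 3| ≤ 0.00000001 * Fintype.card V
  card_C : |(#C : ℝ) - Fintype.card V / 3| ≤ 0.00000001 * Fintype.card V

lemma Tripartition.rot (h : IsTriple E) {t : ℕ} {A B C : Finset V} (P : Tripartition t E A B C) :
    Tripartition t E B C A :=
  ⟨P.disj_BC, P.disj_AB.symm, P.disj_AC.symm, P.same_B, P.same_C, P.same_A,
    by linarith [P.cover], by linarith [P.missing, cnt_rot h (A := A) (B := B) (C := C)],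
    P.card_B, P.card_C, P.card_A⟩

lemma near_third {a b c m : ℝ} (hm : 0 < m) (ha : 0 ≤ a) (hb : 0 ≤ b) (hc : 0 ≤ c)
    (hs : a + b + c ≤ m) (hp : (1 / 27 - 0.000000000000000001) * m ^ 3 ≤ a * b * c) :
    |a - m / 3| ≤ 0.00000001 * m := by
  have h1 : a * b * c ≤ a * ((m - a) / 2) ^ 2 := by
    have : b * c ≤ ((m - a) / 2) ^ 2 := by nlinarith [sq_nonneg (b - c)]
    nlinarith
  set x := a - m / 3 with hx
  have ham : a ≤ m := by linarith
  have h2 : x ^ 2 * (m - x) ≤ 0.000000000000000004 * m ^ 3 := by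
    have : a * ((m - a) / 2) ^ 2 = m ^ 3 / 27 - x ^ 2 * (m - x) / 4 := by
      rw [hx]; ring
    linarith
  have h3 : x ^ 2 * (m / 3) ≤ 0.000000000000000004 * m ^ 3 := by
    refine le_trans (mul_le_mul_of_nonneg_left ?_ (sq_nonneg x)) h2
    linarith
  have h4 : x ^ 2 ≤ (0.00000001 * m) ^ 2 := by
    by_contra hcon
    push Not at hcon
    nlinarith [sq_nonneg m, mul_pos hm hm]
  exact abs_le_of_sq_le_sq h4 (by positivity)

lemma mul_le_cube {a b c m : ℝ} (ha : 0 ≤ a) (hb : 0 ≤ b) (hc : 0 ≤ c) (hs : a + b + c ≤ m) :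
    a * b * c ≤ m ^ 3 / 27 := by
  have h1 : b * c ≤ ((m - a) / 2) ^ 2 := by
    have : b + c ≤ m - a := by linarith
    nlinarith [sq_nonneg (b - c)]
  have h2 : m ^ 3 / 27 - a * ((m - a) / 2) ^ 2 = (a - m / 3) ^ 2 * (4 / 3 * m - a) / 4 := by ring
  have h3 : 0 ≤ (a - m / 3) ^ 2 * (4 / 3 * m - a) / 4 := by
    have : 0 ≤ 4 / 3 * m - a := by linarith
    positivity
  nlinarith

set_option maxHeartbeats 1000000 in
lemma exists_tripartition (h : IsTriple E) {t : ℕ} (hF : Free t E)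
    (hm : (t + 2 : ℝ) ≤ 0.00000000000000000001 * Fintype.card V)
    (hT : (2 / 9 - 0.00000000000000000001) * (Fintype.card V : ℝ) ^ 3 ≤ cnt E univ univ univ) :
    ∃ A B C, Tripartition t E A B C := by
  set m : ℝ := (Fintype.card V : ℝ) with hmdef
  have hm0 : 0 < m := by have : (0 : ℝ) ≤ t := Nat.cast_nonneg _; nlinarith
  set E' := heavy (t + 1 + 1) E with hE'
  have h' : IsTriple E' := heavy_isTriple h _
  have hcan : ∀ a b x y z, E' a b x → E' a b y → ¬ E' x y z := by
    intro a b x y z h1 h2 h3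
    have h4 := hF.codeg_le (h.ne h3.1) h1.1 h2.1
    have h5 := h3.2.1
    omega
  have hT' : (2 / 9 - 0.00000000000000000004) * m ^ 3 ≤ cnt E' univ univ univ := by
    have h1 := cnt_heavy h (t + 1)
    rw [← hmdef, ← hE'] at h1
    push_cast at h1
    have : (t + 1 : ℝ) * m ^ 2 ≤ 0.00000000000000000001 * m * m ^ 2 :=
      mul_le_mul_of_nonneg_right (by linarith) (by positivity)
    nlinarith
  obtain ⟨a, b, c, habc, hsum⟩ : ∃ a b c, E' a b c ∧
      (1 - 0.000000000000000001) * m < (codeg E' a b + codeg E' b c + codeg E' a c : ℝ) := by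
    by_contra hcon
    push Not at hcon
    have h1 := cancellative_bound h' hcan hcon
    rw [← hmdef] at h1
    have h2 : (m - (1 - 0.000000000000000001) * m / 3) * ((2 / 9 - 0.00000000000000000004) * m ^ 3) ≤
        (m - (1 - 0.000000000000000001) * m / 3) * cnt E' univ univ univ :=
      mul_le_mul_of_nonneg_left hT' (by nlinarith)
    have h3 : 0 < m ^ 4 := by positivity
    nlinarith
  set A : Finset V := {w | E' b c w} with hA
  set B : Finset V := {w | E' a c w} with hB
  set C : Finset V := {w | E' a b w} with hC
  have hAB : Disjoint A B := by
    rw [Finset.disjoint_left]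
    intro w h1 h2
    simp only [hA, hB, mem_filter, mem_univ, true_and] at h1 h2
    exact hcan c w a b c (h'.rot h2) (h'.rot h1) habc
  have hAC : Disjoint A C := by
    rw [Finset.disjoint_left]
    intro w h1 h2
    simp only [hA, hC, mem_filter, mem_univ, true_and] at h1 h2
    exact hcan b w a c b (h'.rot h2) (h'.swap (h'.rot' h1)) (h'.swap' habc)
  have hBC : Disjoint B C := by
    rw [Finset.disjoint_left]
    intro w h1 h2
    simp only [hB, hC, mem_filter, mem_univ, true_and] at h1 h2
    exact hcan a w b c a (h'.swap' h2) (h'.swap' h1) (h'.rot habc)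
  have hsame : ∀ u v x y, E' u v x → E' u v y → x ≠ y → codeg E x y ≤ t + 1 :=
    fun u v x y h1 h2 hxy => hF.codeg_le hxy h1.1 h2.1
  have sA : ∀ x ∈ A, ∀ y ∈ A, x ≠ y → codeg E x y ≤ t + 1 := fun x hx y hy =>
    hsame b c x y (by simpa [hA] using hx) (by simpa [hA] using hy)
  have sB : ∀ x ∈ B, ∀ y ∈ B, x ≠ y → codeg E x y ≤ t + 1 := fun x hx y hy =>
    hsame a c x y (by simpa [hB] using hx) (by simpa [hB] using hy)
  have sC : ∀ x ∈ C, ∀ y ∈ C, x ≠ y → codeg E x y ≤ t + 1 := fun x hx y hy =>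
    hsame a b x y (by simpa [hC] using hx) (by simpa [hC] using hy)
  have hcov : (1 - 0.000000000000000001) * m ≤ #A + #B + #C := by
    have e1 : codeg E' b c = #A := rfl
    have e2 : codeg E' a c = #B := rfl
    have e3 : codeg E' a b = #C := rfl
    rw [e1, e2, e3] at hsum
    linarith
  clear_value A B C
  set U := A ∪ B ∪ C with hU
  set X := univ \ U with hX
  have hUX : Disjoint U X := Finset.disjoint_sdiff
  have hUXu : U ∪ X = univ := Finset.union_sdiff_of_subset (Finset.subset_univ _)
  have hUc : (#U : ℝ) = #A + #B + #C := by
    rw [hU, Finset.card_union_of_disjoint (Finset.disjoint_union_left.2 ⟨hAC, hBC⟩),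
      Finset.card_union_of_disjoint hAB]; push_cast; ring
  have hUm : (#U : ℝ) + #X = m := by
    have := Finset.card_union_of_disjoint hUX
    rw [hUXu, card_univ] at this
    rw [hmdef, this]; push_cast; ring
  have hsle : (#A : ℝ) + #B + #C ≤ m := by
    have : (0 : ℝ) ≤ #X := Nat.cast_nonneg _
    linarith
  have hTexp := cnt_cube_union h hUX
  rw [hUXu] at hTexp
  have hXexp := cnt_sq_union h hUX (R := X)
  rw [hUXu] at hXexp
  have hUU := cnt_cube_union₃ h hAB hAC hBC
  rw [← hU] at hUU
  have hXb : cnt E X univ univ ≤ 0.000000000000000001 * m * m * m := by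
    have h1 := cnt_le_card E X univ univ
    rw [card_univ, ← hmdef] at h1
    have h2 : (#X : ℝ) ≤ 0.000000000000000001 * m := by linarith
    nlinarith [mul_le_mul_of_nonneg_right h2 (mul_nonneg hm0.le hm0.le)]
  have pair : ∀ P Q R : Finset V, Disjoint P Q → Disjoint P R → Disjoint Q R →
      (∀ x ∈ P, ∀ y ∈ P, x ≠ y → codeg E x y ≤ t + 1) → (#P : ℝ) ≤ m →
      cnt E P P P + cnt E Q P P + cnt E R P P ≤ #P * (0.00000000000000000001 * m * m) := by
    intro P Q R hPQ hPR hQR hP hPm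
    have h1 := cnt_le_of_codeg_le_offDiag h (P ∪ Q ∪ R) hP
    rw [cnt_union₃ (Finset.disjoint_union_left.2 ⟨hPR, hQR⟩), cnt_union₃ hPQ] at h1
    rw [← cnt_rot h (A := Q), ← cnt_rot h (A := R)] at h1
    push_cast at h1
    have hp : (0 : ℝ) ≤ #P := Nat.cast_nonneg _
    have h2 : (#P : ℝ) * (t + 1) ≤ m * (0.00000000000000000001 * m) := by
      apply mul_le_mul hPm (by linarith) (by positivity) hm0.le
    nlinarith [mul_le_mul_of_nonneg_left h2 hp]
  have a0 : (0 : ℝ) ≤ #A := Nat.cast_nonneg _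
  have b0 : (0 : ℝ) ≤ #B := Nat.cast_nonneg _
  have c0 : (0 : ℝ) ≤ #C := Nat.cast_nonneg _
  have pA := pair A B C hAB hAC hBC sA (by linarith)
  have pB := pair B A C hAB.symm hBC hAC sB (by linarith)
  have pC := pair C A B hAC.symm hBC.symm hAB sC (by linarith)
  clear hcan habc hsum hsame hT' hUX hUXu hUc
  clear_value U X E' m
  have n1 := cnt_nonneg E A A A
  have n2 := cnt_nonneg E B B B
  have n3 := cnt_nonneg E C C C
  have n4 := cnt_nonneg E X U U
  have n5 := cnt_nonneg E X X X
  have n6 := cnt_nonneg E X U X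
  have n7 : cnt E U X X = cnt E X U X := cnt_swap h
  have hpsum : (#A : ℝ) * (0.00000000000000000001 * m * m) + #B * (0.00000000000000000001 * m * m) + #C * (0.00000000000000000001 * m * m)
      ≤ 0.00000000000000000001 * m ^ 3 := by
    nlinarith [mul_le_mul_of_nonneg_right hsle (mul_nonneg hm0.le hm0.le)]
  have hm3 : 0 < m ^ 3 := by positivity
  have hbig : (1 / 27 - 0.000000000000000001) * m ^ 3 ≤ cnt E A B C := by
    linarith
  have hprod : cnt E A B C ≤ (#A : ℝ) * #B * #C := cnt_le_card E A B C
  have hamgm := mul_le_cube a0 b0 c0 hsle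
  subst hmdef
  exact ⟨A, B, C, hAB, hAC, hBC, sA, sB, sC, hcov, by linarith,
    near_third hm0 a0 b0 c0 hsle (by linarith),
    near_third hm0 b0 c0 a0 (by linarith) (by linarith [mul_comm ((#B : ℝ) * #C) #A, mul_assoc (#A : ℝ) #B #C]),
    near_third hm0 c0 a0 b0 (by linarith) (by linarith [mul_comm ((#A : ℝ) * #B) #C, mul_assoc (#C : ℝ) #A #B])⟩

end Tripartitions

section Links

variable {V : Type*} {E : V → V → V → Prop} [Fintype V]

lemma cnt_singleton₁ (E : V → V → V → Prop) (v : V) (B C : Finset V) :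
    cnt E {v} B C = ∑ x ∈ B, ∑ y ∈ C, ind E v x y := by
  simp [cnt]

lemma cnt_pair_le {a v : V} (B C : Finset V) (hav : ∀ b c, ¬ (E a b c ∧ E v b c)) :
    cnt E {a} B C + cnt E {v} B C ≤ #B * #C := by
  rw [cnt_singleton₁, cnt_singleton₁]
  simp only [← Finset.sum_add_distrib]
  calc ∑ x ∈ B, ∑ y ∈ C, (ind E a x y + ind E v x y) ≤ ∑ x ∈ B, ∑ y ∈ C, (1 : ℝ) := by
        refine Finset.sum_le_sum fun x _ => Finset.sum_le_sum fun y _ => ?_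
        have := hav x y
        unfold ind
        split_ifs <;> first | (exfalso; tauto) | norm_num
    _ = _ := by simp

/-- A set of pairs whose codegree into `A` is small has few elements if `A × B × C` is nearly
complete. -/
lemma card_light_pairs {A B C : Finset V} (N : Finset (V × V)) (hN : N ⊆ B ×ˢ C) {l : ℝ}
    (hl : ∀ p ∈ N, cnt E {p.1} {p.2} A ≤ l) :
    #N * (#A - l) ≤ (#B : ℝ) * #C * #A - cnt E B C A := by
  have h1 : cnt E B C A = ∑ p ∈ B ×ˢ C, cnt E {p.1} {p.2} A := by
    rw [Finset.sum_product]; simp [cnt]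
  have h2 : (#B : ℝ) * #C * #A = ∑ p ∈ B ×ˢ C, (#A : ℝ) := by
    rw [Finset.sum_const, nsmul_eq_mul, Finset.card_product]; push_cast; ring
  rw [h1, h2, ← Finset.sum_sub_distrib]
  calc (#N : ℝ) * (#A - l) = ∑ p ∈ N, (#A - l) := by simp; ring
    _ ≤ ∑ p ∈ N, (#A - cnt E {p.1} {p.2} A) :=
        Finset.sum_le_sum fun p hp => by linarith [hl p hp]
    _ ≤ _ := Finset.sum_le_sum_of_subset_of_nonneg hN fun p _ _ => by
        have := cnt_le_card E {p.1} {p.2} A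
        simp at this
        linarith

lemma cnt_link_self_le (h : IsTriple E) (v : V) {B P : Finset V} (hP : P ⊆ B) {r : ℝ}
    (hr : ∀ x ∈ P, cnt E {v} {x} B ≤ r) :
    cnt E {v} B B ≤ (#B - #P : ℝ) ^ 2 + 2 * #P * r := by
  have hd : Disjoint P (B \ P) := Finset.disjoint_sdiff
  have hB : P ∪ (B \ P) = B := Finset.union_sdiff_of_subset hP
  have h1 : cnt E {v} P B ≤ #P * r := by
    have : cnt E {v} P B = ∑ x ∈ P, cnt E {v} {x} B := by simp [cnt]
    rw [this]
    calc _ ≤ ∑ x ∈ P, r := Finset.sum_le_sum hr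
      _ = _ := by simp
  have h2 : cnt E {v} B B = cnt E {v} P B + cnt E {v} (B \ P) B := by
    conv_lhs => rw [← hB]
    rw [cnt_union₂ hd, hB]
  have h3 : cnt E {v} (B \ P) B = cnt E {v} (B \ P) P + cnt E {v} (B \ P) (B \ P) := by
    conv_lhs => rw [← hB]
    rw [hB, ← cnt_union₃ hd, hB]
  have h4 : cnt E {v} (B \ P) P ≤ cnt E {v} P B := by
    rw [cnt_swap' h]; exact cnt_mono subset_rfl subset_rfl Finset.sdiff_subset
  have h5 := cnt_le_card E {v} (B \ P) (B \ P)
  have h6 : (#(B \ P) : ℝ) = #B - #P := by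
    rw [Finset.card_sdiff_of_subset hP, Nat.cast_sub (Finset.card_le_card hP)]
  rw [h6] at h5
  simp only [card_singleton, Nat.cast_one, one_mul] at h5
  nlinarith

lemma cnt_link_le_mul (h : IsTriple E) (v : V) {B C P Q : Finset V} (hP : P ⊆ B) (hQ : Q ⊆ C)
    {r : ℝ} (hrP : ∀ x ∈ B \ P, cnt E {v} {x} C ≤ r) (hrQ : ∀ x ∈ C \ Q, cnt E {v} {x} B ≤ r) :
    cnt E {v} B C ≤ #P * #Q + (#(B \ P) + #(C \ Q)) * r := by
  have hB : P ∪ (B \ P) = B := Finset.union_sdiff_of_subset hP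
  have hC : Q ∪ (C \ Q) = C := Finset.union_sdiff_of_subset hQ
  have h1 : cnt E {v} (B \ P) C ≤ #(B \ P) * r := by
    have : cnt E {v} (B \ P) C = ∑ x ∈ B \ P, cnt E {v} {x} C := by simp [cnt]
    rw [this]
    calc _ ≤ ∑ x ∈ B \ P, r := Finset.sum_le_sum hrP
      _ = _ := by simp
  have h2 : cnt E {v} (C \ Q) B ≤ #(C \ Q) * r := by
    have : cnt E {v} (C \ Q) B = ∑ x ∈ C \ Q, cnt E {v} {x} B := by simp [cnt]
    rw [this]
    calc _ ≤ ∑ x ∈ C \ Q, r := Finset.sum_le_sum hrQ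
      _ = _ := by simp
  have h3 : cnt E {v} B C = cnt E {v} P C + cnt E {v} (B \ P) C := by
    rw [← cnt_union₂ Finset.disjoint_sdiff, hB]
  have h4 : cnt E {v} P C = cnt E {v} P Q + cnt E {v} P (C \ Q) := by
    rw [← cnt_union₃ Finset.disjoint_sdiff, hC]
  have h5 : cnt E {v} P (C \ Q) ≤ cnt E {v} (C \ Q) B := by
    rw [cnt_swap' h]; exact cnt_mono subset_rfl subset_rfl hP
  have h6 := cnt_le_card E {v} P Q
  simp only [card_singleton, Nat.cast_one, one_mul] at h6
  nlinarith

lemma link_numeric {m b c p q x : ℝ} (hm : 0 < m) (hp : 0 ≤ p) (hq : 0 ≤ q) (hpb : p ≤ b)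
    (hqc : q ≤ c) (hb : b ≤ (1 / 3 + 0.00000001) * m) (hc : c ≤ (1 / 3 + 0.00000001) * m)
    (hx : x ≤ p * q + 0.00001 * m ^ 2) (hx' : 0.001 * m ^ 2 < x)
    (hd : (2 / 9 - 0.00000000001) * m ^ 2 ≤ (b - p) ^ 2 + (c - q) ^ 2 + 2 * x) :
    (1 / 9 - 0.000001) * m ^ 2 ≤ x := by
  set K := (1 / 3 + 0.00000001) * m with hK
  have hm2 : 0 < m ^ 2 := by positivity
  have e1 : (b - p) ^ 2 ≤ (K - p) ^ 2 := by
    apply pow_le_pow_left₀ <;> linarith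
  have e2 : (c - q) ^ 2 ≤ (K - q) ^ 2 := by
    apply pow_le_pow_left₀ <;> linarith
  have hKK : K ^ 2 ≤ (1 / 9 + 0.00000001) * m ^ 2 := by rw [hK, mul_pow]; nlinarith
  have h1 : (p + q) * (2 * K - (p + q)) ≤ 0.000022 * m ^ 2 := by nlinarith
  have h2 : 0.06 * m ≤ p + q := by
    have : (0.06 * m) ^ 2 ≤ (p + q) ^ 2 := by nlinarith [sq_nonneg (p - q)]
    exact le_of_sq_le_sq this (by linarith) |> fun h => h
  have h3 : 0 ≤ 2 * K - (p + q) := by linarith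
  have h4 : 2 * K - (p + q) ≤ 0.00037 * m := by
    have := mul_le_mul_of_nonneg_right h2 h3
    by_contra hcon
    push Not at hcon
    nlinarith
  have h5 : (K - p) ^ 2 + (K - q) ^ 2 ≤ (0.00037 * m) ^ 2 := by
    have : (2 * K - (p + q)) ^ 2 ≤ (0.00037 * m) ^ 2 := pow_le_pow_left₀ h3 h4 2
    have h6 : 0 ≤ (K - p) * (K - q) := mul_nonneg (by linarith) (by linarith)
    nlinarith
  nlinarith

variable {t : ℕ} {A B C : Finset V}

/-- If the link of `v` has many edges between `B` and `C`, few of its edges meet `A`. -/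
lemma Tripartition.cnt_part_univ_le (h : IsTriple E) (hF : Free t E)
    (hm : (t + 2 : ℝ) ≤ 0.00000000000000000001 * Fintype.card V) (P : Tripartition t E A B C) {v : V}
    (hv : 0.001 * (Fintype.card V : ℝ) ^ 2 < cnt E {v} B C) :
    cnt E {v} A univ ≤ 0.000000000000002 * (Fintype.card V : ℝ) ^ 2 := by
  obtain ⟨hAB, hAC, hBC, -, -, -, hcov, hmiss, cA, cB, cC⟩ := P
  obtain ⟨m, hmdef⟩ : ∃ m : ℝ, m = (Fintype.card V : ℝ) := ⟨_, rfl⟩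
  rw [← hmdef] at hm hv hcov hmiss cA cB cC ⊢
  have hm0 : 0 < m := by have : (0 : ℝ) ≤ t := Nat.cast_nonneg _; nlinarith
  rw [abs_le] at cA cB cC
  have hle : ∀ S : Finset V, (#S : ℝ) ≤ m := fun S => by
    rw [hmdef]; exact_mod_cast Finset.card_le_univ S
  have hpos : ∀ S : Finset V, (0 : ℝ) ≤ #S := fun S => Nat.cast_nonneg _
  set H := A.filter (fun a => t + 2 ≤ codeg E v a) with hH
  have hHc : (#H : ℝ) * (0.001 * m ^ 2) ≤ 0.000000000000000001 * m ^ 3 := by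
    have h1 : ∑ a ∈ H, (0.001 * m ^ 2) ≤ ∑ a ∈ A, ((#B : ℝ) * #C - cnt E {a} B C) := by
      refine (Finset.sum_le_sum fun a ha => ?_).trans
        (Finset.sum_le_sum_of_subset_of_nonneg (Finset.filter_subset _ _) fun a _ _ => ?_)
      · have ha2 := (Finset.mem_filter.1 ha).2
        have hne : v ≠ a := by rintro rfl; rw [codeg_self h] at ha2; omega
        have := cnt_pair_le (E := E) (a := a) (v := v) B C (by
          rintro b c ⟨h1, h2⟩
          have := hF.codeg_le hne (h.rot h2) (h.rot h1)
          omega)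
        linarith
      · have := cnt_le_card E {a} B C
        simp only [card_singleton, Nat.cast_one, one_mul] at this
        linarith
    rw [Finset.sum_sub_distrib, ← cnt_eq_sum_left, Finset.sum_const, Finset.sum_const,
      nsmul_eq_mul, nsmul_eq_mul] at h1
    linarith
  have hHc' : (#H : ℝ) ≤ 0.000000000000001 * m := by
    have : (#H : ℝ) * (0.001 * m ^ 2) ≤ 0.000000000000001 * m * (0.001 * m ^ 2) := by linarith
    exact le_of_mul_le_mul_right this (by positivity)
  have h2 : cnt E {v} A univ = ∑ a ∈ A, (codeg E v a : ℝ) := by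
    rw [cnt_eq_sum_codeg]; simp
  have h3 : ∑ a ∈ A, (codeg E v a : ℝ) ≤ ∑ a ∈ A, ((if a ∈ H then m else 0) + (t + 2)) := by
    refine Finset.sum_le_sum fun a ha => ?_
    have hb : (codeg E v a : ℝ) ≤ m := by rw [hmdef]; exact_mod_cast codeg_le_card E v a
    have ht : (0 : ℝ) ≤ t := Nat.cast_nonneg _
    split_ifs with haH
    · linarith
    · have : codeg E v a ≤ t + 2 := by
        by_contra hcon
        exact haH (Finset.mem_filter.2 ⟨ha, by omega⟩)
      have : (codeg E v a : ℝ) ≤ t + 2 := by exact_mod_cast this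
      linarith
  rw [Finset.sum_add_distrib, ← Finset.sum_filter, Finset.filter_mem_eq_inter,
    Finset.inter_eq_right.2 (Finset.filter_subset _ _), Finset.sum_const, Finset.sum_const,
    nsmul_eq_mul, nsmul_eq_mul] at h3
  have h4 := mul_le_mul (hle A) hm (by positivity) hm0.le
  have h5 := mul_le_mul_of_nonneg_right hHc' hm0.le
  nlinarith

set_option maxHeartbeats 1000000 in
lemma Tripartition.dichotomy (h : IsTriple E) (hF : Free t E)
    (hm : (t + 2 : ℝ) ≤ 0.00000000000000000001 * Fintype.card V) (P : Tripartition t E A B C) {v : V}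
    (hdeg : (2 / 9 - 0.00000000000000000001) * (Fintype.card V : ℝ) ^ 2 ≤ deg E v)
    (hv : 0.001 * (Fintype.card V : ℝ) ^ 2 < cnt E {v} B C) :
    (1 / 9 - 0.000001) * (Fintype.card V : ℝ) ^ 2 ≤ cnt E {v} B C := by
  have hA := P.cnt_part_univ_le h hF hm hv
  obtain ⟨hAB, hAC, hBC, -, -, -, hcov, hmiss, cA, cB, cC⟩ := P
  obtain ⟨m, hmdef⟩ : ∃ m : ℝ, m = (Fintype.card V : ℝ) := ⟨_, rfl⟩
  rw [← hmdef] at hA hm hdeg hv hcov hmiss cA cB cC ⊢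
  have hm0 : 0 < m := by have : (0 : ℝ) ≤ t := Nat.cast_nonneg _; nlinarith
  rw [abs_le] at cA cB cC
  have hle : ∀ S : Finset V, (#S : ℝ) ≤ m := fun S => by
    rw [hmdef]; exact_mod_cast Finset.card_le_univ S
  have hpos : ∀ S : Finset V, (0 : ℝ) ≤ #S := fun S => Nat.cast_nonneg _
  -- few pairs of `B × C` have small codegree
  set N : Finset (V × V) := (B ×ˢ C).filter (fun p => codeg E p.1 p.2 ≤ t + 1) with hN
  have hNc : (#N : ℝ) ≤ 0.00000000000000001 * m ^ 2 := by
    have h1 := card_light_pairs (E := E) (A := A) N (Finset.filter_subset _ _) (l := t + 1) (by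
      intro p hp
      have h2 := (Finset.mem_filter.1 hp).2
      exact (cnt_le_codeg E _ _ _).trans (by exact_mod_cast h2))
    rw [← cnt_rot h] at h1
    have h2 : (#N : ℝ) * (0.3 * m) ≤ #N * (#A - (t + 1)) :=
      mul_le_mul_of_nonneg_left (by linarith) (Nat.cast_nonneg _)
    have h3 : (#N : ℝ) * (0.3 * m) ≤ 0.00000000000000001 * m ^ 2 * (0.3 * m) := by
      have : (0 : ℝ) < m ^ 3 := by positivity
      nlinarith
    exact le_of_mul_le_mul_right h3 (by positivity)
  have hx : ∀ x, cnt E {v} {x} B * cnt E {v} {x} C ≤ 0.00000000000000001 * m ^ 2 := by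
    intro x
    rw [cnt_singleton₂, cnt_singleton₂]
    refine le_trans ?_ hNc
    rw [← Nat.cast_mul, ← Finset.card_product]
    refine Nat.cast_le.2 (Finset.card_le_card ?_)
    rintro ⟨b, c⟩ hbc
    simp only [mem_product, mem_filter] at hbc
    obtain ⟨⟨hb, h1⟩, hc, h2⟩ := hbc
    refine Finset.mem_filter.2 ⟨Finset.mem_product.2 ⟨hb, hc⟩, hF.codeg_le ?_ h1 h2⟩
    intro e
    have e' : b = c := e
    exact Finset.disjoint_left.1 hBC hb (e' ▸ hc)
  set Pb := B.filter (fun x => 0.00001 * m < cnt E {v} {x} C) with hPb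
  set Qc := C.filter (fun x => 0.00001 * m < cnt E {v} {x} B) with hQc
  have hPB : Pb ⊆ B := Finset.filter_subset _ _
  have hQC : Qc ⊆ C := Finset.filter_subset _ _
  have hsm : ∀ a b : ℝ, 0 ≤ a → 0.00001 * m < b → a * b ≤ 0.00000000000000001 * m ^ 2 → a ≤ 0.000000000001 * m := by
    intro a b ha hb hab
    by_contra hcon
    push Not at hcon
    have : 0.000000000001 * m * (0.00001 * m) < a * b :=
      mul_lt_mul'' hcon hb (by positivity) (by positivity)
    nlinarith
  have hBB := cnt_link_self_le h v hPB (r := 0.000000000001 * m) (fun x hxP =>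
    hsm _ _ (cnt_nonneg _ _ _ _) (Finset.mem_filter.1 hxP).2 (hx x))
  have hCC := cnt_link_self_le h v hQC (r := 0.000000000001 * m) (fun x hxP =>
    hsm _ _ (cnt_nonneg _ _ _ _) (Finset.mem_filter.1 hxP).2 (by linarith [hx x]))
  have hBCle := cnt_link_le_mul h v hPB hQC (r := 0.00001 * m)
    (by
      intro x hxP
      rw [Finset.mem_sdiff] at hxP
      by_contra hcon
      push Not at hcon
      exact hxP.2 (Finset.mem_filter.2 ⟨hxP.1, hcon⟩))
    (by
      intro x hxP
      rw [Finset.mem_sdiff] at hxP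
      by_contra hcon
      push Not at hcon
      exact hxP.2 (Finset.mem_filter.2 ⟨hxP.1, hcon⟩))
  -- assemble the degree of `v`
  set U := A ∪ B ∪ C with hU
  have hUX : Disjoint U (univ \ U) := Finset.disjoint_sdiff
  have hUXu : U ∪ (univ \ U) = univ := Finset.union_sdiff_of_subset (Finset.subset_univ _)
  have hUc : (#U : ℝ) = #A + #B + #C := by
    rw [hU, Finset.card_union_of_disjoint (Finset.disjoint_union_left.2 ⟨hAC, hBC⟩),
      Finset.card_union_of_disjoint hAB]; push_cast; ring
  have hX : (#(univ \ U) : ℝ) ≤ 0.000000000000000001 * m := by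
    have := Finset.card_union_of_disjoint hUX
    rw [hUXu, card_univ] at this
    have h2 : m = #U + #(univ \ U) := by rw [hmdef, this]; push_cast; ring
    linarith
  have hdegU : deg E v ≤ cnt E {v} U U + 2 * cnt E {v} (univ \ U) univ := by
    have h1 := cnt_sq_union h hUX (R := {v})
    have h2 : cnt E {v} (univ \ U) univ = cnt E {v} U (univ \ U) + cnt E {v} (univ \ U) (univ \ U) := by
      have h3 : cnt E {v} (univ \ U) (U ∪ (univ \ U)) = _ := cnt_union₃ hUX
      rw [hUXu] at h3
      rw [h3, cnt_swap' h (B := univ \ U) (C := U)]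
    rw [hUXu] at h1
    rw [deg, h1, h2]
    linarith [cnt_nonneg E {v} (univ \ U) (univ \ U)]
  have hXc : cnt E {v} (univ \ U) univ ≤ 0.000000000000000001 * m * m := by
    have h1 := cnt_le_card E {v} (univ \ U) univ
    rw [card_univ, ← hmdef] at h1
    simp only [card_singleton, Nat.cast_one, one_mul] at h1
    exact h1.trans (mul_le_mul_of_nonneg_right hX hm0.le)
  have hUU := cnt_sq_union₃ h hAB hAC hBC (R := {v})
  rw [← hU] at hUU
  have hAle : cnt E {v} A A + cnt E {v} A B + cnt E {v} A C ≤ cnt E {v} A univ := by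
    rw [← cnt_union₃ hAB, ← cnt_union₃ (Finset.disjoint_union_left.2 ⟨hAC, hBC⟩)]
    exact cnt_mono subset_rfl subset_rfl (Finset.subset_univ _)
  have nA := cnt_nonneg E {v} A A
  have hsd : (#(B \ Pb) : ℝ) + #(C \ Qc) ≤ m := by
    have h1 : (#(B \ Pb) : ℝ) ≤ #B := by exact_mod_cast Finset.card_le_card Finset.sdiff_subset
    have h2 : (#(C \ Qc) : ℝ) ≤ #C := by exact_mod_cast Finset.card_le_card Finset.sdiff_subset
    linarith
  have hpb : (#Pb : ℝ) ≤ #B := by exact_mod_cast Finset.card_le_card hPB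
  have hqc : (#Qc : ℝ) ≤ #C := by exact_mod_cast Finset.card_le_card hQC
  have hsd' : ((#(B \ Pb) : ℝ) + #(C \ Qc)) * (0.00001 * m) ≤ 0.00001 * m ^ 2 := by
    have h1 := mul_le_mul_of_nonneg_right hsd hm0.le
    linarith
  have hsp : 2 * (#Pb : ℝ) * (0.000000000001 * m) + 2 * (#Qc : ℝ) * (0.000000000001 * m) ≤ 0.000000000004 * m ^ 2 := by
    have h1 := mul_le_mul_of_nonneg_right (hle Pb) hm0.le
    have h2 := mul_le_mul_of_nonneg_right (hle Qc) hm0.le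
    linarith
  refine link_numeric hm0 (hpos Pb) (hpos Qc) hpb hqc (by linarith) (by linarith)
    (by linarith) hv ?_
  have hm2 : 0 < m ^ 2 := by positivity
  linarith

end Links

section Labellings

variable {V : Type*} {E : V → V → V → Prop} [Fintype V]

/-- A partition of the vertices into three parts, whose vertices have nearly complete links
across, and an exceptional set whose vertices have links inside the parts. -/
structure Labelling (t : ℕ) (E : V → V → V → Prop) (A B C X : Finset V) : Prop where
  disj_AB : Disjoint A B
  disj_AC : Disjoint A C
  disj_BC : Disjoint B C
  disj_X : Disjoint (A ∪ B ∪ C) X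
  cover : A ∪ B ∪ C ∪ X = univ
  card_A : |(#A : ℝ) - Fintype.card V / 3| ≤ 0.000001 * Fintype.card V
  card_B : |(#B : ℝ) - Fintype.card V / 3| ≤ 0.000001 * Fintype.card V
  card_C : |(#C : ℝ) - Fintype.card V / 3| ≤ 0.000001 * Fintype.card V
  miss_A : ∀ v ∈ A, (#B : ℝ) * #C - 0.00001 * (Fintype.card V : ℝ) ^ 2 ≤ cnt E {v} B C
  miss_B : ∀ v ∈ B, (#C : ℝ) * #A - 0.00001 * (Fintype.card V : ℝ) ^ 2 ≤ cnt E {v} C A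
  miss_C : ∀ v ∈ C, (#A : ℝ) * #B - 0.00001 * (Fintype.card V : ℝ) ^ 2 ≤ cnt E {v} A B
  same_A : ∀ x ∈ A, ∀ y ∈ A, x ≠ y → codeg E x y < t
  same_B : ∀ x ∈ B, ∀ y ∈ B, x ≠ y → codeg E x y < t
  same_C : ∀ x ∈ C, ∀ y ∈ C, x ≠ y → codeg E x y < t
  same_X : ∀ x ∈ X, ∀ y ∈ X, x ≠ y → codeg E x y < t
  cross_X : ∀ v ∈ X, cnt E {v} B C ≤ 0.0011 * (Fintype.card V : ℝ) ^ 2 ∧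
    cnt E {v} C A ≤ 0.0011 * (Fintype.card V : ℝ) ^ 2 ∧
    cnt E {v} A B ≤ 0.0011 * (Fintype.card V : ℝ) ^ 2
  inner_X : ∀ v ∈ X, 0.2 * (Fintype.card V : ℝ) ^ 2 ≤
    cnt E {v} A A + cnt E {v} B B + cnt E {v} C C

namespace Labelling

variable {t : ℕ} {A B C X : Finset V}

lemma rot (L : Labelling t E A B C X) : Labelling t E B C A X :=
  have e : B ∪ C ∪ A = A ∪ B ∪ C := by rw [Finset.union_comm, Finset.union_assoc]
  ⟨L.disj_BC, L.disj_AB.symm, L.disj_AC.symm, e ▸ L.disj_X, e ▸ L.cover, L.card_B, L.card_C,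
    L.card_A, L.miss_B, L.miss_C, L.miss_A, L.same_B, L.same_C, L.same_A, L.same_X,
    fun v hv => ⟨(L.cross_X v hv).2.1, (L.cross_X v hv).2.2, (L.cross_X v hv).1⟩,
    fun v hv => by linarith [L.inner_X v hv]⟩

lemma swap (h : IsTriple E) (L : Labelling t E A B C X) : Labelling t E A C B X :=
  have e : A ∪ C ∪ B = A ∪ B ∪ C := by
    rw [Finset.union_assoc, Finset.union_comm C, Finset.union_assoc]
  ⟨L.disj_AC, L.disj_AB, L.disj_BC.symm, e ▸ L.disj_X, e ▸ L.cover, L.card_A, L.card_C,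
    L.card_B, fun v hv => by rw [cnt_swap' h, mul_comm]; exact L.miss_A v hv,
    fun v hv => by rw [cnt_swap' h, mul_comm]; exact L.miss_C v hv,
    fun v hv => by rw [cnt_swap' h, mul_comm]; exact L.miss_B v hv,
    L.same_A, L.same_C, L.same_B, L.same_X,
    fun v hv => by
      rw [cnt_swap' h (B := C), cnt_swap' h (B := B) (C := A), cnt_swap' h (B := A) (C := C)]
      exact ⟨(L.cross_X v hv).1, (L.cross_X v hv).2.2, (L.cross_X v hv).2.1⟩,
    fun v hv => by linarith [L.inner_X v hv]⟩

end Labelling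

lemma cnt_pair_le' (x y : V) (R S : Finset V) :
    cnt E {x} R S + cnt E {y} R S ≤
      #R * #S + #((R ×ˢ S).filter fun p => E x p.1 p.2 ∧ E y p.1 p.2) := by
  rw [cnt_singleton₁, cnt_singleton₁, ← Finset.sum_product', ← Finset.sum_product',
    ← Finset.sum_add_distrib, ← Nat.cast_mul, ← Finset.card_product, Finset.card_filter]
  push_cast
  rw [Finset.card_eq_sum_ones, Nat.cast_sum, ← Finset.sum_add_distrib]
  refine Finset.sum_le_sum fun p _ => ?_
  unfold ind
  split_ifs <;> first | (exfalso; tauto) | norm_num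

lemma card_common_le (x y : V) {ι : Type*} (s : Finset ι) (R : ι → Finset V)
    (hR : (s : Set ι).PairwiseDisjoint R) (S : ι → Finset V) :
    ∑ i ∈ s, #((R i ×ˢ S i).filter fun p => E x p.1 p.2 ∧ E y p.1 p.2) ≤
      #{p : V × V | E x p.1 p.2 ∧ E y p.1 p.2} := by
  rw [← Finset.card_biUnion]
  · refine Finset.card_le_card fun p hp => ?_
    obtain ⟨i, -, hi⟩ := Finset.mem_biUnion.1 hp
    exact Finset.mem_filter.2 ⟨Finset.mem_univ _, (Finset.mem_filter.1 hi).2⟩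
  · intro i hi j hj hij
    change Disjoint _ _
    rw [Finset.disjoint_left]
    intro p hp hq
    exact Finset.disjoint_left.1 (hR hi hj hij)
      (Finset.mem_product.1 (Finset.mem_filter.1 hp).1).1
      (Finset.mem_product.1 (Finset.mem_filter.1 hq).1).1

lemma cnt_le_cnt_add_sdiff (E : V → V → V → Prop) (v : V) (B B' C C' : Finset V) :
    cnt E {v} B C ≤ cnt E {v} B' C' + #(B \ B') * #C + #B * #(C \ C') := by
  have h1 : cnt E {v} B C = cnt E {v} (B ∩ B') C + cnt E {v} (B \ B') C := by
    rw [← cnt_union₂ (Finset.disjoint_sdiff_inter B B').symm, Finset.union_comm,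
      Finset.sdiff_union_inter]
  have h2 : cnt E {v} (B ∩ B') C =
      cnt E {v} (B ∩ B') (C ∩ C') + cnt E {v} (B ∩ B') (C \ C') := by
    rw [← cnt_union₃ (Finset.disjoint_sdiff_inter C C').symm, Finset.union_comm,
      Finset.sdiff_union_inter]
  have h3 := cnt_le_card E {v} (B \ B') C
  have h4 := cnt_le_card E {v} (B ∩ B') (C \ C')
  have h5 : cnt E {v} (B ∩ B') (C ∩ C') ≤ cnt E {v} B' C' :=
    cnt_mono subset_rfl Finset.inter_subset_right Finset.inter_subset_right
  have h6 : (#(B ∩ B') : ℝ) * #(C \ C') ≤ #B * #(C \ C') :=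
    mul_le_mul_of_nonneg_right
      (Nat.cast_le.2 (Finset.card_le_card Finset.inter_subset_left)) (Nat.cast_nonneg _)
  simp only [card_singleton, Nat.cast_one, one_mul] at h3 h4
  linarith

/-- The vertices whose link has many edges between `B` and `C`. -/
noncomputable def linked (E : V → V → V → Prop) (B C : Finset V) : Finset V :=
  univ.filter fun v => 0.001 * (Fintype.card V : ℝ) ^ 2 < cnt E {v} B C

lemma mem_linked {B C : Finset V} {v : V} :
    v ∈ linked E B C ↔ 0.001 * (Fintype.card V : ℝ) ^ 2 < cnt E {v} B C := by
  simp [linked]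

variable {t : ℕ} {A B C : Finset V}

lemma Tripartition.card_sdiff_linked (P : Tripartition t E A B C)
    (hm0 : 0 < (Fintype.card V : ℝ)) :
    (#(A \ linked E B C) : ℝ) ≤ 0.0000000000000001 * Fintype.card V := by
  obtain ⟨-, -, -, -, -, -, hcov, hmiss, cA, cB, cC⟩ := P
  set N := A \ linked E B C with hN
  obtain ⟨m, hmdef⟩ : ∃ m : ℝ, m = (Fintype.card V : ℝ) := ⟨_, rfl⟩
  have hmem : ∀ a ∈ N, cnt E {a} B C ≤ 0.001 * m ^ 2 := by
    intro a ha
    have := (Finset.mem_sdiff.1 ha).2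
    rw [mem_linked, ← hmdef] at this
    linarith
  rw [← hmdef] at hm0 hcov hmiss cA cB cC ⊢
  rw [abs_le] at cA cB cC
  have h1 : ∑ a ∈ N, (0.1 * m ^ 2) ≤ ∑ a ∈ A, ((#B : ℝ) * #C - cnt E {a} B C) := by
    refine (Finset.sum_le_sum fun a ha => ?_).trans
      (Finset.sum_le_sum_of_subset_of_nonneg Finset.sdiff_subset fun a _ _ => ?_)
    · have h2 : 0.33 * m * (0.33 * m) ≤ (#B : ℝ) * #C :=
        mul_le_mul (by linarith) (by linarith) (by positivity) (Nat.cast_nonneg _)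
      have := hmem a ha
      have : 0 < m ^ 2 := by positivity
      linarith
    · have := cnt_le_card E {a} B C
      simp only [card_singleton, Nat.cast_one, one_mul] at this
      linarith
  rw [Finset.sum_sub_distrib, ← cnt_eq_sum_left, Finset.sum_const, Finset.sum_const,
    nsmul_eq_mul, nsmul_eq_mul] at h1
  have h2 : (#N : ℝ) * (0.1 * m ^ 2) ≤ 0.00000000000000001 * m * (0.1 * m ^ 2) := by linarith
  have := le_of_mul_le_mul_right h2 (by positivity)
  linarith

lemma Tripartition.disjoint_linked (h : IsTriple E) (hF : Free t E)
    (hm : (t + 2 : ℝ) ≤ 0.00000000000000000001 * Fintype.card V) (P : Tripartition t E A B C) :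
    Disjoint (linked E B C) (linked E C A) := by
  rw [Finset.disjoint_left]
  intro v h1 h2
  rw [mem_linked] at h1 h2
  have h3 := P.cnt_part_univ_le h hF hm h1
  have h4 : cnt E {v} C A ≤ cnt E {v} A univ := by
    rw [cnt_swap' h]; exact cnt_mono subset_rfl subset_rfl (Finset.subset_univ _)
  have : (0 : ℝ) ≤ (Fintype.card V : ℝ) ^ 2 := by positivity
  linarith

lemma codeg_lt_of_overlap (h : IsTriple E) (hF : Free t E)
    (hm : (t + 2 : ℝ) ≤ 0.00000000000000000001 * Fintype.card V) {x y : V} (hxy : x ≠ y)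
    {ι : Type*} (s : Finset ι) (R : ι → Finset V)
    (hR : (s : Set ι).PairwiseDisjoint R) (S : ι → Finset V)
    (ho : ∑ i ∈ s, (#(R i) * #(S i) : ℝ) + 0.01 * (Fintype.card V : ℝ) ^ 2 ≤
      ∑ i ∈ s, (cnt E {x} (R i) (S i) + cnt E {y} (R i) (S i))) : codeg E x y < t := by
  refine hF.codeg_lt h hxy ?_
  have h1 := Finset.sum_le_sum fun i (_ : i ∈ s) => cnt_pair_le' (E := E) x y (R i) (S i)
  have h2 := card_common_le (E := E) x y s R hR S
  rw [Finset.sum_add_distrib (f := fun i => (#(R i) * #(S i) : ℝ))] at h1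
  have h3 : ∑ i ∈ s, (#((R i ×ˢ S i).filter fun p => E x p.1 p.2 ∧ E y p.1 p.2) : ℝ) ≤
    #{p : V × V | E x p.1 p.2 ∧ E y p.1 p.2} := by exact_mod_cast h2
  have h0 : (0 : ℝ) ≤ t := Nat.cast_nonneg _
  have hm0 : (0 : ℝ) < Fintype.card V := by linarith
  have h4 : (t + 2 : ℝ) * Fintype.card V ≤ 0.00000000000000000001 * Fintype.card V * Fintype.card V :=
    mul_le_mul_of_nonneg_right hm hm0.le
  have : (2 * t * Fintype.card V : ℝ) < #{p : V × V | E x p.1 p.2 ∧ E y p.1 p.2} := by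
    have hm2 : 0 < (Fintype.card V : ℝ) * Fintype.card V := by positivity
    linarith
  exact_mod_cast this

lemma linked_miss (h : IsTriple E) (hF : Free t E)
    (hm : (t + 2 : ℝ) ≤ 0.00000000000000000001 * Fintype.card V) (P : Tripartition t E A B C)
    (hdeg : ∀ v, (2 / 9 - 0.00000000000000000001) * (Fintype.card V : ℝ) ^ 2 ≤ deg E v) {B' C' : Finset V}
    (hB : (#(B \ B') : ℝ) ≤ 0.0000000000000001 * Fintype.card V) (hC : (#(C \ C') : ℝ) ≤ 0.0000000000000001 * Fintype.card V)
    (hB' : (#B' : ℝ) ≤ (1 / 3 + 0.000001) * Fintype.card V)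
    (hC' : (#C' : ℝ) ≤ (1 / 3 + 0.000001) * Fintype.card V) {v : V} (hv : v ∈ linked E B C) :
    (#B' : ℝ) * #C' - 0.00001 * (Fintype.card V : ℝ) ^ 2 ≤ cnt E {v} B' C' := by
  have h1 := P.dichotomy h hF hm (hdeg v) (mem_linked.1 hv)
  have h2 := cnt_le_cnt_add_sdiff E v B B' C C'
  have h0 : (0 : ℝ) ≤ t := Nat.cast_nonneg _
  have hm0 : (0 : ℝ) < Fintype.card V := by linarith
  have hle : ∀ S : Finset V, (#S : ℝ) ≤ Fintype.card V := fun S => by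
    exact_mod_cast Finset.card_le_univ S
  have h3 := mul_le_mul hB' hC' (Nat.cast_nonneg _) (by positivity)
  have h4 := mul_le_mul hB (hle C) (Nat.cast_nonneg _) (by positivity)
  have h5 := mul_le_mul (hle B) hC (Nat.cast_nonneg _) (by positivity)
  have : (0 : ℝ) ≤ (Fintype.card V : ℝ) ^ 2 := by positivity
  nlinarith

lemma card_sdiff_union₃ (hAB : Disjoint A B) (hAC : Disjoint A C) (hBC : Disjoint B C) :
    (#(univ \ (A ∪ B ∪ C)) : ℝ) = Fintype.card V - (#A + #B + #C) := by
  rw [Finset.card_sdiff_of_subset (Finset.subset_univ _),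
    Nat.cast_sub (Finset.card_le_card (Finset.subset_univ _)),
    Finset.card_union_of_disjoint (Finset.disjoint_union_left.2 ⟨hAC, hBC⟩),
    Finset.card_union_of_disjoint hAB, card_univ]
  push_cast
  ring

lemma Tripartition.card_linked_sdiff (h : IsTriple E) (hF : Free t E)
    (hm : (t + 2 : ℝ) ≤ 0.00000000000000000001 * Fintype.card V) (P : Tripartition t E A B C) :
    (#(linked E B C \ A) : ℝ) ≤ 0.0000000000000003 * Fintype.card V := by
  have h0 : (0 : ℝ) ≤ t := Nat.cast_nonneg _
  have hm0 : (0 : ℝ) < Fintype.card V := by linarith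
  have hB := (P.rot h).card_sdiff_linked hm0
  have hC := ((P.rot h).rot h).card_sdiff_linked hm0
  have d1 := P.disjoint_linked h hF hm
  have d2 := ((P.rot h).rot h).disjoint_linked h hF hm
  have hsub : linked E B C \ A ⊆
      (B \ linked E C A ∪ C \ linked E A B) ∪ (univ \ (A ∪ B ∪ C)) := by
    intro v hv
    obtain ⟨h1, h2⟩ := Finset.mem_sdiff.1 hv
    have h3 := Finset.disjoint_left.1 d1 h1
    have h4 := Finset.disjoint_right.1 d2 h1
    simp only [mem_union, Finset.mem_sdiff, Finset.mem_univ, true_and]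
    tauto
  have h5 : (#(univ \ (A ∪ B ∪ C)) : ℝ) ≤ 0.000000000000000001 * Fintype.card V := by
    rw [card_sdiff_union₃ P.disj_AB P.disj_AC P.disj_BC]
    linarith [P.cover]
  have h6 : (#(linked E B C \ A) : ℝ) ≤
      #(B \ linked E C A) + #(C \ linked E A B) + #(univ \ (A ∪ B ∪ C)) := by
    exact_mod_cast (Finset.card_le_card hsub).trans
      ((Finset.card_union_le _ _).trans (Nat.add_le_add_right (Finset.card_union_le _ _) _))
  linarith

lemma card_le_card_add_sdiff (A B : Finset V) : (#A : ℝ) ≤ #B + #(A \ B) := by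
  have := Finset.card_le_card_sdiff_add_card (s := A) (t := B)
  have h2 : (#A : ℝ) ≤ #(A \ B) + #B := by exact_mod_cast this
  linarith

lemma Tripartition.card_linked (h : IsTriple E) (hF : Free t E)
    (hm : (t + 2 : ℝ) ≤ 0.00000000000000000001 * Fintype.card V) (P : Tripartition t E A B C) :
    |(#(linked E B C) : ℝ) - Fintype.card V / 3| ≤ 0.0000001 * Fintype.card V := by
  have h0 : (0 : ℝ) ≤ t := Nat.cast_nonneg _
  have hm0 : (0 : ℝ) < Fintype.card V := by linarith
  have h1 := P.card_sdiff_linked hm0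
  have h2 := P.card_linked_sdiff h hF hm
  have h3 := card_le_card_add_sdiff A (linked E B C)
  have h4 := card_le_card_add_sdiff (linked E B C) A
  have h5 := P.card_A
  rw [abs_le] at h5 ⊢
  constructor <;> linarith

lemma Tripartition.codeg_linked (h : IsTriple E) (hF : Free t E)
    (hm : (t + 2 : ℝ) ≤ 0.00000000000000000001 * Fintype.card V) (P : Tripartition t E A B C)
    (hdeg : ∀ v, (2 / 9 - 0.00000000000000000001) * (Fintype.card V : ℝ) ^ 2 ≤ deg E v) {x y : V}
    (hx : x ∈ linked E B C) (hy : y ∈ linked E B C) (hxy : x ≠ y) : codeg E x y < t := by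
  have h1 := P.dichotomy h hF hm (hdeg x) (mem_linked.1 hx)
  have h2 := P.dichotomy h hF hm (hdeg y) (mem_linked.1 hy)
  refine codeg_lt_of_overlap h hF hm hxy {()} (fun _ => B) (by simp) (fun _ => C) ?_
  simp only [Finset.sum_singleton]
  have h0 : (0 : ℝ) ≤ t := Nat.cast_nonneg _
  have hm0 : (0 : ℝ) < Fintype.card V := by linarith
  have cB := P.card_B
  have cC := P.card_C
  rw [abs_le] at cB cC
  have h3 : (#B : ℝ) * #C ≤ (1 / 3 + 0.00000001) * Fintype.card V * ((1 / 3 + 0.00000001) * Fintype.card V) :=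
    mul_le_mul (by linarith) (by linarith) (Nat.cast_nonneg _) (by positivity)
  have : (0 : ℝ) < (Fintype.card V : ℝ) ^ 2 := by positivity
  linarith

lemma cross_le {B C B' C' : Finset V} {v : V} (hv : v ∉ linked E B C)
    (hB : (#(B' \ B) : ℝ) ≤ 0.0000000000000003 * Fintype.card V)
    (hC : (#(C' \ C) : ℝ) ≤ 0.0000000000000003 * Fintype.card V) :
    cnt E {v} B' C' ≤ 0.0011 * (Fintype.card V : ℝ) ^ 2 := by
  rw [mem_linked, not_lt] at hv
  have hle : ∀ S : Finset V, (#S : ℝ) ≤ Fintype.card V := fun S => by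
    exact_mod_cast Finset.card_le_univ S
  have h2 := cnt_le_cnt_add_sdiff E v B' B C' C
  have h4 := mul_le_mul hB (hle C') (Nat.cast_nonneg _) (by positivity)
  have h5 := mul_le_mul (hle B') hC (Nat.cast_nonneg _) (by positivity)
  have : (0 : ℝ) ≤ (Fintype.card V : ℝ) ^ 2 := by positivity
  linarith

/-- An upper bound on the degree of `v` by its link counts inside and across three parts. -/
lemma deg_le_of_cover (h : IsTriple E) {A B C X : Finset V} (hAB : Disjoint A B)
    (hAC : Disjoint A C) (hBC : Disjoint B C) (hX : Disjoint (A ∪ B ∪ C) X)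
    (hU : A ∪ B ∪ C ∪ X = univ) (v : V) :
    deg E v ≤ cnt E {v} A A + cnt E {v} B B + cnt E {v} C C +
      2 * (cnt E {v} A B + cnt E {v} A C + cnt E {v} B C) + 2 * #X * Fintype.card V := by
  have h1 := cnt_sq_union h hX (R := {v})
  rw [hU, cnt_sq_union₃ h hAB hAC hBC] at h1
  have h2 := cnt_le_card E {v} univ X
  have h3 : cnt E {v} univ X = cnt E {v} (A ∪ B ∪ C) X + cnt E {v} X X := by
    rw [← hU, cnt_union₂ hX]
  simp only [card_singleton, Nat.cast_one, one_mul, card_univ] at h2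
  rw [deg]
  nlinarith [cnt_nonneg E {v} X X]

set_option maxHeartbeats 1000000 in
theorem exists_labelling (h : IsTriple E) (hF : Free t E)
    (hm : (t + 2 : ℝ) ≤ 0.00000000000000000001 * Fintype.card V)
    (hdeg : ∀ v, (2 / 9 - 0.00000000000000000001) * (Fintype.card V : ℝ) ^ 2 ≤ deg E v)
    (P : Tripartition t E A B C) :
    Labelling t E (linked E B C) (linked E C A) (linked E A B)
      (univ \ (linked E B C ∪ linked E C A ∪ linked E A B)) := by
  have h0 : (0 : ℝ) ≤ t := Nat.cast_nonneg _
  have hm0 : (0 : ℝ) < Fintype.card V := by linarith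
  have hm2 : (0 : ℝ) < (Fintype.card V : ℝ) ^ 2 := by positivity
  have PB := P.rot h
  have PC := PB.rot h
  have sA := P.card_sdiff_linked hm0
  have sB := PB.card_sdiff_linked hm0
  have sC := PC.card_sdiff_linked hm0
  have tA := P.card_linked_sdiff h hF hm
  have tB := PB.card_linked_sdiff h hF hm
  have tC := PC.card_linked_sdiff h hF hm
  have kA := P.card_linked h hF hm
  have kB := PB.card_linked h hF hm
  have kC := PC.card_linked h hF hm
  have dAB := P.disjoint_linked h hF hm
  have dBC := PB.disjoint_linked h hF hm
  have dCA := PC.disjoint_linked h hF hm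
  have uA := (abs_le.1 kA).2
  have uB := (abs_le.1 kB).2
  have uC := (abs_le.1 kC).2
  have hcross : ∀ v ∈ univ \ (linked E B C ∪ linked E C A ∪ linked E A B),
      cnt E {v} (linked E C A) (linked E A B) ≤ 0.0011 * (Fintype.card V : ℝ) ^ 2 ∧
      cnt E {v} (linked E A B) (linked E B C) ≤ 0.0011 * (Fintype.card V : ℝ) ^ 2 ∧
      cnt E {v} (linked E B C) (linked E C A) ≤ 0.0011 * (Fintype.card V : ℝ) ^ 2 := by
    intro v hv
    have hv' := (Finset.mem_sdiff.1 hv).2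
    simp only [mem_union, not_or] at hv'
    exact ⟨cross_le hv'.1.1 tB tC, cross_le hv'.1.2 tC tA, cross_le hv'.2 tA tB⟩
  have dX := Finset.disjoint_sdiff (s := linked E B C ∪ linked E C A ∪ linked E A B)
    (t := univ)
  have cov := Finset.union_sdiff_of_subset
    (Finset.subset_univ (linked E B C ∪ linked E C A ∪ linked E A B))
  set LA := linked E B C with hLA
  set LB := linked E C A with hLB
  set LC := linked E A B with hLC
  set X := univ \ (LA ∪ LB ∪ LC) with hX
  have hXc : (#X : ℝ) ≤ 0.000000000000001 * Fintype.card V := by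
    have hsub : X ⊆ (A \ LA ∪ B \ LB ∪ C \ LC) ∪ (univ \ (A ∪ B ∪ C)) := by
      intro v hv
      have := (Finset.mem_sdiff.1 hv).2
      simp only [mem_union, Finset.mem_sdiff, Finset.mem_univ, true_and] at this ⊢
      tauto
    have h5 : (#(univ \ (A ∪ B ∪ C)) : ℝ) ≤ 0.000000000000000001 * Fintype.card V := by
      rw [card_sdiff_union₃ P.disj_AB P.disj_AC P.disj_BC]
      linarith [P.cover]
    have h6 : (#X : ℝ) ≤ #(A \ LA) + #(B \ LB) + #(C \ LC) + #(univ \ (A ∪ B ∪ C)) := by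
      exact_mod_cast (Finset.card_le_card hsub).trans ((Finset.card_union_le _ _).trans
        (Nat.add_le_add_right ((Finset.card_union_le _ _).trans
          (Nat.add_le_add_right (Finset.card_union_le _ _) _)) _))
    linarith
  have hinner : ∀ v ∈ X, 0.213 * (Fintype.card V : ℝ) ^ 2 ≤
      cnt E {v} LA LA + cnt E {v} LB LB + cnt E {v} LC LC := by
    intro v hv
    obtain ⟨h1, h2, h3⟩ := hcross v hv
    have h4 := deg_le_of_cover h dAB dCA.symm dBC dX cov v
    rw [cnt_swap' h (B := LA) (C := LC)] at h4
    have h5 := hdeg v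
    have h6 := mul_le_mul_of_nonneg_right hXc hm0.le
    linarith
  refine ⟨dAB, dCA.symm, dBC, dX, cov, by linarith, by linarith, by linarith,
    fun v hv => linked_miss h hF hm P hdeg (by linarith) (by linarith) (by linarith)
      (by linarith) hv,
    fun v hv => linked_miss h hF hm PB hdeg (by linarith) (by linarith) (by linarith)
      (by linarith) hv,
    fun v hv => linked_miss h hF hm PC hdeg (by linarith) (by linarith) (by linarith)
      (by linarith) hv,
    fun x hx y hy hxy => P.codeg_linked h hF hm hdeg hx hy hxy,
    fun x hx y hy hxy => PB.codeg_linked h hF hm hdeg hx hy hxy,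
    fun x hx y hy hxy => PC.codeg_linked h hF hm hdeg hx hy hxy, ?_, hcross,
    fun v hv => by linarith [hinner v hv]⟩
  intro x hx y hy hxy
  have hx' := hinner x hx
  have hy' := hinner y hy
  refine codeg_lt_of_overlap h hF hm hxy (univ : Finset (Fin 3)) ![LA, LB, LC] ?_
    ![LA, LB, LC] ?_
  · intro i _ j _ hij
    change Disjoint _ _
    fin_cases i <;> fin_cases j <;>
      first
        | exact absurd rfl hij
        | exact dAB
        | exact dAB.symm
        | exact dBC
        | exact dBC.symm
        | exact dCA
        | exact dCA.symm
  · have sq : ∀ S : Finset V, (#S : ℝ) ≤ (1 / 3 + 0.0000001) * Fintype.card V →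
        (#S : ℝ) * #S ≤ 0.112 * (Fintype.card V : ℝ) ^ 2 := by
      intro S hS
      have := mul_le_mul hS hS (Nat.cast_nonneg _) (by positivity)
      linarith
    have qA := sq LA (by linarith)
    have qB := sq LB (by linarith)
    have qC := sq LC (by linarith)
    simp only [Fin.sum_univ_three, Matrix.cons_val_zero, Matrix.cons_val_one, Matrix.cons_val]
    linarith

end Labellings

section Exceptional

variable {V : Type*} {E : V → V → V → Prop} [Fintype V]

lemma cnt_link_le_of_light (h : IsTriple E) (v : V) {B C N : Finset V} (hN : N ⊆ C) {l : ℝ}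
    (hl : ∀ c ∈ N, cnt E {v} {c} B ≤ l) :
    cnt E {v} B C ≤ #N * l + (#C - #N) * #B := by
  have h1 : cnt E {v} B C = ∑ c ∈ C, cnt E {v} {c} B := by
    rw [cnt_swap' h]; simp [cnt]
  have h2 : (#(C \ N) : ℝ) = #C - #N := by
    rw [Finset.card_sdiff_of_subset hN, Nat.cast_sub (Finset.card_le_card hN)]
  rw [h1, ← Finset.sum_sdiff hN, add_comm, ← h2]
  refine add_le_add ((Finset.sum_le_sum hl).trans (by simp)) ?_
  calc ∑ c ∈ C \ N, cnt E {v} {c} B ≤ ∑ c ∈ C \ N, (#B : ℝ) := by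
        refine Finset.sum_le_sum fun c _ => ?_
        have := cnt_le_card E {v} {c} B
        simpa using this
    _ = _ := by simp

lemma cnt_link_self_le_card (h : IsTriple E) (v : V) (C : Finset V) :
    cnt E {v} C C ≤ #C * (#C - 1) := by
  have h1 : cnt E {v} C C = ∑ c ∈ C, cnt E {v} {c} C := by simp [cnt]
  rw [h1]
  calc ∑ c ∈ C, cnt E {v} {c} C ≤ ∑ c ∈ C, ((#C : ℝ) - 1) := by
        refine Finset.sum_le_sum fun c hc => ?_
        rw [cnt_singleton₂, ← Nat.cast_one, ← Nat.cast_sub (Finset.card_pos.2 ⟨c, hc⟩),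
          ← Finset.card_erase_of_mem hc]
        refine Nat.cast_le.2 (Finset.card_le_card fun z hz => ?_)
        obtain ⟨hz1, hz2⟩ := Finset.mem_filter.1 hz
        exact Finset.mem_erase.2 ⟨fun e => h.ne' hz2 e.symm, hz1⟩
    _ = _ := by simp; ring

namespace Labelling

variable {t : ℕ} {A B C X : Finset V}

/-- Two vertices of `A` in a common edge with `y ∈ B` each have few common neighbours with `y`
in `C`. -/
lemma light_of_edge (h : IsTriple E) (hF : Free t E)
    (hm : (t + 2 : ℝ) ≤ 0.00000000000000000001 * Fintype.card V) (L : Labelling t E A B C X) {x x' y : V}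
    (hx' : x' ∈ A) (hE : E x y x') :
    cnt E {x} {y} C ≤ (Fintype.card V : ℝ) / 7 := by
  by_contra hcon
  push Not at hcon
  have h0 : (0 : ℝ) ≤ t := Nat.cast_nonneg _
  have hm0 : (0 : ℝ) < Fintype.card V := by linarith
  rw [cnt_singleton₂] at hcon
  have h1 := cnt_link_le_of_light h x' (B := B) (C := C) (N := C.filter fun z => E x y z)
    (Finset.filter_subset _ _) (l := t + 1) (by
      intro c hc
      obtain ⟨hc1, hc2⟩ := Finset.mem_filter.1 hc
      refine (cnt_le_codeg _ _ _ _).trans ?_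
      have hne : x' ≠ c := fun e => Finset.disjoint_left.1 L.disj_AC hx' (e ▸ hc1)
      exact_mod_cast hF.codeg_le hne hE hc2)
  have h2 := L.miss_A x' hx'
  have cB := (abs_le.1 L.card_B).1
  have h3 := mul_le_mul hcon.le (show 0.33 * (Fintype.card V : ℝ) ≤ #B - (t + 1) by linarith)
    (by positivity) (Nat.cast_nonneg _)
  have : (0 : ℝ) < (Fintype.card V : ℝ) ^ 2 := by positivity
  linarith

lemma two_one_le (h : IsTriple E) (hF : Free t E)
    (hm : (t + 2 : ℝ) ≤ 0.00000000000000000001 * Fintype.card V) (L : Labelling t E A B C X) :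
    6 * cnt E A A B ≤ #A * #B * #C - cnt E A B C := by
  have h0 : (0 : ℝ) ≤ t := Nat.cast_nonneg _
  have hm0 : (0 : ℝ) < Fintype.card V := by linarith
  have e1 : cnt E A A B = ∑ y ∈ B, cnt E {y} A A := by
    rw [← cnt_rot h, ← cnt_eq_sum_left]
  have e2 : (#A : ℝ) * #B * #C - cnt E A B C = ∑ y ∈ B, (#C * #A - cnt E {y} C A) := by
    rw [Finset.sum_sub_distrib, ← cnt_eq_sum_left, cnt_rot h (A := A) (B := B) (C := C)]
    simp; ring
  rw [e1, e2, Finset.mul_sum]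
  refine Finset.sum_le_sum fun y hy => ?_
  set N := A.filter fun x => cnt E {x} {y} C ≤ (Fintype.card V : ℝ) / 7 with hN
  have h1 : cnt E {y} A A ≤ #N * #N := by
    have hle : cnt E {y} A A ≤ cnt E {y} N N := by
      rw [cnt_singleton₁, cnt_singleton₁]
      rw [Finset.sum_filter]
      refine Finset.sum_le_sum fun x hx => ?_
      by_cases hxN : cnt E {x} {y} C ≤ (Fintype.card V : ℝ) / 7
      · rw [if_pos hxN, Finset.sum_filter]
        refine Finset.sum_le_sum fun x' hx' => ?_
        by_cases hxN' : cnt E {x'} {y} C ≤ (Fintype.card V : ℝ) / 7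
        · rw [if_pos hxN']
        · rw [if_neg hxN', ind, if_neg]
          exact fun hE => hxN' (L.light_of_edge h hF hm hx (h.rot (h.rot hE)))
      · rw [if_neg hxN]
        refine (Finset.sum_eq_zero fun x' hx' => ?_).le
        rw [ind, if_neg]
        exact fun hE => hxN (L.light_of_edge h hF hm hx' (h.swap hE))
    refine hle.trans ((cnt_le_card _ _ _ _).trans ?_)
    simp
  have h2 := cnt_link_le_of_light h y (B := C) (C := A) (N := N)
    (Finset.filter_subset _ _) (l := (Fintype.card V : ℝ) / 7) (by
      intro x hx
      rw [cnt_swap h]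
      exact (Finset.mem_filter.1 hx).2)
  have h3 := L.miss_B y hy
  have cC := (abs_le.1 L.card_C).1
  have h4 : (#N : ℝ) * (0.19 * Fintype.card V) ≤ #C * #A - cnt E {y} C A := by
    have := mul_le_mul_of_nonneg_left
      (show 0.19 * (Fintype.card V : ℝ) ≤ #C - Fintype.card V / 7 by linarith)
      (Nat.cast_nonneg (α := ℝ) #N)
    linarith
  have h5 : (#N : ℝ) ≤ 0.0001 * Fintype.card V := by
    have : (#N : ℝ) * (0.19 * Fintype.card V) ≤
        0.0001 * Fintype.card V * (0.19 * Fintype.card V) := by nlinarith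
    exact le_of_mul_le_mul_right this (by positivity)
  have h6 := mul_le_mul_of_nonneg_left h5 (Nat.cast_nonneg (α := ℝ) #N)
  have h7 : 0 ≤ (#N : ℝ) * Fintype.card V := by positivity
  linarith

lemma cross_or_inner (h : IsTriple E) (hF : Free t E)
    (hm : (t + 2 : ℝ) ≤ 0.00000000000000000001 * Fintype.card V) (L : Labelling t E A B C X) {v : V}
    (hv : v ∈ X) :
    0.19 * Fintype.card V * cnt E {v} A B ≤ #A * #B * #C - cnt E A B C ∨
    cnt E {v} C C ≤ #C * (#C - 1) - 0.04 * (Fintype.card V : ℝ) ^ 2 := by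
  have h0 : (0 : ℝ) ≤ t := Nat.cast_nonneg _
  have hm0 : (0 : ℝ) < Fintype.card V := by linarith
  have hm2 : (0 : ℝ) < (Fintype.card V : ℝ) ^ 2 := by positivity
  have cC := abs_le.1 L.card_C
  by_cases hg : ∃ x ∈ A, ∃ y ∈ B, E v x y ∧ (Fintype.card V : ℝ) / 7 < cnt E {x} {y} C
  · right
    obtain ⟨x, hx, y, hy, hE, hg⟩ := hg
    rw [cnt_singleton₂] at hg
    have h1 := cnt_link_le_of_light h v (B := C) (C := C) (N := C.filter fun z => E x y z)
      (Finset.filter_subset _ _) (l := t + 1) (by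
        intro c hc
        obtain ⟨hc1, hc2⟩ := Finset.mem_filter.1 hc
        refine (cnt_le_codeg _ _ _ _).trans ?_
        have hne : v ≠ c := fun e =>
          Finset.disjoint_right.1 L.disj_X hv (e ▸ Finset.mem_union_right _ hc1)
        exact_mod_cast hF.codeg_le hne (h.rot hE) hc2)
    have h3 := mul_le_mul hg.le (show 0.33 * (Fintype.card V : ℝ) ≤ #C - (t + 1) by linarith)
      (by positivity) (Nat.cast_nonneg _)
    have h4 : (#C : ℝ) ≤ 0.00000000000000000001 * (Fintype.card V : ℝ) ^ 2 := by
      have : (1 : ℝ) * Fintype.card V ≤ 0.00000000000000000001 * Fintype.card V * Fintype.card V :=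
        mul_le_mul_of_nonneg_right (by linarith) hm0.le
      linarith
    linarith
  · left
    push Not at hg
    set N := (A ×ˢ B).filter fun p => cnt E {p.1} {p.2} C ≤ (Fintype.card V : ℝ) / 7 with hN
    have h1 := card_light_pairs N (Finset.filter_subset _ _) fun p hp =>
      (Finset.mem_filter.1 hp).2
    have h2 : cnt E {v} A B ≤ #N := by
      rw [cnt_singleton₁, ← Finset.sum_product', hN, Finset.card_filter]
      push_cast
      refine Finset.sum_le_sum fun p hp => ?_
      obtain ⟨hp1, hp2⟩ := Finset.mem_product.1 hp
      unfold ind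
      split_ifs with ha hb
      · exact le_rfl
      · exact absurd (hg _ hp1 _ hp2 ha) hb
      · exact zero_le_one
      · exact le_rfl
    have h3 := mul_le_mul_of_nonneg_left
      (show 0.19 * (Fintype.card V : ℝ) ≤ #C - Fintype.card V / 7 by linarith)
      (Nat.cast_nonneg (α := ℝ) #N)
    have h4 := mul_le_mul_of_nonneg_left h2 (show 0 ≤ 0.19 * (Fintype.card V : ℝ) by positivity)
    linarith

lemma link_X_le (h : IsTriple E) (hF : Free t E)
    (hm : (t + 2 : ℝ) ≤ 0.00000000000000000001 * Fintype.card V) (L : Labelling t E A B C X) {v : V}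
    (hv : v ∈ X) :
    Fintype.card V * (2 * (cnt E {v} A A + cnt E {v} B B + cnt E {v} C C) +
      6 * (cnt E {v} A B + cnt E {v} A C + cnt E {v} B C)) ≤
    Fintype.card V * (2 * (#A * (#A - 1) + #B * (#B - 1) + #C * (#C - 1))) +
      100 * (#A * #B * #C - cnt E A B C) := by
  have h0 : (0 : ℝ) ≤ t := Nat.cast_nonneg _
  have hm0 : (0 : ℝ) < Fintype.card V := by linarith
  have hm2 : (0 : ℝ) < (Fintype.card V : ℝ) ^ 2 := by positivity
  have iA := cnt_link_self_le_card h v A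
  have iB := cnt_link_self_le_card h v B
  have iC := cnt_link_self_le_card h v C
  have hM : 0 ≤ #A * #B * #C - cnt E A B C := by linarith [cnt_le_card E A B C]
  obtain ⟨k1, k2, k3⟩ := L.cross_X v hv
  have c1 := L.cross_or_inner h hF hm hv
  have c2 := L.rot.cross_or_inner h hF hm hv
  have c3 := L.rot.rot.cross_or_inner h hF hm hv
  rw [← cnt_rot h (A := A) (B := B) (C := C)] at c2
  rw [cnt_rot h (A := C) (B := A) (C := B)] at c3
  rw [cnt_swap' h (B := C) (C := A)] at c3 k2
  set M := #A * #B * #C - cnt E A B C with hMdef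
  have key : ∀ J : ℝ, J ≤ 2 * (#A * (#A - 1) + #B * (#B - 1) + #C * (#C - 1)) →
      Fintype.card V * J ≤
        Fintype.card V * (2 * (#A * (#A - 1) + #B * (#B - 1) + #C * (#C - 1))) + 100 * M :=
    fun J hJ => by linarith [mul_le_mul_of_nonneg_left hJ hm0.le]
  rcases c1 with c1 | c1
  · rcases c2 with c2 | c2
    · rcases c3 with c3 | c3
      · have hJ := mul_le_mul_of_nonneg_left (add_le_add (add_le_add iA iB) iC) hm0.le
        linarith
      · exact key _ (by linarith)
    · exact key _ (by linarith)
  · exact key _ (by linarith)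

lemma inner_add_le (hA : ∀ x ∈ A, ∀ y ∈ A, x ≠ y → codeg E x y < t)
    (h : IsTriple E) : cnt E A A univ ≤ (t - 1) * (#A * (#A - 1)) := by
  rw [cnt_eq_sum_codeg]
  calc ∑ x ∈ A, ∑ y ∈ A, (codeg E x y : ℝ)
      ≤ ∑ x ∈ A, ∑ y ∈ A.erase x, ((t : ℝ) - 1) := by
        refine Finset.sum_le_sum fun x hx => ?_
        rw [← Finset.add_sum_erase _ _ hx, codeg_self h, Nat.cast_zero, zero_add]
        refine Finset.sum_le_sum fun y hy => ?_
        obtain ⟨h1, h2⟩ := Finset.mem_erase.1 hy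
        have := hA x hx y h2 h1.symm
        have h3 : (codeg E x y : ℝ) + 1 ≤ t := by exact_mod_cast this
        linarith
    _ = ∑ x ∈ A, ((#A : ℝ) - 1) * (t - 1) := by
        refine Finset.sum_congr rfl fun x hx => ?_
        rw [Finset.sum_const, nsmul_eq_mul, Finset.card_erase_of_mem hx,
          Nat.cast_sub (Finset.card_pos.2 ⟨x, hx⟩), Nat.cast_one]
    _ = _ := by rw [Finset.sum_const, nsmul_eq_mul]; ring

lemma cnt_univ_eq (h : IsTriple E) (L : Labelling t E A B C X) :
    cnt E univ univ univ = 6 * cnt E A B C + (cnt E A A A + cnt E B B B + cnt E C C C) +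
      3 * (cnt E A A B + cnt E A A C + cnt E B B A + cnt E B B C + cnt E C C A + cnt E C C B) +
      3 * (cnt E X A A + cnt E X B B + cnt E X C C) +
      6 * (cnt E X A B + cnt E X A C + cnt E X B C) +
      3 * cnt E (A ∪ B ∪ C) X X + cnt E X X X := by
  have h1 := cnt_cube_union h L.disj_X
  rw [L.cover, cnt_cube_union₃ h L.disj_AB L.disj_AC L.disj_BC,
    cnt_sq_union₃ h L.disj_AB L.disj_AC L.disj_BC] at h1
  rw [h1, cnt_rot h (A := A) (B := B) (C := B), cnt_rot h (A := A) (B := C) (C := C),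
    cnt_rot h (A := B) (B := A) (C := A), cnt_rot h (A := B) (B := C) (C := C),
    cnt_rot h (A := C) (B := A) (C := A), cnt_rot h (A := C) (B := B) (C := B)]
  ring

lemma cnt_sq_univ_eq (h : IsTriple E) (L : Labelling t E A B C X) :
    cnt E A A univ = cnt E A A A + cnt E A A B + cnt E A A C + cnt E X A A := by
  have h1 := cnt_union₃ (E := E) (A := A) (B := A) L.disj_X
  rw [L.cover, cnt_union₃ (Finset.disjoint_union_left.2 ⟨L.disj_AC, L.disj_BC⟩),
    cnt_union₃ L.disj_AB] at h1
  rw [h1, cnt_rot h (A := X)]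

lemma two_one_sum_le (h : IsTriple E) (hF : Free t E)
    (hm : (t + 2 : ℝ) ≤ 0.00000000000000000001 * Fintype.card V) (L : Labelling t E A B C X) :
    cnt E A A B + cnt E A A C + cnt E B B A + cnt E B B C + cnt E C C A + cnt E C C B ≤
      #A * #B * #C - cnt E A B C := by
  have h1 := L.two_one_le h hF hm
  have h2 := (L.swap h).two_one_le h hF hm
  have h3 := L.rot.two_one_le h hF hm
  have h4 := (L.rot.swap h).two_one_le h hF hm
  have h5 := L.rot.rot.two_one_le h hF hm
  have h6 := (L.rot.rot.swap h).two_one_le h hF hm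
  rw [cnt_swap' h (A := A) (B := C)] at h2
  rw [← cnt_rot h (A := A) (B := B) (C := C)] at h3
  rw [cnt_swap h (A := B) (B := A)] at h4
  rw [cnt_rot h (A := C) (B := A) (C := B)] at h5
  rw [cnt_swap' h (A := C) (B := B), cnt_rot h (A := C) (B := A) (C := B)] at h6
  linarith

/-- The number of exceptional vertices is bounded in terms of `t`. -/
lemma card_X_le (h : IsTriple E) (ht : 1 ≤ t)
    (hm : (t + 2 : ℝ) ≤ 0.00000000000000000001 * Fintype.card V) (L : Labelling t E A B C X) :
    (#X : ℝ) ≤ 2 * (t - 1) := by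
  have h0 : (1 : ℝ) ≤ t := by exact_mod_cast ht
  have hm0 : (0 : ℝ) < Fintype.card V := by linarith
  have hm2 : (0 : ℝ) < (Fintype.card V : ℝ) ^ 2 := by positivity
  have h1 : #X * (0.2 * (Fintype.card V : ℝ) ^ 2) ≤
      cnt E X A A + cnt E X B B + cnt E X C C := by
    rw [cnt_eq_sum_left E X A, cnt_eq_sum_left E X B, cnt_eq_sum_left E X C,
      ← Finset.sum_add_distrib, ← Finset.sum_add_distrib, ← nsmul_eq_mul, ← Finset.sum_const]
    exact Finset.sum_le_sum fun v hv => L.inner_X v hv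
  have iA := inner_add_le L.same_A h
  have iB := inner_add_le L.same_B h
  have iC := inner_add_le L.same_C h
  have tA : cnt E X A A ≤ cnt E A A univ := by
    rw [cnt_rot h]; exact cnt_mono subset_rfl subset_rfl (Finset.subset_univ _)
  have tB : cnt E X B B ≤ cnt E B B univ := by
    rw [cnt_rot h]; exact cnt_mono subset_rfl subset_rfl (Finset.subset_univ _)
  have tC : cnt E X C C ≤ cnt E C C univ := by
    rw [cnt_rot h]; exact cnt_mono subset_rfl subset_rfl (Finset.subset_univ _)
  have sq : ∀ S : Finset V, (#S : ℝ) ≤ (1 / 3 + 0.000001) * Fintype.card V →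
      (#S : ℝ) * (#S - 1) ≤ 0.112 * (Fintype.card V : ℝ) ^ 2 := by
    intro S hS
    have := mul_le_mul hS hS (Nat.cast_nonneg _) (by positivity)
    linarith [(Nat.cast_nonneg #S : (0 : ℝ) ≤ #S)]
  have qA := mul_le_mul_of_nonneg_left (sq A (by linarith [(abs_le.1 L.card_A).2]))
    (show (0 : ℝ) ≤ t - 1 by linarith)
  have qB := mul_le_mul_of_nonneg_left (sq B (by linarith [(abs_le.1 L.card_B).2]))
    (show (0 : ℝ) ≤ t - 1 by linarith)
  have qC := mul_le_mul_of_nonneg_left (sq C (by linarith [(abs_le.1 L.card_C).2]))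
    (show (0 : ℝ) ≤ t - 1 by linarith)
  have q0 : 0 ≤ (t - 1 : ℝ) * (Fintype.card V : ℝ) ^ 2 := mul_nonneg (by linarith) hm2.le
  have h2 : #X * (0.2 * (Fintype.card V : ℝ) ^ 2) ≤
      2 * (t - 1) * (0.2 * (Fintype.card V : ℝ) ^ 2) := by linarith
  exact le_of_mul_le_mul_right h2 (by positivity)

theorem cnt_le_of_X_empty (h : IsTriple E) (hF : Free t E)
    (hm : (t + 2 : ℝ) ≤ 0.00000000000000000001 * Fintype.card V) (L : Labelling t E A B C ∅) :
    cnt E univ univ univ ≤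
      6 * (#A * #B * #C) + 6 * (Dmax #A t + Dmax #B t + Dmax #C t : ℝ) := by
  have h1 := L.cnt_univ_eq h
  have h2 := L.two_one_sum_le h hF hm
  have h3 := cnt_le_Dmax h A fun x hx y hy hxy => Nat.le_sub_one_of_lt (L.same_A x hx y hy hxy)
  have h4 := cnt_le_Dmax h B fun x hx y hy hxy => Nat.le_sub_one_of_lt (L.same_B x hx y hy hxy)
  have h5 := cnt_le_Dmax h C fun x hx y hy hxy => Nat.le_sub_one_of_lt (L.same_C x hx y hy hxy)
  have hM := cnt_le_card E A B C
  have z : ∀ S T, cnt E ∅ S T = 0 := fun S T => by simp [cnt]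
  have z' : ∀ S T, cnt E S T ∅ = 0 := fun S T => by simp [cnt]
  simp only [z, z'] at h1
  linarith

theorem cnt_le_of_X (h : IsTriple E) (hF : Free t E) (ht : 1 ≤ t)
    (hm : (t + 2 : ℝ) ≤ 0.00000000000000000001 * Fintype.card V) (L : Labelling t E A B C X) :
    cnt E univ univ univ ≤ 6 * (#A * #B * #C) +
      (t - 1 + 2 * #X) * (#A * (#A - 1) + #B * (#B - 1) + #C * (#C - 1)) +
      3 * (t - 1) * #X ^ 2 := by
  have h0 : (1 : ℝ) ≤ t := by exact_mod_cast ht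
  have hm0 : (0 : ℝ) < Fintype.card V := by linarith
  have h1 := L.cnt_univ_eq h
  have h2 := L.two_one_sum_le h hF hm
  have eA := L.cnt_sq_univ_eq h
  have eB := L.rot.cnt_sq_univ_eq h
  have eC := L.rot.rot.cnt_sq_univ_eq h
  have iA := inner_add_le L.same_A h
  have iB := inner_add_le L.same_B h
  have iC := inner_add_le L.same_C h
  have iX := inner_add_le L.same_X h
  have eX : cnt E X X univ = cnt E (A ∪ B ∪ C) X X + cnt E X X X := by
    rw [← L.cover, cnt_union₃ L.disj_X, cnt_rot h (A := A ∪ B ∪ C)]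
  have nX := cnt_nonneg E X X X
  have hM : 0 ≤ #A * #B * #C - cnt E A B C := by linarith [cnt_le_card E A B C]
  have hs : (#X : ℝ) * 100 ≤ Fintype.card V := by linarith [L.card_X_le h ht hm]
  have h3 : Fintype.card V * (2 * (cnt E X A A + cnt E X B B + cnt E X C C) +
      6 * (cnt E X A B + cnt E X A C + cnt E X B C)) ≤
      Fintype.card V * (2 * (#A * (#A - 1) + #B * (#B - 1) + #C * (#C - 1)) * #X) +
        Fintype.card V * (#A * #B * #C - cnt E A B C) := by
    have h4 := Finset.sum_le_sum fun v (hv : v ∈ X) => L.link_X_le h hF hm hv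
    rw [Finset.sum_const, nsmul_eq_mul, ← Finset.mul_sum, Finset.sum_add_distrib,
      ← Finset.mul_sum, ← Finset.mul_sum, Finset.sum_add_distrib, Finset.sum_add_distrib,
      Finset.sum_add_distrib, Finset.sum_add_distrib, ← cnt_eq_sum_left, ← cnt_eq_sum_left,
      ← cnt_eq_sum_left, ← cnt_eq_sum_left, ← cnt_eq_sum_left, ← cnt_eq_sum_left] at h4
    have h5 := mul_le_mul_of_nonneg_right hs hM
    linarith
  rw [← mul_add] at h3
  have h6 := le_of_mul_le_mul_left h3 hm0
  have h7 : (0 : ℝ) ≤ (t - 1) * #X := mul_nonneg (by linarith) (Nat.cast_nonneg _)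
  linarith

end Labelling

end Exceptional

section BoseSystems

lemma fin3_facts : ∀ i l : Fin 3, i + 1 ≠ i ∧ i + 2 ≠ i ∧ i + 1 + 1 = i + 2 ∧ i + 2 + 1 = i ∧
    i + 2 ≠ i + 1 ∧ (l = i ∨ l = i + 1 ∨ l = i + 2) ∧ (i = l + 1 → l = i + 2) ∧
    (l = i + 1 → ¬ i = l + 1) := by decide

section Bose

variable {R : Type*} [CommRing R]

/-- The three shifts of a class; they add up to `0`. -/
def shift (i : Fin 3) (j : R) : R := if i = 2 then -2 * j else j

/-- The third point of the block through `p` and `q` in the shifted Bose triple system with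
parameter `j`; here `u` is the inverse of `2`. -/
noncomputable def bose (u j : R) (p q : R × Fin 3) : R × Fin 3 :=
  if p.2 = q.2 then (u * (p.1 + q.1) + shift p.2 j, p.2 + 1)
  else if q.2 = p.2 + 1 then
    if q.1 = p.1 + shift p.2 j then (q.1 + shift q.2 j, q.2 + 1)
    else (2 * (q.1 - shift p.2 j) - p.1, p.2)
  else if p.1 = q.1 + shift q.2 j then (p.1 + shift p.2 j, p.2 + 1)
    else (2 * (p.1 - shift q.2 j) - q.1, q.2)

/-- The pairs in the transversal blocks of the shifted Bose triple system. -/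
def transv (j : R) (p q : R × Fin 3) : Prop :=
  (q.2 = p.2 + 1 ∧ q.1 = p.1 + shift p.2 j) ∨ (p.2 = q.2 + 1 ∧ p.1 = q.1 + shift q.2 j)

lemma transv_comm {j : R} {p q : R × Fin 3} (h : transv j p q) : transv j q p := Or.symm h

lemma bose_comm (u j : R) (p q : R × Fin 3) : bose u j p q = bose u j q p := by
  obtain ⟨x, i⟩ := p
  obtain ⟨y, l⟩ := q
  fin_cases i <;> fin_cases l <;> simp [bose, add_comm]

lemma bose_ne {u : R} (hu : 2 * u = 1) (j : R) {p q : R × Fin 3} (h : p ≠ q) :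
    bose u j p q ≠ p := by
  obtain ⟨x, i⟩ := p
  obtain ⟨y, l⟩ := q
  have key : ∀ x y c : R, ¬ y = x + c → ¬ 2 * (y - c) - x = x := fun x y c h1 h2 =>
    h1 (by linear_combination u * h2 - (y - c - x) * hu)
  fin_cases i <;> fin_cases l <;> simp [bose] <;> split_ifs <;> simp <;> exact key _ _ _ ‹_›

lemma bose_bose {u : R} (hu : 2 * u = 1) (j : R) {p q : R × Fin 3} (h : p ≠ q) :
    bose u j p (bose u j p q) = q := by
  obtain ⟨x, i⟩ := p
  obtain ⟨y, l⟩ := q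
  have hs : shift i j + shift (i + 1) j + shift (i + 2) j = 0 := by
    fin_cases i <;> simp [shift] <;> ring
  obtain ⟨e1, e2, a1, a2, a3, hl, hl1, hl2⟩ := fin3_facts i l
  rcases hl with rfl | rfl | rfl
  · have hxy : x ≠ y := fun e => h (by rw [e])
    have h1 : ¬ u * (x + y) + shift l j = x + shift l j := fun h1 => hxy (by
      linear_combination -2 * h1 + (x + y) * hu)
    simp only [bose, if_true, e1.symm, if_false, h1]
    ext
    · simp only; linear_combination (x + y) * hu
    · rfl
  · by_cases hy : y = x + shift i j
    · subst hy
      have h1 : x = x + shift i j + shift (i + 1) j + shift (i + 2) j := by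
        linear_combination -hs
      simp [bose, e1.symm, a1, e2.symm, a3, ← h1]
    · simp only [bose, if_true, e1.symm, if_false, hy]
      ext
      · simp only; linear_combination (y - shift i j) * hu
      · rfl
  · by_cases hy : x = y + shift (i + 2) j
    · simp only [bose, e1.symm, e2.symm, if_true, if_false, a3, ← hy, a1]
      ext
      · simp only; linear_combination hs + hy
      · rfl
    · have h1 : ¬ x = 2 * (x - shift (i + 2) j) - y + shift (i + 2) j := fun h1 => hy (by
        linear_combination -h1)
      simp only [bose, e2.symm, if_false, a3, hy, h1]
      ext
      · simp only; ring
      · rfl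

lemma shift_injective {u : R} (hu : 2 * u = 1) (i : Fin 3) :
    Function.Injective (shift i : R → R) := by
  intro a b h
  simp only [shift] at h
  split_ifs at h
  · linear_combination -u * h + (b - a) * hu
  · exact h

lemma bose_injective {u : R} (hu : 2 * u = 1) {p q : R × Fin 3} {a b : R}
    (h : bose u a p q = bose u b p q) : a = b := by
  obtain ⟨x, i⟩ := p
  obtain ⟨y, l⟩ := q
  obtain ⟨e1, e2, a1, a2, a3, hl, hl1, hl2⟩ := fin3_facts i l
  have key : ∀ (i : Fin 3) (z w : R), 2 * (z - shift i a) - w = 2 * (z - shift i b) - w →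
      a = b := fun i z w h1 => shift_injective hu i (by
    linear_combination -u * h1 + (shift i b - shift i a) * hu)
  rcases hl with rfl | rfl | rfl
  · simp only [bose, if_true, Prod.mk.injEq, and_true, add_right_inj] at h
    exact shift_injective hu _ h
  · simp only [bose, if_true, e1.symm, if_false, a1] at h
    split_ifs at h with h1 h2 h2
    · exact shift_injective hu i (add_left_cancel (h1.symm.trans h2))
    · exact absurd (congrArg Prod.snd h) e2
    · exact absurd (congrArg Prod.snd h) e2.symm
    · exact key i y x (congrArg Prod.fst h)
  · simp only [bose, e2.symm, if_false, a3] at h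
    split_ifs at h with h1 h2 h2
    · exact shift_injective hu (i + 2) (add_left_cancel (h1.symm.trans h2))
    · exact absurd (congrArg Prod.snd h) a3.symm
    · exact absurd (congrArg Prod.snd h) a3
    · exact key (i + 2) x y (congrArg Prod.fst h)

lemma transv_bose {j u : R} {p q : R × Fin 3} (h : transv j p q) : transv j p (bose u j p q) := by
  obtain ⟨x, i⟩ := p
  obtain ⟨y, l⟩ := q
  have hs : shift i j + shift (i + 1) j + shift (i + 2) j = 0 := by
    fin_cases i <;> simp [shift] <;> ring
  obtain ⟨e1, e2, a1, a2, a3, hl, hl1, hl2⟩ := fin3_facts i l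
  rcases h with ⟨h1, h2⟩ | ⟨h1, h2⟩ <;> simp only at h1 h2
  · subst h1 h2
    right
    simp only [bose, if_true, e1.symm, if_false, a1, a2, true_and]
    linear_combination -hs
  · obtain rfl := hl1 h1
    left
    simp [bose, e2.symm, a3, ← h2]

lemma transv_injective {u : R} (hu : 2 * u = 1) {p q : R × Fin 3} {a b : R}
    (ha : transv a p q) (hb : transv b p q) : a = b := by
  obtain ⟨x, i⟩ := p
  obtain ⟨y, l⟩ := q
  obtain ⟨e1, e2, a1, a2, a3, hl, hl1, hl2⟩ := fin3_facts i l
  rcases ha with ⟨h1, h2⟩ | ⟨h1, h2⟩ <;> rcases hb with ⟨h3, h4⟩ | ⟨h3, h4⟩ <;>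
    simp only at h1 h2 h3 h4
  · exact shift_injective hu i (add_left_cancel (h2.symm.trans h4))
  · exact absurd h3 (hl2 h1)
  · exact absurd h1 (hl2 h3)
  · exact shift_injective hu l (add_left_cancel (h2.symm.trans h4))

lemma transv_irrefl (j : R) (p : R × Fin 3) : ¬ transv j p p := by
  have e1 : p.2 ≠ p.2 + 1 := (fin3_facts p.2 p.2).1.symm
  rintro (⟨h, _⟩ | ⟨h, _⟩) <;> exact e1 h

end Bose

end BoseSystems

section Packings

/-- There is a 3-graph on `V` with all codegrees at most `l` whose codegrees add up to at least
`l * |V| * (|V| - 1) - d`. -/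
def HasPacking (V : Type*) [Fintype V] (l d : ℕ) : Prop :=
  ∃ E : V → V → V → Prop, IsTriple E ∧ Bounded l E ∧
    l * (Fintype.card V * Fintype.card V) ≤ ∑ x, ∑ y, codeg E x y + d + l * Fintype.card V

lemma HasPacking.congr {V W : Type*} [Fintype V] [Fintype W] {l d : ℕ} (h : HasPacking V l d)
    (hc : Fintype.card W = Fintype.card V) : HasPacking W l d := by
  obtain ⟨E, h1, h2, h3⟩ := h
  let f : W ≃ V := Fintype.equivOfCardEq hc
  refine ⟨fun x y z => E (f x) (f y) (f z), h1.restrict f, fun x y hxy => ?_, ?_⟩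
  · rw [codeg_comp_equiv]; exact h2 _ _ (f.injective.ne hxy)
  · rw [hc]
    refine h3.trans (le_of_eq ?_)
    congr 2
    rw [← Equiv.sum_comp f]
    refine Finset.sum_congr rfl fun x _ => ?_
    rw [← Equiv.sum_comp f]
    exact Finset.sum_congr rfl fun y _ => (codeg_comp_equiv E f x y).symm

lemma HasPacking.le_Dmax {V : Type*} [Fintype V] {l d : ℕ} (h : HasPacking V l d) :
    l * (Fintype.card V * Fintype.card V) ≤
      6 * Dmax (Fintype.card V) (l + 1) + d + l * Fintype.card V := by
  obtain ⟨E, h1, h2, h3⟩ := h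
  have := Packing.le_Dmax (t := l + 1) h1 h2
  omega

lemma sum_sum_add {V : Type*} [Fintype V] {c : V → V → ℕ} {l : ℕ} (hs : ∀ x, c x x = 0)
    (hc : ∀ x y, x ≠ y → c x y = l) :
    ∑ x, ∑ y, c x y + l * Fintype.card V = l * (Fintype.card V * Fintype.card V) := by
  have : ∀ x, ∑ y, c x y + l = l * Fintype.card V := fun x => by
    have : ∑ y, (c x y + if x = y then l else 0) = ∑ y : V, l := by
      refine Finset.sum_congr rfl fun y _ => ?_
      split_ifs with hxy
      · rw [hxy, hs, zero_add]
      · rw [hc x y hxy, add_zero]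
    rw [Finset.sum_add_distrib] at this
    simpa [mul_comm] using this
  have h2 : ∑ x, (∑ y, c x y + l) = ∑ x : V, l * Fintype.card V :=
    Finset.sum_congr rfl fun x _ => this x
  rw [Finset.sum_add_distrib] at h2
  simp only [sum_const, card_univ, smul_eq_mul] at h2
  linarith

section Bose

variable {R : Type*} [CommRing R] [Fintype R]

lemma hasPacking_bose {u : R} (hu : 2 * u = 1) (S : Finset R) :
    HasPacking (R × Fin 3) #S 0 := by
  let E : R × Fin 3 → R × Fin 3 → R × Fin 3 → Prop := fun p q s => p ≠ q ∧ ∃ j ∈ S, bose u j p q = s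
  have hE : IsTriple E := by
    refine ⟨?_, ?_, fun h => h.1⟩
    · rintro p q s ⟨h, j, hj, rfl⟩
      exact ⟨h.symm, j, hj, bose_comm ..⟩
    · rintro p q s ⟨h, j, hj, rfl⟩
      refine ⟨?_, j, hj, ?_⟩
      · rw [bose_comm]; exact (bose_ne hu j h.symm).symm
      · rw [bose_comm u j p q, bose_bose hu j h.symm]
  have hc : ∀ p q, p ≠ q → codeg E p q = #S := by
    intro p q h
    rw [← Finset.card_image_of_injective S (f := fun j => bose u j p q)
      (fun a b hab => bose_injective hu hab)]
    unfold codeg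
    congr 1
    ext s
    simp [E, h]
  exact ⟨E, hE, fun p q h => (hc p q h).le, (sum_sum_add (codeg_self hE) hc).ge⟩

/-- The shifted Bose triple systems with a new point joined to the transversal pairs of the
classes in `M`. -/
def boseInf (u : R) (S M : Finset R) : Option (R × Fin 3) → Option (R × Fin 3) →
    Option (R × Fin 3) → Prop
  | some p, some q, some s => p ≠ q ∧ ∃ j ∈ S, bose u j p q = s ∧ ¬ (j ∈ M ∧ transv j p q)
  | none, some p, some q => ∃ j ∈ M, transv j p q
  | some p, none, some q => ∃ j ∈ M, transv j p q
  | some p, some q, none => ∃ j ∈ M, transv j p q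
  | _, _, _ => False

lemma boseInf_isTriple {u : R} (hu : 2 * u = 1) (S M : Finset R) :
    IsTriple (boseInf u S M) := by
  have key : ∀ (j : R) p q, transv j p q → transv j q p := fun _ _ _ h => transv_comm h
  have ht : ∀ (j : R) p, ¬ transv j p p := transv_irrefl
  refine ⟨?_, ?_, ?_⟩
  · rintro (_ | p) (_ | q) (_ | s) h <;> simp only [boseInf] at h ⊢
    · exact h
    · exact h
    · obtain ⟨j, hj, h⟩ := h; exact ⟨j, hj, key _ _ _ h⟩
    · obtain ⟨h, j, hj, h1, h2⟩ := h
      exact ⟨h.symm, j, hj, by rw [bose_comm, h1], fun h3 => h2 ⟨h3.1, key _ _ _ h3.2⟩⟩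
  · rintro (_ | p) (_ | q) (_ | s) h <;> simp only [boseInf] at h ⊢
    · exact h
    · obtain ⟨j, hj, h⟩ := h; exact ⟨j, hj, key _ _ _ h⟩
    · obtain ⟨j, hj, h⟩ := h; exact ⟨j, hj, key _ _ _ h⟩
    · obtain ⟨h, j, hj, rfl, h2⟩ := h
      have h1 : bose u j q (bose u j p q) = p := by
        rw [bose_comm u j p q, bose_bose hu j h.symm]
      refine ⟨?_, j, hj, h1, fun h3 => h2 ⟨h3.1, ?_⟩⟩
      · rw [bose_comm]; exact (bose_ne hu j h.symm).symm
      · have := transv_bose (u := u) h3.2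
        rw [h1] at this
        exact key _ _ _ this
  · rintro (_ | p) (_ | q) (_ | s) h <;> simp only [boseInf] at h <;> simp
    · obtain ⟨j, hj, h⟩ := h; rintro rfl; exact ht _ _ h
    · exact h.1

lemma codeg_boseInf {u : R} (hu : 2 * u = 1) {S M : Finset R} (hM : M ⊆ S) {p q : R × Fin 3}
    (h : p ≠ q) : codeg (boseInf u S M) (some p) (some q) = #S := by
  rw [← Finset.card_image_of_injective S
    (f := fun j => if j ∈ M ∧ transv j p q then none else some (bose u j p q)) ?_]
  · unfold codeg
    congr 1
    ext (_ | s)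
    · simp only [mem_filter, mem_univ, true_and, mem_image]
      simp only [boseInf]
      constructor
      · rintro ⟨j, hj, h1⟩; exact ⟨j, hM hj, by simp [hj, h1]⟩
      · rintro ⟨j, hj, h1⟩
        split_ifs at h1 with h2
        exact ⟨j, h2⟩
    · simp only [mem_filter, mem_univ, true_and, mem_image]
      simp only [boseInf]
      constructor
      · rintro ⟨_, j, hj, h1, h2⟩; exact ⟨j, hj, by rw [if_neg h2, h1]⟩
      · rintro ⟨j, hj, h1⟩
        split_ifs at h1 with h2
        exact ⟨h, j, hj, Option.some_injective _ h1, h2⟩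
  · intro a b hab
    simp only at hab
    split_ifs at hab with h1 h2 h2
    · exact transv_injective hu h1.2 h2.2
    · exact bose_injective hu (Option.some_injective _ hab)

lemma codeg_boseInf_none {u : R} (hu : 2 * u = 1) (S M : Finset R) (p : R × Fin 3) :
    codeg (boseInf u S M) none (some p) = 2 * #M := by
  obtain ⟨x, i⟩ := p
  obtain ⟨e1, e2, a1, a2, a3, -⟩ := fin3_facts i i
  have h1 : Function.Injective fun j : R => some (x + shift i j, i + 1) := fun a b h => by
    simp only [Option.some.injEq, Prod.mk.injEq, add_right_inj, and_true] at h
    exact shift_injective hu _ h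
  have h2 : Function.Injective fun j : R => some (x - shift (i + 2) j, i + 2) := fun a b h => by
    simp only [Option.some.injEq, Prod.mk.injEq, sub_right_inj, and_true] at h
    exact shift_injective hu _ h
  rw [two_mul]
  nth_rw 1 [← Finset.card_image_of_injective M h1]
  rw [← Finset.card_image_of_injective M h2, ← Finset.card_union_of_disjoint]
  · unfold codeg
    congr 1
    ext (_ | ⟨y, l⟩)
    · simp [boseInf]
    · simp only [mem_filter, mem_univ, true_and, mem_union, mem_image, Option.some.injEq,
        Prod.mk.injEq]
      simp only [boseInf, transv]
      obtain ⟨-, -, -, -, -, -, hl, -⟩ := fin3_facts i l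
      constructor
      · rintro ⟨j, hj, ⟨h3, h4⟩ | ⟨h3, h4⟩⟩
        · exact Or.inl ⟨j, hj, h4.symm, h3.symm⟩
        · obtain rfl := hl h3
          exact Or.inr ⟨j, hj, by rw [h4]; ring, rfl⟩
      · rintro (⟨j, hj, rfl, rfl⟩ | ⟨j, hj, rfl, rfl⟩)
        · exact ⟨j, hj, Or.inl ⟨rfl, rfl⟩⟩
        · exact ⟨j, hj, Or.inr ⟨a2.symm, by ring⟩⟩
  · rw [Finset.disjoint_left]
    simp only [mem_image, not_exists, not_and, forall_exists_index, and_imp]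
    rintro _ j hj rfl j' hj' h
    simp only [Option.some.injEq, Prod.mk.injEq] at h
    exact a3 h.2

lemma hasPacking_boseInf {u : R} (hu : 2 * u = 1) (S : Finset R) :
    HasPacking (Option (R × Fin 3)) #S (2 * Fintype.card (Option (R × Fin 3))) := by
  obtain ⟨M, hM, hc⟩ := Finset.exists_subset_card_eq (s := S) (n := #S / 2) (Nat.div_le_self _ _)
  have hE := boseInf_isTriple hu S M
  refine ⟨boseInf u S M, hE, ?_, ?_⟩
  · rintro (_ | p) (_ | q) h
    · exact absurd rfl h
    · rw [codeg_boseInf_none hu]; omega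
    · rw [codeg_comm hE, codeg_boseInf_none hu]; omega
    · exact (codeg_boseInf hu hM fun e => h (by rw [e])).le
  · have h1 := sum_sum_add (c := fun p q : R × Fin 3 => codeg (boseInf u S M) (some p) (some q))
      (fun p => codeg_self hE _) (fun p q h => codeg_boseInf hu hM h)
    simp only [Fintype.sum_option, codeg_self hE, codeg_boseInf_none hu, sum_add_distrib,
      codeg_comm hE (some _) none, sum_const, card_univ, smul_eq_mul, Fintype.card_option]
    have h4 : 2 * #M + 1 ≥ #S := by omega
    generalize Fintype.card (R × Fin 3) = v at *
    have := Nat.mul_le_mul_left (2 * v) h4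
    nlinarith

end Bose

end Packings

section Triplication

variable {K P : Type*} [AddCommGroup K] [Fintype K] [Fintype P]

/-- Three copies of a 3-graph on `K ⊕ P` sharing `P`, without the edges meeting `P` twice,
together with the transversal triples with sum in `S`. -/
def triplicate (S : Finset K) (E : K ⊕ P → K ⊕ P → K ⊕ P → Prop) :
    K × Fin 3 ⊕ P → K × Fin 3 ⊕ P → K × Fin 3 ⊕ P → Prop
  | .inl p, .inl q, .inl s => (p.2 = q.2 ∧ q.2 = s.2 ∧ E (.inl p.1) (.inl q.1) (.inl s.1)) ∨
      (p.2 ≠ q.2 ∧ s.2 = -p.2 - q.2 ∧ p.1 + q.1 + s.1 ∈ S)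
  | .inr a, .inl p, .inl q => p.2 = q.2 ∧ E (.inr a) (.inl p.1) (.inl q.1)
  | .inl p, .inr a, .inl q => p.2 = q.2 ∧ E (.inr a) (.inl p.1) (.inl q.1)
  | .inl p, .inl q, .inr a => p.2 = q.2 ∧ E (.inr a) (.inl p.1) (.inl q.1)
  | _, _, _ => False

variable {S : Finset K} {E : K ⊕ P → K ⊕ P → K ⊕ P → Prop}

lemma fin3_third : ∀ i j l : Fin 3, i ≠ j → l = -i - j → j ≠ l ∧ i = -j - l := by decide

lemma triplicate_isTriple (h : IsTriple E) : IsTriple (triplicate S E) := by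
  refine ⟨?_, ?_, ?_⟩
  · rintro (⟨x, i⟩ | a) (⟨y, j⟩ | b) (⟨z, l⟩ | c) H <;> simp only [triplicate] at H ⊢
    · rcases H with ⟨rfl, rfl, H⟩ | ⟨h1, h2, h3⟩
      · exact Or.inl ⟨rfl, rfl, h.swap H⟩
      · exact Or.inr ⟨h1.symm, by rw [h2]; abel, by rwa [add_comm y]⟩
    · exact ⟨H.1.symm, h.swap' H.2⟩
    · exact H
    · exact H
  · rintro (⟨x, i⟩ | a) (⟨y, j⟩ | b) (⟨z, l⟩ | c) H <;> simp only [triplicate] at H ⊢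
    · rcases H with ⟨rfl, rfl, H⟩ | ⟨h1, h2, h3⟩
      · exact Or.inl ⟨rfl, rfl, h.rot H⟩
      · obtain ⟨h4, h5⟩ := fin3_third i j l h1 h2
        refine Or.inr ⟨h4, h5, ?_⟩
        rwa [show y + z + x = x + y + z by abel]
    · exact ⟨H.1.symm, h.swap' H.2⟩
    · exact ⟨H.1.symm, h.swap' H.2⟩
    · exact H
  · rintro (⟨x, i⟩ | a) (⟨y, j⟩ | b) (⟨z, l⟩ | c) H <;> simp only [triplicate] at H <;> simp
    · rcases H with ⟨rfl, rfl, H⟩ | ⟨h1, h2, h3⟩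
      · rintro rfl; exact absurd rfl (h.ne H)
      · exact fun _ => h1
    · rintro rfl; exact absurd rfl (h.ne' H.2)

lemma codeg_sum {α β : Type*} [Fintype α] [Fintype β] (F : α ⊕ β → α ⊕ β → α ⊕ β → Prop)
    (p q : α ⊕ β) : codeg F p q = #{a | F p q (.inl a)} + #{b | F p q (.inr b)} := by
  unfold codeg
  simp only [Finset.card_filter, Fintype.sum_sum_type]

lemma card_filter_layer (i : Fin 3) (Q : K → Prop) :
    #{p : K × Fin 3 | i = p.2 ∧ Q p.1} = #{x | Q x} := by
  rw [← Finset.card_image_of_injective (s := {x | Q x}) (f := fun x => (x, i))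
    (fun a b h => congrArg Prod.fst h)]
  congr 1
  ext ⟨x, l⟩
  simp only [mem_filter, mem_univ, true_and, mem_image, Prod.mk.injEq]
  constructor
  · rintro ⟨rfl, h⟩; exact ⟨x, h, rfl, rfl⟩
  · rintro ⟨y, h, rfl, rfl⟩; exact ⟨rfl, h⟩

lemma codeg_triplicate_layer (h : IsTriple E) (x y : K) (i : Fin 3) :
    codeg (triplicate S E) (.inl (x, i)) (.inl (y, i)) = codeg E (.inl x) (.inl y) := by
  rw [codeg_sum, codeg_sum]
  simp only [triplicate, true_and, ne_eq, not_true_eq_false, false_and, or_false]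
  congr 1
  · exact card_filter_layer i fun z => E (.inl x) (.inl y) (.inl z)
  · congr 1; ext a
    simp only [mem_filter, mem_univ, true_and]
    exact ⟨h.rot, h.rot'⟩

lemma codeg_triplicate_ne (x y : K) {i j : Fin 3} (hij : i ≠ j) :
    codeg (triplicate S E) (.inl (x, i)) (.inl (y, j)) = #S := by
  rw [codeg_sum]
  simp only [triplicate, hij, ne_eq, not_false_eq_true, true_and, false_and, false_or,
    filter_false, card_empty, add_zero]
  have h1 := card_filter_layer (-i - j) (fun z => x + y + z ∈ S)
  simp only [eq_comm (a := -i - j)] at h1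
  rw [h1, ← Finset.card_image_of_injective S (f := fun s => s - (x + y))
    sub_left_injective]
  congr 1
  ext z
  simp only [mem_filter, mem_univ, true_and, mem_image]
  constructor
  · intro h; exact ⟨_, h, by abel⟩
  · rintro ⟨s, h, rfl⟩; simpa using h

lemma codeg_triplicate_inr (x : K) (i : Fin 3) (a : P) :
    codeg (triplicate S E) (.inl (x, i)) (.inr a) = #{z | E (.inr a) (.inl x) (.inl z)} := by
  have h0 : #{b | triplicate S E (.inl (x, i)) (.inr a) (.inr b)} = 0 :=
    Finset.card_eq_zero.2 (Finset.filter_eq_empty_iff.2 fun (b : P) _ h => h)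
  rw [codeg_sum, h0, add_zero]
  rw [← card_filter_layer i fun z => E (.inr a) (.inl x) (.inl z)]
  congr 1
  ext
  simp only [mem_filter, mem_univ, true_and]
  exact Iff.rfl

lemma codeg_triplicate_inr_inr (a b : P) : codeg (triplicate S E) (.inr a) (.inr b) = 0 :=
  codeg_eq_zero fun z H => by rcases z with z | z <;> exact H

lemma triplicate_bounded (h : IsTriple E) (hb : Bounded #S E) :
    Bounded #S (triplicate S E) := by
  have key : ∀ (x : K) (i : Fin 3) (a : P),
      codeg (triplicate S E) (.inl (x, i)) (.inr a) ≤ #S := fun x i a => by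
    rw [codeg_triplicate_inr]
    have := hb (.inr a) (.inl x) (by simp)
    rw [codeg_sum] at this
    omega
  rintro (⟨x, i⟩ | a) (⟨y, j⟩ | b) hxy
  · by_cases hij : i = j
    · subst hij
      rw [codeg_triplicate_layer h]
      exact hb _ _ fun e => hxy (by simpa using e)
    · exact (codeg_triplicate_ne x y hij).le
  · exact key ..
  · rw [codeg_comm (triplicate_isTriple h)]; exact key ..
  · rw [codeg_triplicate_inr_inr]; exact zero_le

lemma sum_codeg_triplicate (h : IsTriple E) (hb : Bounded #S E) :
    6 * (#S * (Fintype.card K * Fintype.card K)) + 3 * ∑ p, ∑ q, codeg E p q ≤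
      ∑ p, ∑ q, codeg (triplicate S E) p q +
        9 * (#S * (Fintype.card P * Fintype.card P)) := by
  have hb' : ∀ a b : P, codeg E (.inr a) (.inr b) ≤ #S := fun a b => by
    by_cases hab : a = b
    · rw [hab, codeg_self h]; exact zero_le
    · exact hb _ _ (by simpa using hab)
  have hrr : ∑ a : P, ∑ b : P, codeg E (.inr a) (.inr b) ≤
      #S * (Fintype.card P * Fintype.card P) := by
    calc _ ≤ ∑ a : P, ∑ b : P, #S :=
          Finset.sum_le_sum fun a _ => Finset.sum_le_sum fun b _ => hb' a b
      _ = _ := by simp; ring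
  have hkr : ∑ x : K, ∑ a : P, codeg E (.inl x) (.inr a) ≤
      ∑ x : K, ∑ a : P, #{z | E (.inr a) (.inl x) (.inl z)} +
        #S * (Fintype.card P * Fintype.card P) := by
    have h1 : ∀ (x : K) (a : P), codeg E (.inl x) (.inr a) =
        #{z | E (.inr a) (.inl x) (.inl z)} + #{b | E (.inr a) (.inl x) (.inr b)} := fun x a => by
      rw [codeg_comm h, codeg_sum]
    have h2 : ∑ x : K, ∑ a : P, #{b : P | E (.inr a) (.inl x) (.inr b)} ≤
        ∑ a : P, ∑ b : P, codeg E (.inr a) (.inr b) := by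
      rw [Finset.sum_comm]
      refine Finset.sum_le_sum fun a _ => ?_
      simp only [codeg_sum, Finset.card_filter]
      rw [Finset.sum_comm]
      refine Finset.sum_le_sum fun b _ => ?_
      refine le_trans (le_of_eq ?_) (Nat.le_add_right _ _)
      refine Finset.sum_congr rfl fun x _ => ?_
      congr 1
      exact propext ⟨h.swap', h.swap'⟩
    simp only [h1, Finset.sum_add_distrib]
    omega
  have h1 : ∀ x : K, ∀ i : Fin 3, ∑ y : K, ∑ j : Fin 3,
      codeg (triplicate S E) (.inl (x, i)) (.inl (y, j)) =
        ∑ y : K, codeg E (.inl x) (.inl y) + Fintype.card K * (2 * #S) := fun x i => by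
    have : ∀ y, ∑ j : Fin 3, codeg (triplicate S E) (.inl (x, i)) (.inl (y, j)) =
        codeg E (.inl x) (.inl y) + 2 * #S := fun y => by
      rw [← Finset.add_sum_erase _ _ (mem_univ i), codeg_triplicate_layer h,
        Finset.sum_congr rfl fun j hj => codeg_triplicate_ne x y (Finset.ne_of_mem_erase hj).symm]
      simp
    simp only [this, sum_add_distrib, sum_const, card_univ, smul_eq_mul]
  simp only [Fintype.sum_sum_type, Fintype.sum_prod_type, sum_add_distrib, h1,
    codeg_comm (triplicate_isTriple h) (.inr _) (.inl _), codeg_comm h (.inr _) (.inl _),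
    codeg_triplicate_inr, codeg_triplicate_inr_inr, sum_const, card_univ, smul_eq_mul,
    Fintype.card_fin, Fintype.card_prod, mul_zero]
  rw [Finset.sum_comm (s := (univ : Finset P)) (t := (univ : Finset K)),
    Finset.sum_comm (s := (univ : Finset P)) (t := (univ : Finset K))]
  simp only [← Finset.mul_sum]
  generalize #S * (Fintype.card P * Fintype.card P) = w at *
  nlinarith

lemma HasPacking.triplicate {d : ℕ} (h : HasPacking (K ⊕ P) #S d) :
    HasPacking (K × Fin 3 ⊕ P) #S (3 * d + 9 * (#S * (Fintype.card P * Fintype.card P))) := by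
  obtain ⟨E, h1, h2, h3⟩ := h
  refine ⟨Packing.triplicate S E, triplicate_isTriple h1, triplicate_bounded h1 h2, ?_⟩
  have h4 := sum_codeg_triplicate h1 h2
  simp only [Fintype.card_sum, Fintype.card_prod, Fintype.card_fin] at h3 ⊢
  generalize Fintype.card P = r at *
  generalize Fintype.card K = k at *
  have h5 : #S * r ≤ #S * (r * r) := Nat.mul_le_mul_left _ (Nat.le_mul_self r)
  nlinarith

lemma HasPacking.le_Dmax_triplicate {V : Type*} [Fintype V] {l d m r : ℕ} (h : HasPacking V l d)
    (hV : Fintype.card V = m + 1 + r) (hl : l ≤ m + 1) :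
    l * ((3 * (m + 1) + r) * (3 * (m + 1) + r)) ≤
      6 * Dmax (3 * (m + 1) + r) (l + 1) + (3 * d + 9 * (l * (r * r))) +
        l * (3 * (m + 1) + r) := by
  obtain ⟨S, -, hS⟩ := Finset.exists_subset_card_eq (s := (univ : Finset (ZMod (m + 1))))
    (n := l) (by simpa using hl)
  have h1 : HasPacking (ZMod (m + 1) ⊕ Fin r) #S d := by
    rw [hS]; exact h.congr (by simp [hV])
  have h2 := h1.triplicate.le_Dmax
  rw [hS] at h2
  have h3 : Fintype.card (ZMod (m + 1) × Fin 3 ⊕ Fin r) = 3 * (m + 1) + r := by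
    simp [mul_comm]
  simpa only [h3, Fintype.card_fin] using h2

lemma exists_bose_base (l j : ℕ) (hl : l ≤ 2 * j + 1) :
    HasPacking (ZMod (2 * j + 1) × Fin 3) l 0 ∧
      HasPacking (Option (ZMod (2 * j + 1) × Fin 3)) l (2 * (6 * j + 4)) := by
  obtain ⟨S, -, hS⟩ := Finset.exists_subset_card_eq (s := (univ : Finset (ZMod (2 * j + 1))))
    (n := l) (by simpa using hl)
  have hu : (2 : ZMod (2 * j + 1)) * ((j + 1 : ℕ) : ZMod (2 * j + 1)) = 1 := by
    have : ((2 * j + 1 : ℕ) : ZMod (2 * j + 1)) = 0 := ZMod.natCast_self _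
    push_cast at this ⊢
    linear_combination this
  have h1 := hasPacking_bose hu S
  have h2 := hasPacking_boseInf hu S
  have h3 : Fintype.card (Option (ZMod (2 * j + 1) × Fin 3)) = 6 * j + 4 := by
    simp; ring
  rw [hS] at h1 h2
  rw [h3] at h2
  exact ⟨h1, h2⟩

theorem exists_le_Dmax (l : ℕ) : ∃ C : ℕ, ∀ N : ℕ,
    l * (N * N) ≤ 6 * Dmax N (l + 1) + (2 * N + C) + l * N := by
  refine ⟨l * ((9 * l + 60) * (9 * l + 60)) + 9 * (l * (8 * 8)) + 96, fun N => ?_⟩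
  by_cases hN : N < 9 * l + 60
  · have := Nat.mul_le_mul_left l (Nat.mul_le_mul hN.le hN.le)
    omega
  push Not at hN
  have hr : ∀ r ≤ 8, l * (r * r) ≤ l * (8 * 8) := fun r hr =>
    Nat.mul_le_mul_left _ (Nat.mul_le_mul hr hr)
  rcases Nat.even_or_odd' N with ⟨c, rfl | rfl⟩
  · obtain ⟨j, r, hj, hr8⟩ : ∃ j r, 2 * c + 2 * r = 18 * j + 12 ∧ r ≤ 8 :=
      ⟨(2 * c + 4) / 18, 9 * ((2 * c + 4) / 18) + 6 - c, by omega, by omega⟩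
    have h1 := (exists_bose_base l j (by omega)).2.le_Dmax_triplicate (m := 6 * j + 3 - r) (r := r)
      (by simp; omega) (by omega)
    rw [show 3 * (6 * j + 3 - r + 1) + r = 2 * c by omega] at h1
    have := hr r hr8
    omega
  · obtain ⟨j, r, hj, hr8⟩ : ∃ j r, 2 * c + 1 + 2 * r = 18 * j + 9 ∧ r ≤ 8 :=
      ⟨(2 * c + 8) / 18, 9 * ((2 * c + 8) / 18) + 4 - c, by omega, by omega⟩
    have h1 := (exists_bose_base l j (by omega)).1.le_Dmax_triplicate (m := 6 * j + 2 - r) (r := r)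
      (by simp; omega) (by omega)
    rw [show 3 * (6 * j + 2 - r + 1) + r = 2 * c + 1 by omega] at h1
    have := hr r hr8
    omega

end Triplication

section Numeric

variable {D : ℕ → ℝ} {l C : ℝ}

/-- Moving a vertex from a larger part to a smaller one does not decrease the edge count. -/
lemma balance_step (hC0 : 0 ≤ C) (hu : ∀ N : ℕ, 6 * D N ≤ l * (N * (N - 1)))
    (hd : ∀ N : ℕ, l * (N * (N - 1)) ≤ 6 * D N + 2 * N + C) {x y z m : ℕ} (hm : x + y + z = m)
    (hC : 10 * (C + l) ≤ m) (hy : 33 * m ≤ 100 * y) (hz : 33 * m ≤ 100 * z) (hxy : y + 2 ≤ x) :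
    (x : ℝ) * y * z + (D x + D y + D z) ≤
      ((x - 1 : ℕ) : ℝ) * (y + 1 : ℕ) * z + (D (x - 1) + D (y + 1) + D z) := by
  obtain ⟨w, rfl⟩ : ∃ w, x = w + 1 := ⟨x - 1, by omega⟩
  rw [Nat.add_sub_cancel]
  have h1 := hu (w + 1)
  have h2 := hu y
  have h3 := hd w
  have h4 := hd (y + 1)
  have hw : (y : ℝ) + 1 ≤ w := by exact_mod_cast (by omega : y + 1 ≤ w)
  have hm' : (w : ℝ) + 1 + y + z = m := by exact_mod_cast hm
  have hy' : (33 : ℝ) * m ≤ 100 * y := by exact_mod_cast hy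
  have hz' : (33 : ℝ) * m ≤ 100 * z := by exact_mod_cast hz
  have hw0 : (0 : ℝ) ≤ y := Nat.cast_nonneg _
  push_cast at h1 h2 h3 h4 ⊢
  generalize (w : ℝ) = w at *
  generalize (y : ℝ) = y at *
  generalize (z : ℝ) = z at *
  have h5 : 0 ≤ (z - l / 3) * (w - y - 1) := mul_nonneg (by linarith) (by linarith)
  have h6 : w * (y + 1) * z - (w + 1) * y * z =
      (z - l / 3) * (w - y - 1) + (z - l / 3) + (l * (w - y)) / 3 := by ring
  have h7 : l * ((w + 1) * (w + 1 - 1)) + l * (y * (y - 1)) - l * (w * (w - 1)) -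
      l * ((y + 1) * (y + 1 - 1)) = 2 * (l * (w - y)) := by ring
  linarith

lemma eq_balanced {x y z m : ℕ} (hm : x + y + z = m) (h1 : x < y + 2) (h2 : y < x + 2)
    (h3 : x < z + 2) (h4 : z < x + 2) (h5 : y < z + 2) (h6 : z < y + 2) :
    (x : ℝ) * y * z + (D x + D y + D z) =
      ((m + 2) / 3 : ℕ) * ((m + 1) / 3 : ℕ) * (m / 3 : ℕ) +
        (D ((m + 2) / 3) + D ((m + 1) / 3) + D (m / 3)) := by
  generalize ha : (m + 2) / 3 = a
  generalize hb : (m + 1) / 3 = b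
  generalize hc : m / 3 = c
  have : (x = a ∧ y = b ∧ z = c) ∨ (x = a ∧ y = c ∧ z = b) ∨ (x = b ∧ y = a ∧ z = c) ∨
      (x = b ∧ y = c ∧ z = a) ∨ (x = c ∧ y = a ∧ z = b) ∨ (x = c ∧ y = b ∧ z = a) := by omega
  rcases this with ⟨rfl, rfl, rfl⟩ | ⟨rfl, rfl, rfl⟩ | ⟨rfl, rfl, rfl⟩ | ⟨rfl, rfl, rfl⟩ |
    ⟨rfl, rfl, rfl⟩ | ⟨rfl, rfl, rfl⟩ <;> ring

/-- Among nearly balanced partitions the balanced one is optimal. -/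
lemma le_balanced (hC0 : 0 ≤ C) (hu : ∀ N : ℕ, 6 * D N ≤ l * (N * (N - 1)))
    (hd : ∀ N : ℕ, l * (N * (N - 1)) ≤ 6 * D N + 2 * N + C) {m : ℕ} (hC : 10 * (C + l) ≤ m)
    (k : ℕ) : ∀ x y z : ℕ, x * x + y * y + z * z ≤ k → x + y + z = m → 33 * m ≤ 100 * x →
      33 * m ≤ 100 * y → 33 * m ≤ 100 * z →
    (x : ℝ) * y * z + (D x + D y + D z) ≤
      ((m + 2) / 3 : ℕ) * ((m + 1) / 3 : ℕ) * (m / 3 : ℕ) +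
        (D ((m + 2) / 3) + D ((m + 1) / 3) + D (m / 3)) := by
  induction k with
  | zero =>
    intro x y z hk hm hx hy hz
    have hx0 : x = 0 := by nlinarith
    have hy0 : y = 0 := by nlinarith
    have hz0 : z = 0 := by nlinarith
    exact (eq_balanced hm (by omega) (by omega) (by omega) (by omega) (by omega) (by omega)).le
  | succ k ih =>
    have key : ∀ x y z : ℕ, x * x + y * y + z * z ≤ k + 1 → x + y + z = m → 33 * m ≤ 100 * x →
        33 * m ≤ 100 * y → 33 * m ≤ 100 * z → y + 2 ≤ x →
        (x : ℝ) * y * z + (D x + D y + D z) ≤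
          ((m + 2) / 3 : ℕ) * ((m + 1) / 3 : ℕ) * (m / 3 : ℕ) +
            (D ((m + 2) / 3) + D ((m + 1) / 3) + D (m / 3)) := by
      intro x y z hk hm hx hy hz hxy
      refine (balance_step hC0 hu hd hm hC hy hz hxy).trans
        (ih (x - 1) (y + 1) z ?_ (by omega) (by omega) (by omega) hz)
      obtain ⟨w, rfl⟩ : ∃ w, x = w + 1 := ⟨x - 1, by omega⟩
      rw [Nat.add_sub_cancel]
      nlinarith
    intro x y z hk hm hx hy hz
    by_cases h1 : y + 2 ≤ x
    · exact key x y z hk hm hx hy hz h1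
    by_cases h2 : x + 2 ≤ y
    · refine le_trans (le_of_eq ?_) (key y x z (by omega) (by omega) hy hx hz h2); ring
    by_cases h3 : z + 2 ≤ x
    · refine le_trans (le_of_eq ?_) (key x z y (by omega) (by omega) hx hz hy h3); ring
    by_cases h4 : x + 2 ≤ z
    · refine le_trans (le_of_eq ?_) (key z x y (by omega) (by omega) hz hx hy h4); ring
    by_cases h5 : z + 2 ≤ y
    · refine le_trans (le_of_eq ?_) (key y z x (by omega) (by omega) hy hz hx h5); ring
    by_cases h6 : y + 2 ≤ z
    · refine le_trans (le_of_eq ?_) (key z y x (by omega) (by omega) hz hy hx h6); ring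
    exact (eq_balanced hm (by omega) (by omega) (by omega) (by omega) (by omega) (by omega)).le

lemma balanced_ge (hl : 0 ≤ l)
    (hd : ∀ N : ℕ, l * (N * (N - 1)) ≤ 6 * D N + 2 * N + C) (m : ℕ) :
    6 * ((m / 3 : ℝ) ^ 3 - m / 9 - 1) + l * ((m : ℝ) ^ 2 / 3 - m) - 2 * m - 3 * C ≤
      6 * (((m + 2) / 3 : ℕ) * ((m + 1) / 3 : ℕ) * (m / 3 : ℕ) +
        (D ((m + 2) / 3) + D ((m + 1) / 3) + D (m / 3))) := by
  have h1 := hd ((m + 2) / 3)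
  have h2 := hd ((m + 1) / 3)
  have h3 := hd (m / 3)
  obtain ⟨n, hn⟩ : ∃ n, n = m / 3 := ⟨_, rfl⟩
  have hm : m = 3 * n ∨ m = 3 * n + 1 ∨ m = 3 * n + 2 := by omega
  rcases hm with hm | hm | hm
  · rw [show (m + 2) / 3 = n by omega, show (m + 1) / 3 = n by omega,
      show m / 3 = n by omega] at *
    have : (m : ℝ) = 3 * n := by exact_mod_cast hm
    rw [this]
    nlinarith [(Nat.cast_nonneg n : (0 : ℝ) ≤ n)]
  · rw [show (m + 2) / 3 = n + 1 by omega, show (m + 1) / 3 = n by omega,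
      show m / 3 = n by omega] at *
    have : (m : ℝ) = 3 * n + 1 := by exact_mod_cast hm
    rw [this]
    push_cast at *
    nlinarith [(Nat.cast_nonneg n : (0 : ℝ) ≤ n)]
  · rw [show (m + 2) / 3 = n + 1 by omega, show (m + 1) / 3 = n + 1 by omega,
      show m / 3 = n by omega] at *
    have : (m : ℝ) = 3 * n + 2 := by exact_mod_cast hm
    rw [this]
    push_cast at *
    nlinarith [(Nat.cast_nonneg n : (0 : ℝ) ≤ n)]

lemma three_parts_le {p a b k : ℝ} (hk : k ≤ 2 * p)
    (hab : |a + b| ≤ p / 100) :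
    6 * ((p + a) * (p + b) * (p - a - b)) + k * ((p + a) * (p + a - 1) +
      (p + b) * (p + b - 1) + (p - a - b) * (p - a - b - 1)) ≤
      6 * p ^ 3 + k * (3 * p ^ 2 - 3 * p) := by
  have hp : 0 ≤ p := by linarith [abs_nonneg (a + b)]
  obtain ⟨q, hq⟩ : ∃ q, q = a ^ 2 + a * b + b ^ 2 := ⟨_, rfl⟩
  have hq1 : q = (a + b / 2) ^ 2 + 3 / 4 * b ^ 2 := by rw [hq]; ring
  have hq0 : 0 ≤ q := by rw [hq1]; positivity
  have e1 : 6 * ((p + a) * (p + b) * (p - a - b)) = 6 * p ^ 3 - 6 * p * q -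
      6 * (a * b * (a + b)) := by rw [hq]; ring
  have e2 : (p + a) * (p + a - 1) + (p + b) * (p + b - 1) + (p - a - b) * (p - a - b - 1) =
      3 * p ^ 2 - 3 * p + 2 * q := by rw [hq]; ring
  have h3 : -(a * b * (a + b)) ≤ q * (p / 100) := by
    have h4 : |a * b| ≤ q := by
      have := sq_nonneg (a + b)
      have := sq_nonneg (a - b)
      have := sq_nonneg a
      have := sq_nonneg b
      rw [abs_le]; constructor <;> linarith
    calc -(a * b * (a + b)) ≤ |a * b * (a + b)| := neg_le_abs _
      _ = |a * b| * |a + b| := abs_mul _ _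
      _ ≤ _ := mul_le_mul h4 hab (abs_nonneg _) hq0
  have h5 : 0 ≤ q * (6 * p - 6 * (p / 100) - 2 * k) := mul_nonneg hq0 (by linarith)
  rw [e1, e2]
  linarith

/-- With a nonempty exceptional set the edge count stays below the lower bound of
`balanced_ge`. -/
lemma exceptional_le {x y z s m : ℝ} (hs : 1 ≤ s) (hsl : s ≤ 2 * l)
    (hl : 1 ≤ l) (hC : 0 ≤ C) (hm : x + y + z + s = m) (hbig : 1000 * (l ^ 3 + C + 1) ≤ m)
    (hx : |x - m / 3| ≤ 0.000001 * m) (hy : |y - m / 3| ≤ 0.000001 * m) (hz : |z - m / 3| ≤ 0.000001 * m) :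
    6 * (x * y * z) + (l + 2 * s) * (x * (x - 1) + y * (y - 1) + z * (z - 1)) + 3 * l * s ^ 2 ≤
      6 * ((m / 3) ^ 3 - m / 9 - 1) + l * (m ^ 2 / 3 - m) - 2 * m - 3 * C := by
  have hl2 : l ^ 2 ≤ l ^ 3 := pow_le_pow_right₀ hl (by norm_num)
  have hl1 : l ≤ l ^ 2 := le_self_pow₀ hl (by norm_num)
  obtain ⟨p, hp⟩ : ∃ p, p = (m - s) / 3 := ⟨_, rfl⟩
  rw [abs_le] at hx hy hz
  have hab : |(x - p) + (y - p)| ≤ p / 100 := by rw [abs_le]; constructor <;> linarith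
  have h1 := three_parts_le (p := p) (a := x - p) (b := y - p) (k := l + 2 * s)
    (by linarith) hab
  rw [show p + (x - p) = x by ring, show p + (y - p) = y by ring,
    show p - (x - p) - (y - p) = z by linarith] at h1
  have h2 : 6 * ((m / 3) ^ 3 - m / 9 - 1) + l * (m ^ 2 / 3 - m) - 2 * m - 3 * C -
      (6 * p ^ 3 + (l + 2 * s) * (3 * p ^ 2 - 3 * p) + 3 * l * s ^ 2) =
      (2 * s ^ 2 + 2 * (l * s) + 6 * s - 8) * p + 2 / 9 * s ^ 3 - 2 / 3 * s - 6 + l * s ^ 2 / 3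
        - l * s - 2 * s - 3 * C - 3 * (l * s ^ 2) := by
    rw [show m = 3 * p + s by linarith]; ring
  have hls : l * s ≤ 2 * l ^ 2 := by
    have := mul_le_mul_of_nonneg_left hsl (by linarith : 0 ≤ l)
    linarith
  have hls1 : 1 ≤ l * s := one_le_mul_of_one_le_of_one_le hl hs
  have hs1 : 1 ≤ s ^ 2 := one_le_pow₀ hs
  have hs3 : l * s ^ 2 ≤ 4 * l ^ 3 := by
    have h3 : s ^ 2 ≤ (2 * l) ^ 2 := pow_le_pow_left₀ (by linarith) hsl 2
    have := mul_le_mul_of_nonneg_left h3 (by linarith : 0 ≤ l)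
    linarith
  have h7 : 2 * p ≤ (2 * s ^ 2 + 2 * (l * s) + 6 * s - 8) * p :=
    mul_le_mul_of_nonneg_right (by linarith) (by linarith)
  have h8 : 0 ≤ s ^ 3 := by positivity
  have h9 : 0 ≤ l * s ^ 2 := by positivity
  linarith

end Numeric

lemma eT3plus_eq (n t : ℕ) : eT3plus n t = (n + 2) / 3 * ((n + 1) / 3) * (n / 3) +
    (Dmax ((n + 2) / 3) t + Dmax ((n + 1) / 3) t + Dmax (n / 3) t) := by
  unfold eT3plus
  rw [card_T3, Fin.sum_univ_three]
  simp only [card_turanPart, Fin.val_zero, Fin.val_one, Fin.val_two]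
  rfl

lemma eT3plus_add_sq_le (n t : ℕ) : eT3plus n t + n / 3 * (n / 3) ≤ eT3plus (n + 1) t := by
  rw [eT3plus_eq, eT3plus_eq]
  have h1 : (n + 1 + 2) / 3 = n / 3 + 1 := by omega
  have h2 := Dmax_mono t (Nat.le_succ (n / 3))
  have h3 : n / 3 * (n / 3) ≤ (n + 2) / 3 * ((n + 1) / 3) :=
    Nat.mul_le_mul (by omega) (by omega)
  rw [h1, show n + 1 + 1 = n + 2 by ring, Nat.succ_eq_add_one] at *
  have h4 : (n / 3 + 1) * ((n + 2) / 3) * ((n + 1) / 3) =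
      (n + 2) / 3 * ((n + 1) / 3) * (n / 3) + (n + 2) / 3 * ((n + 1) / 3) := by ring
  omega

/-- The upper bound for 3-graphs of large minimum degree. -/
lemma cnt_le_of_deg (l : ℕ) : ∃ n₁ : ℕ, ∀ (V : Type) [Fintype V] (E : V → V → V → Prop),
    IsTriple E → Free (l + 1) E → n₁ ≤ Fintype.card V →
    (∀ v, (2 / 9 - 0.00000000000000000001) * (Fintype.card V : ℝ) ^ 2 ≤ deg E v) →
    cnt E univ univ univ ≤ 6 * eT3plus (Fintype.card V) (l + 1) := by
  obtain ⟨C, hC⟩ := exists_le_Dmax l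
  refine ⟨10 ^ 20 * (l + 3) + 1000 * (l ^ 3 + C + 1), fun V _ E h hF hn hdeg => ?_⟩
  have hn' : (10 : ℝ) ^ 20 * (l + 3) + 1000 * (l ^ 3 + C + 1) ≤ Fintype.card V := by
    exact_mod_cast hn
  have hl0 : (0 : ℝ) ≤ l := Nat.cast_nonneg l
  have hC0 : (0 : ℝ) ≤ C := Nat.cast_nonneg C
  have hl3 : (0 : ℝ) ≤ (l : ℝ) ^ 3 := by positivity
  have hm : (((l + 1 : ℕ) : ℝ) + 2) ≤ 0.00000000000000000001 * Fintype.card V := by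
    push_cast
    linarith
  have hT : (2 / 9 - 0.00000000000000000001) * (Fintype.card V : ℝ) ^ 3 ≤ cnt E univ univ univ := by
    rw [← sum_deg]
    calc (2 / 9 - 0.00000000000000000001) * (Fintype.card V : ℝ) ^ 3
        = ∑ v : V, (2 / 9 - 0.00000000000000000001) * (Fintype.card V : ℝ) ^ 2 := by
          rw [Finset.sum_const, Finset.card_univ, nsmul_eq_mul]; ring
      _ ≤ _ := Finset.sum_le_sum fun v _ => hdeg v
  obtain ⟨A₀, B₀, C₀, P⟩ := exists_tripartition h hF hm hT
  obtain ⟨X, A, B, S, L⟩ : ∃ X A B S, Labelling (l + 1) E A B S X :=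
    ⟨_, _, _, _, exists_labelling h hF hm hdeg P⟩
  have hcard : #A + #B + #S + #X = Fintype.card V := by
    rw [← Finset.card_univ, ← L.cover, Finset.card_union_of_disjoint L.disj_X,
      Finset.card_union_of_disjoint (Finset.disjoint_union_left.2 ⟨L.disj_AC, L.disj_BC⟩),
      Finset.card_union_of_disjoint L.disj_AB]
  obtain ⟨D, hD⟩ : ∃ D : ℕ → ℝ, D = fun N => (Dmax N (l + 1) : ℝ) := ⟨_, rfl⟩
  have hDv : ∀ N, (Dmax N (l + 1) : ℝ) = D N := fun N => by rw [hD]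
  have hu : ∀ N : ℕ, 6 * D N ≤ l * (N * (N - 1)) := by
    intro N
    have h1 := Dmax_le N (l + 1)
    rw [Nat.add_sub_cancel] at h1
    rw [← hDv]
    rcases N with _ | N
    · have h2 : Dmax 0 (l + 1) = 0 := by simpa using h1
      simp [h2]
    · rw [Nat.add_sub_cancel] at h1
      have h2 : (6 : ℝ) * Dmax (N + 1) (l + 1) ≤ l * ((N + 1 : ℕ) * N) := by exact_mod_cast h1
      push_cast at h2 ⊢
      linarith
  have hd : ∀ N : ℕ, (l : ℝ) * (N * (N - 1)) ≤ 6 * D N + 2 * N + C := by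
    intro N
    have h1 : (l : ℝ) * (N * N) ≤ 6 * Dmax N (l + 1) + (2 * N + C) + l * N := by
      exact_mod_cast hC N
    rw [hDv] at h1
    linarith
  rw [eT3plus_eq]
  push_cast
  simp only [hDv]
  have cA := abs_le.1 L.card_A
  have cB := abs_le.1 L.card_B
  have cS := abs_le.1 L.card_C
  have h33 : ∀ N : ℕ, (33 : ℝ) * Fintype.card V ≤ 100 * N → 33 * Fintype.card V ≤ 100 * N :=
    fun N hN => by exact_mod_cast hN
  rcases Finset.eq_empty_or_nonempty X with hX | hX
  · subst hX
    have h1 := L.cnt_le_of_X_empty h hF hm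
    simp only [hDv] at h1
    have h2 := le_balanced hC0 hu hd (m := Fintype.card V) (by linarith) _ #A #B #S le_rfl
      (by simpa using hcard) (h33 #A (by linarith))
      (h33 #B (by linarith))
      (h33 #S (by linarith))
    linarith
  · have h1 := L.cnt_le_of_X h hF (Nat.le_add_left 1 l) hm
    have h2 := L.card_X_le h (Nat.le_add_left 1 l) hm
    have h3 : (1 : ℝ) ≤ #X := by exact_mod_cast hX.card_pos
    push_cast at h1 h2
    rw [add_sub_cancel_right] at h1 h2
    have h4 : (1 : ℝ) ≤ l := by
      have : (0 : ℝ) < l := by linarith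
      exact_mod_cast this
    exact h1.trans ((exceptional_le h3 h2 h4 hC0 (by exact_mod_cast hcard)
      (by linarith) L.card_A L.card_B L.card_C).trans (balanced_ge hl0 hd _))

section Deletion

variable {V : Type*} [Fintype V] {E : V → V → V → Prop}

lemma Free.restrict {W : Type*} [Fintype W] {t : ℕ} (hF : Free t E) {f : W → V}
    (hf : f.Injective) : Free t (fun a b c => E (f a) (f b) (f c)) := by
  intro a b x y hxy h1 h2
  refine lt_of_le_of_lt ?_ (hF (f a) (f b) (f x) (f y) (hf.ne hxy) h1 h2)
  rw [← Finset.card_image_of_injective _ hf]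
  refine Finset.card_le_card fun z hz => ?_
  obtain ⟨w, hw, rfl⟩ := Finset.mem_image.1 hz
  simp only [mem_filter, mem_univ, true_and] at hw ⊢
  exact ⟨hw.1, hf.ne hw.2.1, hf.ne hw.2.2⟩

lemma cnt_delete (h : IsTriple E) (v : V) :
    cnt E univ univ univ = cnt (fun a b c : {w // w ≠ v} => E a b c) univ univ univ +
      3 * deg E v := by
  have hd : Disjoint {v} (univ \ {v} : Finset V) := Finset.disjoint_sdiff
  have hU : {v} ∪ (univ \ {v}) = (univ : Finset V) :=
    Finset.union_sdiff_of_subset (Finset.subset_univ _)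
  have e1 := cnt_cube_union h hd
  have e2 := cnt_sq_union (R := {v}) h hd
  rw [hU] at e1 e2
  have z : ∀ S : Finset V, cnt E {v} {v} S = 0 := fun S => by
    rw [cnt, Finset.sum_singleton, Finset.sum_singleton]
    exact Finset.sum_eq_zero fun z _ => if_neg fun H => h.ne H rfl
  have z' : cnt E (univ \ {v}) {v} {v} = 0 := by rw [cnt_rot h]; exact z _
  have hs : ∀ g : V → ℝ, ∑ x ∈ univ \ {v}, g x = ∑ x : {w // w ≠ v}, g x := fun g =>
    Finset.sum_subtype _ (fun x => by simp) g
  have e3 : cnt E (univ \ {v}) (univ \ {v}) (univ \ {v}) =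
      cnt (fun a b c : {w // w ≠ v} => E a b c) univ univ univ := by
    simp only [cnt, hs]
    rfl
  rw [z, z', e3] at e1
  rw [z, z] at e2
  rw [e1, deg, e2]
  ring

end Deletion

lemma increment_bound {N q d : ℝ} (hN : 10 ^ 21 ≤ N) (hq : N / 3 - 1 ≤ q)
    (hd : d ≤ (2 / 9 - 0.00000000000000000001) * N ^ 2) : 3 * d + 6 ≤ 6 * (q * q) := by
  have h1 : (N / 3 - 1) * (N / 3 - 1) ≤ q * q :=
    mul_self_le_mul_self (by linarith) hq
  have h2 : 10 ^ 21 * N ≤ N * N := mul_le_mul_of_nonneg_right hN (by linarith)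
  linarith

/-- Deleting vertices of small degree one by one, the excess over the conjectured
maximum decreases until it vanishes. -/
lemma exists_cnt_le_excess (l : ℕ) : ∃ n₁ : ℕ, ∀ (k : ℕ) (V : Type) [Fintype V]
    (E : V → V → V → Prop), IsTriple E → Free (l + 1) E → Fintype.card V = n₁ + k →
    cnt E univ univ univ ≤
      6 * eT3plus (Fintype.card V) (l + 1) + 6 * max 0 ((n₁ : ℝ) ^ 3 - k) := by
  obtain ⟨n₀, hn₀⟩ := cnt_le_of_deg l
  refine ⟨n₀ + 10 ^ 21, fun k => ?_⟩
  obtain ⟨n₁, hn₁⟩ : ∃ n₁, n₁ = n₀ + 10 ^ 21 := ⟨_, rfl⟩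
  have hn₁' : (10 ^ 21 : ℝ) ≤ n₁ := by
    have : (n₁ : ℝ) = n₀ + 10 ^ 21 := by exact_mod_cast hn₁
    have : (0 : ℝ) ≤ n₀ := Nat.cast_nonneg n₀
    linarith
  have hn₀₁ : n₀ ≤ n₁ := hn₁ ▸ Nat.le_add_right _ _
  rw [← hn₁]
  clear hn₁
  induction k with
  | zero =>
    intro V _ E h hF hV
    have h1 := cnt_le_card E univ univ univ
    rw [Finset.card_univ, hV, Nat.add_zero] at h1
    rw [Nat.cast_zero, sub_zero]
    have h2 := le_max_right (0 : ℝ) ((n₁ : ℝ) ^ 3)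
    have h3 : (0 : ℝ) ≤ (eT3plus (Fintype.card V) (l + 1) : ℝ) := Nat.cast_nonneg _
    have h4 : (0 : ℝ) ≤ (n₁ : ℝ) ^ 3 := by positivity
    linarith
  | succ k ih =>
    intro V _ E h hF hV
    by_cases hdeg : ∀ v, (2 / 9 - 0.00000000000000000001) * (Fintype.card V : ℝ) ^ 2 ≤ deg E v
    · have h1 := hn₀ V E h hF (by omega) hdeg
      have h2 := le_max_left (0 : ℝ) ((n₁ : ℝ) ^ 3 - (k + 1 : ℕ))
      linarith
    · push Not at hdeg
      obtain ⟨v, hv⟩ := hdeg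
      have hW : Fintype.card {w // w ≠ v} = n₁ + k := by
        rw [Fintype.card_subtype_compl, Fintype.card_subtype_eq, hV]
        omega
      have h1 := ih {w // w ≠ v} _ (h.restrict Subtype.val) (hF.restrict Subtype.val_injective) hW
      rw [cnt_delete h v]
      rw [hW] at h1
      rw [hV] at hv ⊢
      have h2 := eT3plus_add_sq_le (n₁ + k) (l + 1)
      have h2' : (eT3plus (n₁ + k) (l + 1) : ℝ) + ((n₁ + k) / 3 : ℕ) * ((n₁ + k) / 3 : ℕ) ≤
          eT3plus (n₁ + k + 1) (l + 1) := by exact_mod_cast h2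
      have h3 : n₁ + (k + 1) ≤ 3 * ((n₁ + k) / 3) + 3 := by omega
      have h3' : ((n₁ + (k + 1) : ℕ) : ℝ) ≤ 3 * ((n₁ + k) / 3 : ℕ) + 3 := by exact_mod_cast h3
      have h4 : (10 ^ 21 : ℝ) ≤ (n₁ + (k + 1) : ℕ) :=
        hn₁'.trans (Nat.cast_le.2 (Nat.le_add_right _ _))
      have h5 := increment_bound (q := ((n₁ + k) / 3 : ℕ)) h4 (by linarith) hv.le
      have h6 : max 0 ((n₁ : ℝ) ^ 3 - k) ≤ max 0 ((n₁ : ℝ) ^ 3 - (k + 1 : ℕ)) + 1 := by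
        have h7 := le_max_left (0 : ℝ) ((n₁ : ℝ) ^ 3 - (k + 1 : ℕ))
        have h8 := le_max_right (0 : ℝ) ((n₁ : ℝ) ^ 3 - (k + 1 : ℕ))
        rw [Nat.cast_succ] at h7 h8 ⊢
        exact max_le (by linarith) (by linarith)
      rw [← add_assoc n₁ k 1]
      linarith

end Packing

theorem statement0 (t : ℕ) (ht : 1 ≤ t) :
    ∃ n0 : ℕ, ∀ n : ℕ, n ≥ n0 → exThree n (F5b5 t) = eT3plus n t := by
  obtain ⟨l, rfl⟩ : ∃ l, t = l + 1 := ⟨t - 1, by omega⟩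
  obtain ⟨n₁, hn₁⟩ := Packing.exists_cnt_le_excess l
  refine ⟨n₁ + n₁ ^ 3, fun n hn => le_antisymm ?_ (Packing.eT3plus_le_exThree n (l + 1) ht)⟩
  refine csSup_le' ?_
  rintro k ⟨H, hH, hF, rfl⟩
  rw [Packing.hasCopy_iff hH, not_not] at hF
  have h1 := hn₁ (n - n₁) (Fin n) _ (Packing.edgeRel_isTriple hH) hF
    (by rw [Fintype.card_fin]; omega)
  have h2 : ((n₁ ^ 3 : ℕ) : ℝ) ≤ (n - n₁ : ℕ) := Nat.cast_le.2 (by omega)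
  rw [Packing.six_card_cnt hH, Fintype.card_fin,
    max_eq_left (by push_cast at h2 ⊢; linarith)] at h1
  have h3 : (#H : ℝ) ≤ eT3plus n (l + 1) := by linarith
  exact_mod_cast h3
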